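/- Assume ∂D is of class C^{1,1}, assume (S3) holds, and let 1 ≤ p ≤ q ≤ ∞ with conjugate exponents p′ = p/(p−1) and q′ = q/(q−1). Let u ∈ W^{2,q}(D_ε; ω^ε) satisfy u = 0 on ∂D, and let v ∈ W^{1,p′}(D_ε; ω^ε). Then there exists a constant C independent of ε, u and v such that ∫_{Γ_ε} u v |∇ω^ε| dx ≤ C ( ε^{1+1/q′} ‖u‖_{W^{2,q}(D_ε;ω^ε)} + ε^{1+1/p} ‖u‖_{W^{2,p}(D_ε;ω^ε)} ) ‖v‖_{W^{1,p′}(D_ε;ω^ε)}. -/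

import Mathlib

open MeasureTheory ENNReal Set Filter Topology
open scoped RealInnerProductSpace

noncomputable section

/-- The weighted measure `w dx` restricted to the set `U`. -/
def wMeas {n : ℕ} (U : Set (EuclideanSpace ℝ (Fin n)))
    (w : EuclideanSpace ℝ (Fin n) → ℝ) : Measure (EuclideanSpace ℝ (Fin n)) :=
  (volume.restrict U).withDensity fun x => ENNReal.ofReal (w x)

theorem volume_le_of_expanding_on {n : ℕ} {A B : Set (EuclideanSpace ℝ (Fin n))}
    {Φ : EuclideanSpace ℝ (Fin n) → EuclideanSpace ℝ (Fin n)} {K : NNReal}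
    (hΦ : ∀ x ∈ A, ∀ y ∈ A, dist x y ≤ K * dist (Φ x) (Φ y)) (hAB : MapsTo Φ A B) :
    volume A ≤ (K : ℝ≥0∞) ^ n * volume B := by
  have hinj : InjOn Φ A := fun x hx y hy h => by
    have := hΦ x hx y hy
    rw [h, dist_self, mul_zero] at this
    exact dist_le_zero.1 this
  have hlip : LipschitzOnWith K (Function.invFunOn Φ A) (Φ '' A) := by
    refine LipschitzOnWith.of_dist_le_mul ?_
    rintro _ ⟨x, hx, rfl⟩ _ ⟨y, hy, rfl⟩
    rw [hinj.leftInvOn_invFunOn hx, hinj.leftInvOn_invFunOn hy]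
    exact hΦ x hx y hy
  have himg : Function.invFunOn Φ A '' (Φ '' A) = A := hinj.invFunOn_image Subset.rfl
  have h1 := hlip.hausdorffMeasure_image_le (d := (n : ℝ)) (by positivity)
  rw [himg] at h1
  have : (Measure.hausdorffMeasure (n : ℝ) : Measure
      (EuclideanSpace ℝ (Fin n))).IsAddHaarMeasure := by
    simpa using MeasureTheory.isAddHaarMeasure_hausdorffMeasure (E := EuclideanSpace ℝ (Fin n))
  have h2 := Measure.isAddLeftInvariant_eq_smul (volume : Measure (EuclideanSpace ℝ (Fin n)))
    (Measure.hausdorffMeasure (n : ℝ))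
  rw [h2]
  simp only [Measure.smul_apply]
  rw [mul_smul_comm]
  gcongr
  refine h1.trans ?_
  rw [ENNReal.rpow_natCast]
  gcongr
  exact image_subset_iff.2 hAB

theorem lintegral_comp_le_of_expanding_on {n : ℕ} {A B : Set (EuclideanSpace ℝ (Fin n))}
    {Φ : EuclideanSpace ℝ (Fin n) → EuclideanSpace ℝ (Fin n)} {K : NNReal}
    (hΦm : Measurable Φ) (hΦ : ∀ x ∈ A, ∀ y ∈ A, dist x y ≤ K * dist (Φ x) (Φ y))
    (hAB : MapsTo Φ A B) {g : EuclideanSpace ℝ (Fin n) → ℝ≥0∞} (hg : Measurable g) :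
    ∫⁻ x in A, g (Φ x) ≤ (K : ℝ≥0∞) ^ n * ∫⁻ y in B, g y := by
  have hle : (volume.restrict A).map Φ ≤ ((K : ℝ≥0∞) ^ n) • volume.restrict B := by
    refine Measure.le_iff.2 fun s hs => ?_
    rw [Measure.map_apply hΦm hs, Measure.restrict_apply (hΦm hs), Measure.smul_apply,
      Measure.restrict_apply hs, smul_eq_mul]
    exact volume_le_of_expanding_on (fun x hx y hy => hΦ x hx.2 y hy.2)
      fun x hx => ⟨hx.1, hAB hx.2⟩
  calc ∫⁻ x in A, g (Φ x) = ∫⁻ y, g y ∂((volume.restrict A).map Φ) := (lintegral_map hg hΦm).symm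
    _ ≤ ∫⁻ y, g y ∂(((K : ℝ≥0∞) ^ n) • volume.restrict B) := lintegral_mono' hle le_rfl
    _ = _ := lintegral_smul_measure _ _

/-- Change of variables along a family of uniformly expanding maps, integrated in the parameter. -/
theorem lintegral_family_le_of_expanding_on {n : ℕ} {δ : ℝ}
    {A : ℝ → Set (EuclideanSpace ℝ (Fin n))} {B : Set (EuclideanSpace ℝ (Fin n))}
    {Φ : ℝ → EuclideanSpace ℝ (Fin n) → EuclideanSpace ℝ (Fin n)} {K : NNReal}
    (hA : ∀ s ∈ Ioc 0 δ, MeasurableSet (A s)) (hB : MeasurableSet B) (hΦm : ∀ s, Measurable (Φ s))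
    (hΦ : ∀ s ∈ Ioc 0 δ, ∀ x ∈ A s, ∀ y ∈ A s, dist x y ≤ K * dist (Φ s x) (Φ s y))
    (hAB : ∀ s ∈ Ioc 0 δ, MapsTo (Φ s) (A s) B)
    {κ : EuclideanSpace ℝ (Fin n) → ℝ≥0∞} {κ' : EuclideanSpace ℝ (Fin n) → ℝ → ℝ≥0∞}
    (hκ' : Measurable (Function.uncurry κ'))
    (hκ : ∀ s ∈ Ioc 0 δ, ∀ x ∈ A s, κ x ≤ κ' (Φ s x) s)
    {W : EuclideanSpace ℝ (Fin n) → ℝ≥0∞} (hW : ∀ y ∈ B, ∫⁻ s in Ioc 0 δ, κ' y s ≤ W y)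
    {H : EuclideanSpace ℝ (Fin n) → ℝ≥0∞} (hH : Measurable H) :
    ∫⁻ s in Ioc 0 δ, ∫⁻ x in A s, κ x * H (Φ s x) ≤ (K : ℝ≥0∞) ^ n * ∫⁻ y in B, W y * H y := by
  calc ∫⁻ s in Ioc 0 δ, ∫⁻ x in A s, κ x * H (Φ s x)
      ≤ ∫⁻ s in Ioc 0 δ, (K : ℝ≥0∞) ^ n * ∫⁻ y in B, κ' y s * H y := by
        refine setLIntegral_mono' measurableSet_Ioc fun s hs => ?_
        refine (setLIntegral_mono' (hA s hs) (g := fun x => κ' (Φ s x) s * H (Φ s x))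
          fun x hx => ?_).trans ?_
        · gcongr
          exact hκ s hs x hx
        · exact lintegral_comp_le_of_expanding_on (g := fun y => κ' y s * H y) (hΦm s)
            (hΦ s hs) (hAB s hs) ((hκ'.comp (measurable_id.prodMk measurable_const)).mul hH)
    _ = (K : ℝ≥0∞) ^ n * ∫⁻ s in Ioc 0 δ, ∫⁻ y in B, κ' y s * H y :=
        lintegral_const_mul' _ _ (by finiteness)
    _ = (K : ℝ≥0∞) ^ n * ∫⁻ y in B, ∫⁻ s in Ioc 0 δ, κ' y s * H y := by
        congr 1
        refine lintegral_lintegral_swap (Measurable.aemeasurable ?_)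
        exact ((hκ'.comp measurable_swap).mul (hH.comp measurable_snd))
    _ ≤ _ := by
        gcongr _ * ?_
        refine setLIntegral_mono' hB fun y hy => ?_
        rw [lintegral_mul_const _ (hκ'.of_uncurry_left (x := y))]
        gcongr
        exact hW y hy

theorem enorm_sub_le_lintegral_fderiv {E F : Type*} [NormedAddCommGroup E] [NormedSpace ℝ E]
    [NormedAddCommGroup F] [NormedSpace ℝ F] [CompleteSpace F] {w : E → F} {x e : E} {s : ℝ}
    (hs : 0 ≤ s) (he : ‖e‖ ≤ 1) (hw : ∀ t ∈ Icc (0 : ℝ) s, DifferentiableAt ℝ w (x + t • e)) :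
    ‖w (x + s • e) - w x‖ₑ ≤ ∫⁻ t in Ioc 0 s, ‖fderiv ℝ w (x + t • e)‖ₑ := by
  by_cases hfin : ∫⁻ t in Ioc 0 s, ‖fderiv ℝ w (x + t • e)‖ₑ = ⊤
  · rw [hfin]; exact le_top
  have hd : ∀ t ∈ Icc (0 : ℝ) s,
      HasDerivAt (fun t : ℝ => w (x + t • e)) (fderiv ℝ w (x + t • e) e) t := by
    intro t ht
    have h1 : HasDerivAt (fun t : ℝ => x + t • e) e t := by
      simpa using ((hasDerivAt_id t).smul_const e).const_add x
    exact (hw t ht).hasFDerivAt.comp_hasDerivAt t h1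
  have hle : ∀ t : ℝ, ‖fderiv ℝ w (x + t • e) e‖ₑ ≤ ‖fderiv ℝ w (x + t • e)‖ₑ := fun t => by
    rw [enorm_le_iff_norm_le]
    exact ((fderiv ℝ w (x + t • e)).le_opNorm e).trans
      (mul_le_of_le_one_right (norm_nonneg _) he)
  have hint : IntervalIntegrable (fun t => fderiv ℝ w (x + t • e) e) volume 0 s := by
    rw [intervalIntegrable_iff_integrableOn_Ioc_of_le hs]
    refine ⟨?_, ?_⟩
    · refine (stronglyMeasurable_deriv fun t : ℝ => w (x + t • e)).aestronglyMeasurable.congr ?_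
      filter_upwards [ae_restrict_mem measurableSet_Ioc] with t ht
      exact (hd t ⟨ht.1.le, ht.2⟩).deriv
    · exact (lintegral_mono fun t => hle t).trans_lt (lt_top_iff_ne_top.2 hfin)
  have := intervalIntegral.integral_eq_sub_of_hasDerivAt (f := fun t : ℝ => w (x + t • e))
    (by rwa [uIcc_of_le hs]) hint
  simp only [zero_smul, add_zero] at this
  rw [← this, intervalIntegral.integral_of_le hs]
  exact (enorm_integral_le_lintegral_enorm _).trans (lintegral_mono fun t => hle t)

/-- Jensen inequality for powers, on an interval. -/
theorem lintegral_Ioc_rpow_le {s r : ℝ} (hr : 1 ≤ r) {f : ℝ → ℝ≥0∞}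
    (hf : Measurable f) :
    (∫⁻ t in Ioc 0 s, f t) ^ r ≤ ENNReal.ofReal s ^ (r - 1) * ∫⁻ t in Ioc 0 s, f t ^ r := by
  rcases hr.eq_or_lt with rfl | hr
  · simp
  have hc : r.HolderConjugate (r / (r - 1)) := (Real.holderConjugate_iff_eq_conjExponent hr).2 rfl
  have h := ENNReal.lintegral_mul_le_Lp_mul_Lq (volume.restrict (Ioc 0 s)) hc hf.aemeasurable
    (g := fun _ => 1) aemeasurable_const
  have hr0 : 0 < r := by linarith
  simp only [Pi.mul_apply, mul_one, one_rpow, lintegral_const, Measure.restrict_apply_univ,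
    Real.volume_Ioc, sub_zero, one_mul] at h
  calc (∫⁻ t in Ioc 0 s, f t) ^ r ≤ ((∫⁻ t in Ioc 0 s, f t ^ r) ^ (1 / r) *
        ENNReal.ofReal s ^ (1 / (r / (r - 1)))) ^ r := by gcongr
    _ = _ := by
      rw [ENNReal.mul_rpow_of_nonneg _ _ hr0.le, ← ENNReal.rpow_mul, ← ENNReal.rpow_mul, mul_comm]
      congr 2
      · field_simp
      · rw [one_div_mul_cancel hr0.ne', ENNReal.rpow_one]

/-- `N` is the unit normal field of the level sets of `d` in the tube `|d| < ρ`: it is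
`L`-Lipschitz there and constant along the normal lines, on which `d` grows at unit speed. -/
structure IsNormalTube {n : ℕ} (d : EuclideanSpace ℝ (Fin n) → ℝ)
    (N : EuclideanSpace ℝ (Fin n) → EuclideanSpace ℝ (Fin n)) (ρ L : ℝ) : Prop where
  nonneg : 0 ≤ L
  continuous : Continuous d
  measurable : Measurable N
  norm_eq : ∀ x, |d x| < ρ → ‖N x‖ = 1
  norm_sub_le : ∀ x y, |d x| < ρ → |d y| < ρ → ‖N x - N y‖ ≤ L * ‖x - y‖
  flow : ∀ x s, |d x| < ρ → |d x + s| < ρ → d (x + s • N x) = d x + s ∧ N (x + s • N x) = N x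

namespace IsNormalTube

variable {n : ℕ} {d : EuclideanSpace ℝ (Fin n) → ℝ}
  {N : EuclideanSpace ℝ (Fin n) → EuclideanSpace ℝ (Fin n)} {ρ L : ℝ}

theorem neg (h : IsNormalTube d N ρ L) : IsNormalTube (fun x => -d x) (fun x => -N x) ρ L where
  nonneg := h.nonneg
  continuous := h.continuous.neg
  measurable := h.measurable.neg
  norm_eq x hx := by
    rw [abs_neg] at hx
    rw [norm_neg]; exact h.norm_eq x hx
  norm_sub_le x y hx hy := by
    rw [abs_neg] at hx hy
    rw [neg_sub_neg, norm_sub_rev]; exact h.norm_sub_le x y hx hy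
  flow x s hx hs := by
    rw [abs_neg] at hx
    have := h.flow x (-s) hx (by rw [← abs_neg]; simpa [add_comm] using hs)
    rw [smul_neg, ← neg_smul, this.1, this.2]
    exact ⟨by ring, rfl⟩

theorem measurable_shift (h : IsNormalTube d N ρ L) (s : ℝ) : Measurable fun x => x + s • N x :=
  measurable_id.add (h.measurable.const_smul s)

theorem measurableSet_tube (h : IsNormalTube d N ρ L) (r : ℝ) : MeasurableSet {x | |d x| < r} :=
  (isOpen_lt h.continuous.abs continuous_const).measurableSet

theorem dist_le (h : IsNormalTube d N ρ L) {s : ℝ} (hs : |s| * L ≤ 1 / 2)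
    {x y : EuclideanSpace ℝ (Fin n)} (hx : |d x| < ρ) (hy : |d y| < ρ) :
    dist x y ≤ (1 + 2 * (|s| * L)) * dist (x + s • N x) (y + s • N y) := by
  have h1 : ‖x - y‖ ≤ ‖(x + s • N x) - (y + s • N y)‖ + |s| * L * ‖x - y‖ := by
    calc ‖x - y‖ = ‖((x + s • N x) - (y + s • N y)) - s • (N x - N y)‖ := by
          congr 1; rw [smul_sub]; abel
      _ ≤ ‖(x + s • N x) - (y + s • N y)‖ + |s| * ‖N x - N y‖ := by
          rw [← Real.norm_eq_abs, ← norm_smul]; exact _root_.norm_sub_le _ _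
      _ ≤ _ := by
          rw [mul_assoc]
          gcongr
          exact h.norm_sub_le x y hx hy
  rw [dist_eq_norm, dist_eq_norm]
  have h0 : 0 ≤ |s| * L := mul_nonneg (abs_nonneg _) h.nonneg
  nlinarith [norm_nonneg (x - y), mul_nonneg h0 (norm_nonneg (x - y)),
    mul_nonneg (mul_nonneg h0 (norm_nonneg (x - y))) (sub_nonneg.2 hs)]

theorem lintegral_shift_le (h : IsNormalTube d N ρ L) {A B : Set (EuclideanSpace ℝ (Fin n))}
    {s c : ℝ} (hs : |s| * L ≤ 1 / 2) (hc : 1 + 2 * (|s| * L) ≤ c) (hA : ∀ x ∈ A, |d x| < ρ)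
    (hAB : MapsTo (fun x => x + s • N x) A B) {g : EuclideanSpace ℝ (Fin n) → ℝ≥0∞}
    (hg : Measurable g) :
    ∫⁻ x in A, g (x + s • N x) ≤ ENNReal.ofReal (c ^ n) * ∫⁻ y in B, g y := by
  have h0 : 0 ≤ |s| * L := mul_nonneg (abs_nonneg _) h.nonneg
  have hc0 : 0 ≤ c := by linarith
  have := lintegral_comp_le_of_expanding_on (K := c.toNNReal) (h.measurable_shift s)
    (fun x hx y hy => ?_) hAB hg
  · rwa [ENNReal.ofReal_pow hc0]
  · rw [Real.coe_toNNReal _ hc0]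
    exact (h.dist_le hs (hA x hx) (hA y hy)).trans (by gcongr)

theorem lintegral_le_shift (h : IsNormalTube d N ρ L) {ε r s : ℝ} (hs0 : 0 ≤ s)
    (hs : s * L ≤ 1 / 2) (hεr : ε + s ≤ r) (hr : r + s ≤ ρ)
    {g : EuclideanSpace ℝ (Fin n) → ℝ≥0∞}
    (hg : Measurable g) (hg0 : ∀ x, ε ≤ |d x| → g x = 0) :
    ∫⁻ x, g x ≤
      ENNReal.ofReal ((1 + 2 * (s * L)) ^ n) * ∫⁻ x in {x | |d x| < r}, g (x + s • N x) := by
  have key : ∀ y, |d y| < ε → |d y| < ρ ∧ |d y + -s| < r ∧ |d y + -s| < ρ := fun y hy => by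
    rw [abs_lt] at hy
    refine ⟨abs_lt.2 ⟨?_, ?_⟩, abs_lt.2 ⟨?_, ?_⟩, abs_lt.2 ⟨?_, ?_⟩⟩ <;> linarith
  have h1 := h.lintegral_shift_le (A := {x | |d x| < ε}) (B := {x | |d x| < r}) (s := -s)
    (c := 1 + 2 * (s * L)) (g := fun x => g (x + s • N x)) (by rwa [abs_neg, abs_of_nonneg hs0])
    (by rw [abs_neg, abs_of_nonneg hs0]) (fun y hy => (key y hy).1) (fun y hy => ?_)
    (hg.comp (h.measurable_shift s))
  · refine le_trans (le_of_eq ?_) h1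
    rw [← setLIntegral_univ, ← inter_univ {x | |d x| < ε},
      ← setLIntegral_indicator (h.measurableSet_tube ε), setLIntegral_univ]
    rw [setLIntegral_univ]
    refine lintegral_congr fun y => ?_
    by_cases hy : |d y| < ε
    · rw [indicator_of_mem (by exact hy), (h.flow y (-s) (key y hy).1 (key y hy).2.2).2]
      congr 1
      rw [neg_smul]; abel
    · rw [indicator_of_notMem (by exact hy), hg0 y (not_lt.1 hy)]
  · show |d _| < r
    rw [(h.flow y (-s) (key y hy).1 (key y hy).2.2).1]
    exact (key y hy).2.1

/-- Shifting along the normals distorts the integral by a factor close to `1`. -/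
theorem abs_integral_shift_sub_le (h : IsNormalTube d N ρ L) {ε r s : ℝ} (hs0 : 0 ≤ s)
    (hs : s * L ≤ 1 / 2) (hεr : ε + s ≤ r) (hr : r + s ≤ ρ) {f : EuclideanSpace ℝ (Fin n) → ℝ}
    (hfm : Measurable f) (hf : Integrable f) (hf0 : ∀ x, ε ≤ |d x| → f x = 0) :
    IntegrableOn (fun x => f (x + s • N x)) {x | |d x| < r} ∧
    |(∫ x in {x | |d x| < r}, f (x + s • N x)) - ∫ x, f x| ≤
      ((1 + 2 * (s * L)) ^ n - 1) * ∫ x, |f x| := by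
  set c : ℝ := (1 + 2 * (s * L)) ^ n with hc
  have hL := h.nonneg
  have hc1 : 1 ≤ c := one_le_pow₀ (by have := mul_nonneg hs0 hL; linarith)
  have up : ∀ g : EuclideanSpace ℝ (Fin n) → ℝ≥0∞, Measurable g →
      ∫⁻ x in {x | |d x| < r}, g (x + s • N x) ≤ ENNReal.ofReal c * ∫⁻ x, g x := fun g hg => by
    have := h.lintegral_shift_le (A := {x | |d x| < r}) (B := univ) (s := s)
      (by rwa [abs_of_nonneg hs0]) (le_of_eq (by rw [abs_of_nonneg hs0]))
      (fun x hx => lt_of_lt_of_le hx (by linarith)) (mapsTo_univ _ _) hg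
    rwa [setLIntegral_univ] at this
  have hint : IntegrableOn (fun x => f (x + s • N x)) {x | |d x| < r} := by
    refine ⟨(hfm.comp (h.measurable_shift s)).aestronglyMeasurable, ?_⟩
    exact (up (fun x => ‖f x‖ₑ) hfm.enorm).trans_lt (ENNReal.mul_lt_top ofReal_lt_top hf.2)
  have part : ∀ g : EuclideanSpace ℝ (Fin n) → ℝ, Measurable g → Integrable g →
      (∀ x, ε ≤ |d x| → g x = 0) →
      |(∫⁻ x in {x | |d x| < r}, ENNReal.ofReal (g (x + s • N x))).toReal -
        (∫⁻ x, ENNReal.ofReal (g x)).toReal| ≤ (c - 1) * (∫⁻ x, ENNReal.ofReal (g x)).toReal := by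
    intro g hgm hg hg0
    have hfin : ∫⁻ x, ENNReal.ofReal (g x) ≠ ⊤ := hg.lintegral_lt_top.ne
    have h1 := up (fun x => ENNReal.ofReal (g x)) hgm.ennreal_ofReal
    have h2 := h.lintegral_le_shift hs0 hs hεr hr hgm.ennreal_ofReal
      (fun x hx => by rw [hg0 x hx, ofReal_zero])
    have hfin' := ne_top_of_le_ne_top (ENNReal.mul_ne_top ofReal_ne_top hfin) h1
    have h1' := ENNReal.toReal_mono (ENNReal.mul_ne_top ofReal_ne_top hfin) h1
    have h2' := ENNReal.toReal_mono (ENNReal.mul_ne_top ofReal_ne_top hfin') h2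
    rw [ENNReal.toReal_mul, ENNReal.toReal_ofReal (by linarith)] at h1' h2'
    rw [← hc] at h2'
    set P := (∫⁻ x, ENNReal.ofReal (g x)).toReal
    set P' := (∫⁻ x in {x | |d x| < r}, ENNReal.ofReal (g (x + s • N x))).toReal
    rw [abs_le]
    constructor <;> nlinarith [mul_le_mul_of_nonneg_left h1' (sub_nonneg.2 hc1)]
  refine ⟨hint, ?_⟩
  have e1 := part f hfm hf hf0
  have e2 := part (fun x => -f x) hfm.neg hf.neg (fun x hx => by rw [hf0 x hx, neg_zero])
  rw [integral_eq_lintegral_pos_part_sub_lintegral_neg_part hint,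
    integral_eq_lintegral_pos_part_sub_lintegral_neg_part hf]
  have e3 : ∫ x, |f x| = (∫⁻ x, ENNReal.ofReal (f x)).toReal +
      (∫⁻ x, ENNReal.ofReal (-f x)).toReal := by
    rw [integral_eq_lintegral_of_nonneg_ae (ae_of_all _ fun x => abs_nonneg _)
      hfm.norm.aestronglyMeasurable, ← ENNReal.toReal_add hf.lintegral_lt_top.ne
      (show ∫⁻ x, ENNReal.ofReal (-f x) ≠ ⊤ from hf.neg.lintegral_lt_top.ne),
      ← lintegral_add_left hfm.ennreal_ofReal]
    congr 2 with x
    rcases le_total 0 (f x) with hx | hx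
    · rw [abs_of_nonneg hx, ENNReal.ofReal_of_nonpos (neg_nonpos.2 hx), add_zero]
    · rw [abs_of_nonpos hx, ENNReal.ofReal_of_nonpos hx, zero_add]
  rw [e3, mul_add]
  refine le_trans ?_ (add_le_add e1 e2)
  refine le_trans (le_of_eq ?_) (abs_sub _ _)
  congr 1
  ring


theorem one_add_pow_le {y : ℝ} (hy0 : 0 ≤ y) (hy : y ≤ 1) (n : ℕ) :
    (1 + y) ^ n ≤ 1 + 3 ^ n * y := by
  induction n with
  | zero => simpa using hy0
  | succ k ih =>
    have h3 : (1 : ℝ) ≤ 3 ^ k := one_le_pow₀ (by norm_num)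
    calc (1 + y) ^ (k + 1) = (1 + y) ^ k * (1 + y) := pow_succ _ _
      _ ≤ (1 + 3 ^ k * y) * (1 + y) := by gcongr
      _ ≤ 1 + 3 ^ (k + 1) * y := by
        rw [pow_succ]
        nlinarith [mul_nonneg (mul_nonneg (zero_le_one.trans h3) hy0) (sub_nonneg.2 hy),
          mul_nonneg hy0 (sub_nonneg.2 h3)]

/-- Integration by parts along the normal lines: if `F` is the normal derivative of `f`, the
integral of `F` is controlled by that of `f`, since the level sets have bounded curvature. -/
theorem abs_integral_normal_deriv_le (h : IsNormalTube d N ρ L) {ε : ℝ} (hε : ε < ρ)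
    {f F : EuclideanSpace ℝ (Fin n) → ℝ} (hfm : Measurable f) (hf : Integrable f)
    (hFm : Measurable F) (hF : Integrable F) (hf0 : ∀ x, ε ≤ |d x| → f x = 0)
    (hF0 : ∀ x, ε ≤ |d x| → F x = 0)
    (hcont : ∀ x, |d x| < ρ → ∀ s, |d x + s| < ρ →
      ContinuousAt (fun s : ℝ => f (x + s • N x)) s)
    {T : Set ℝ} (hT : T.Countable)
    (hder : ∀ x, |d x| < ρ → ∀ s, |d x + s| < ρ → d x + s ∉ T →
      HasDerivAt (fun s : ℝ => f (x + s • N x)) (F (x + s • N x)) s) :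
    |∫ x, F x| ≤ 3 ^ n * (2 * L) * ∫ x, |f x| := by
  have hL := h.nonneg
  set C : ℝ := 3 ^ n * (2 * L) with hC
  set r : ℝ := (ε + ρ) / 2 with hr
  have step : ∀ᶠ s : ℝ in 𝓝[>] 0, |∫ x, F x| ≤ C * (∫ x, |f x|) + C * s * ∫ x, |F x| := by
    have hlim : ∀ᶠ s : ℝ in 𝓝 0, s * (2 * L) < 1 := by
      have : Tendsto (fun s : ℝ => s * (2 * L)) (𝓝 0) (𝓝 (0 * (2 * L))) :=
        tendsto_id.mul_const _
      exact this.eventually (gt_mem_nhds (by simp))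
    have hsm : ∀ᶠ s : ℝ in 𝓝 0, s < (ρ - ε) / 2 := gt_mem_nhds (by linarith)
    filter_upwards [self_mem_nhdsWithin, nhdsWithin_le_nhds hlim, nhdsWithin_le_nhds hsm]
      with s (hs0 : 0 < s) hsL hsr
    set A : Set (EuclideanSpace ℝ (Fin n)) := {x | |d x| < r} with hA
    have hAm : MeasurableSet A := h.measurableSet_tube r
    have hdist : ∀ t ∈ Icc 0 s, ∀ g : EuclideanSpace ℝ (Fin n) → ℝ, Measurable g →
        Integrable g → (∀ x, ε ≤ |d x| → g x = 0) →
        IntegrableOn (fun x => g (x + t • N x)) A ∧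
        |(∫ x in A, g (x + t • N x)) - ∫ x, g x| ≤ C * s * ∫ x, |g x| := by
      intro t ht g hgm hg hg0
      have htL : t * L ≤ s * L := mul_le_mul_of_nonneg_right ht.2 hL
      have h1 := h.abs_integral_shift_sub_le (r := r) ht.1 (by linarith) (by linarith [ht.2])
        (by linarith [ht.2]) hgm hg hg0
      refine ⟨h1.1, h1.2.trans (mul_le_mul_of_nonneg_right ?_
        (integral_nonneg fun x => abs_nonneg _))⟩
      have h2 := one_add_pow_le (y := 2 * (t * L)) (by have := mul_nonneg ht.1 hL; linarith)
        (by linarith) n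
      have h3 : (3 : ℝ) ^ n * (2 * (t * L)) ≤ 3 ^ n * (2 * (s * L)) := by gcongr
      rw [hC]
      linarith
    have hjoint : Measurable fun z : EuclideanSpace ℝ (Fin n) × ℝ => F (z.1 + z.2 • N z.1) :=
      hFm.comp (measurable_fst.add (measurable_snd.smul (h.measurable.comp measurable_fst)))
    have hprod : Integrable (fun z : EuclideanSpace ℝ (Fin n) × ℝ => F (z.1 + z.2 • N z.1))
        ((volume.restrict A).prod (volume.restrict (Ioc 0 s))) := by
      rw [integrable_prod_iff' hjoint.aestronglyMeasurable]
      refine ⟨?_, ?_⟩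
      · filter_upwards [ae_restrict_mem measurableSet_Ioc] with t ht
        exact (hdist t ⟨ht.1.le, ht.2⟩ F hFm hF hF0).1
      · refine Integrable.mono' (g := fun _ => C * s * (∫ x, |(|F x|)|) + ∫ x, |F x|)
          (integrable_const _) ?_ ?_
        · exact (hjoint.norm.stronglyMeasurable.integral_prod_left
            (μ := volume.restrict A)).aestronglyMeasurable
        · filter_upwards [ae_restrict_mem measurableSet_Ioc] with t ht
          have := (hdist t ⟨ht.1.le, ht.2⟩ (fun x => |F x|) hFm.norm hF.norm
            fun x hx => by rw [hF0 x hx, abs_zero]).2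
          rw [Real.norm_of_nonneg (integral_nonneg fun x => norm_nonneg _)]
          have := (abs_le.1 this).2
          simp only [Real.norm_eq_abs]
          linarith
    have hline : ∀ᵐ x ∂volume.restrict A,
        ∫ t in Ioc 0 s, F (x + t • N x) = f (x + s • N x) - f x := by
      filter_upwards [hprod.prod_right_ae, ae_restrict_mem hAm] with x hx hxA
      have hxρ : |d x| < ρ := lt_of_lt_of_le hxA (by linarith)
      have hts : ∀ t ∈ Icc 0 s, |d x + t| < ρ := fun t ht =>
        (abs_add_le _ _).trans_lt (by
          rw [abs_of_nonneg ht.1]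
          have : |d x| < r := hxA
          linarith [ht.2])
      rw [← intervalIntegral.integral_of_le hs0.le]
      have := integral_eq_of_hasDerivAt_off_countable_of_le
        (fun t : ℝ => f (x + t • N x)) (fun t => F (x + t • N x)) hs0.le
        (s := (fun t => d x + t) ⁻¹' T) (hT.preimage (add_right_injective (d x)))
        (fun t ht => (hcont x hxρ t (hts t ht)).continuousWithinAt)
        (fun t ht => hder x hxρ t (hts t ⟨ht.1.1.le, ht.1.2.le⟩) ht.2)
        (by rw [intervalIntegrable_iff_integrableOn_Ioc_of_le hs0.le]; exact hx)
      simpa using this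
    have hs00 : s ∈ Icc 0 s := ⟨hs0.le, le_rfl⟩
    have hf1 := hdist s hs00 f hfm hf hf0
    have hfA : ∫ x in A, f x = ∫ x, f x :=
      setIntegral_eq_integral_of_forall_compl_eq_zero fun x hx => hf0 x (by
        have : r ≤ |d x| := not_lt.1 hx
        linarith)
    have hdiff : ∫ t in Ioc 0 s, ∫ x in A, F (x + t • N x) =
        (∫ x in A, f (x + s • N x)) - ∫ x, f x := by
      rw [← hfA, ← integral_sub hf1.1 hf.integrableOn, ← integral_congr_ae hline]
      exact (integral_integral_swap hprod).symm
    have hmain : |(∫ t in Ioc 0 s, ∫ x in A, F (x + t • N x)) - s * ∫ x, F x| ≤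
        C * s * (∫ x, |F x|) * s := by
      have hi : IntegrableOn (fun t => ∫ x in A, F (x + t • N x)) (Ioc 0 s) :=
        hprod.integral_prod_right
      have hconst : s * ∫ x, F x = ∫ _ in Ioc 0 s, ∫ x, F x := by
        simp [hs0.le]
      rw [hconst, ← integral_sub hi (integrable_const _), ← Real.norm_eq_abs]
      have := norm_setIntegral_le_of_norm_le_const (μ := volume) (s := Ioc 0 s)
        (f := fun t => (∫ x in A, F (x + t • N x)) - ∫ x, F x) (C := C * s * ∫ x, |F x|)
        (by simp) (fun t ht => (hdist t ⟨ht.1.le, ht.2⟩ F hFm hF hF0).2)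
      simpa [hs0.le] using this
    rw [hdiff] at hmain
    have h1 := hf1.2
    have h2 : s * |∫ x, F x| ≤ s * (C * (∫ x, |f x|) + C * s * ∫ x, |F x|) := by
      rw [← abs_of_pos hs0, ← abs_mul, abs_of_pos hs0]
      rw [abs_le] at *
      constructor <;> linarith [h1.1, h1.2, hmain.1, hmain.2]
    exact le_of_mul_le_mul_left h2 hs0
  have hlim : Tendsto (fun s : ℝ => C * (∫ x, |f x|) + C * s * ∫ x, |F x|) (𝓝[>] 0)
      (𝓝 (C * (∫ x, |f x|) + C * 0 * ∫ x, |F x|)) := by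
    refine Tendsto.mono_left ?_ nhdsWithin_le_nhds
    exact (Continuous.tendsto (by fun_prop) 0)
  simpa using ge_of_tendsto hlim step

end IsNormalTube

theorem rpow_enorm_le_lintegral_along {E F : Type*} [NormedAddCommGroup E] [NormedSpace ℝ E]
    [MeasurableSpace E] [BorelSpace E] [SecondCountableTopology E]
    [NormedAddCommGroup F] [NormedSpace ℝ F] [CompleteSpace F] {w : E → F} {x e : E} {δ r : ℝ}
    (hr : 1 ≤ r) (he : ‖e‖ ≤ 1)
    (hw : ∀ t ∈ Icc (0 : ℝ) δ, DifferentiableAt ℝ w (x + t • e))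
    (hwm : Measurable fun y => ‖w y‖ₑ) (hwm' : Measurable fun y => ‖fderiv ℝ w y‖ₑ) :
    ENNReal.ofReal δ * ‖w x‖ₑ ^ r ≤ 2 ^ (r - 1) * (1 + ENNReal.ofReal δ ^ r) *
      ∫⁻ t in Ioc 0 δ, (‖w (x + t • e)‖ₑ ^ r + ‖fderiv ℝ w (x + t • e)‖ₑ ^ r) := by
  have hr0 : 0 ≤ r := by linarith
  have hline : Measurable fun t : ℝ => x + t • e := by fun_prop
  set I := ∫⁻ t in Ioc 0 δ, ‖fderiv ℝ w (x + t • e)‖ₑ ^ r with hI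
  have hpt : ∀ s ∈ Ioc 0 δ, ‖w x‖ₑ ^ r ≤
      2 ^ (r - 1) * (‖w (x + s • e)‖ₑ ^ r + ENNReal.ofReal δ ^ (r - 1) * I) := by
    intro s hs
    have h1 : ‖w x‖ₑ ≤ ‖w (x + s • e)‖ₑ + ∫⁻ t in Ioc 0 δ, ‖fderiv ℝ w (x + t • e)‖ₑ := by
      calc ‖w x‖ₑ = ‖w (x + s • e) - (w (x + s • e) - w x)‖ₑ := by
            congr 1; abel
        _ ≤ ‖w (x + s • e)‖ₑ + ‖w (x + s • e) - w x‖ₑ := enorm_sub_le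
        _ ≤ _ := by
          gcongr
          refine (enorm_sub_le_lintegral_fderiv hs.1.le he
            fun t ht => hw t ⟨ht.1, ht.2.trans hs.2⟩).trans ?_
          exact lintegral_mono_set (Ioc_subset_Ioc_right hs.2)
    calc ‖w x‖ₑ ^ r ≤ (‖w (x + s • e)‖ₑ + ∫⁻ t in Ioc 0 δ, ‖fderiv ℝ w (x + t • e)‖ₑ) ^ r := by
          gcongr
      _ ≤ 2 ^ (r - 1) * (‖w (x + s • e)‖ₑ ^ r +
            (∫⁻ t in Ioc 0 δ, ‖fderiv ℝ w (x + t • e)‖ₑ) ^ r) :=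
          ENNReal.rpow_add_le_mul_rpow_add_rpow _ _ hr
      _ ≤ _ := by
          gcongr
          exact lintegral_Ioc_rpow_le hr (hwm'.comp hline)
  have hsplit : ∫⁻ t in Ioc 0 δ, (‖w (x + t • e)‖ₑ ^ r + ‖fderiv ℝ w (x + t • e)‖ₑ ^ r) =
      (∫⁻ t in Ioc 0 δ, ‖w (x + t • e)‖ₑ ^ r) + I :=
    lintegral_add_left ((hwm.comp hline).pow_const r) _
  have hδ : ENNReal.ofReal δ * ENNReal.ofReal δ ^ (r - 1) ≤ ENNReal.ofReal δ ^ r := by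
    rcases le_or_gt δ 0 with h0 | h0
    · simp [ENNReal.ofReal_of_nonpos h0]
    · refine le_of_eq ?_
      conv_lhs => rw [← ENNReal.rpow_one (ENNReal.ofReal δ), ← ENNReal.rpow_mul, one_mul]
      rw [← ENNReal.rpow_add _ _ (by simpa using h0) ofReal_ne_top, add_sub_cancel]
  calc ENNReal.ofReal δ * ‖w x‖ₑ ^ r = ∫⁻ _ in Ioc 0 δ, ‖w x‖ₑ ^ r := by simp [mul_comm]
    _ ≤ ∫⁻ s in Ioc 0 δ, 2 ^ (r - 1) * (‖w (x + s • e)‖ₑ ^ r + ENNReal.ofReal δ ^ (r - 1) * I) :=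
        setLIntegral_mono' measurableSet_Ioc hpt
    _ = 2 ^ (r - 1) * ((∫⁻ t in Ioc 0 δ, ‖w (x + t • e)‖ₑ ^ r) +
          ENNReal.ofReal δ * ENNReal.ofReal δ ^ (r - 1) * I) := by
        rw [lintegral_const_mul' _ _ (by finiteness),
          lintegral_add_left (show Measurable fun t : ℝ => ‖w (x + t • e)‖ₑ ^ r from
            (hwm.comp hline).pow_const r)]
        simp [mul_comm, mul_assoc]
    _ ≤ 2 ^ (r - 1) * ((∫⁻ t in Ioc 0 δ, ‖w (x + t • e)‖ₑ ^ r) + ENNReal.ofReal δ ^ r * I) := by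
        gcongr
    _ ≤ _ := by
        rw [hsplit, mul_assoc]
        gcongr
        rw [add_mul, one_mul]
        gcongr
        · exact le_self_add
        · exact le_add_self

theorem mul_lintegral_rpow_le_along {n : ℕ} {F : Type*} [NormedAddCommGroup F] [NormedSpace ℝ F]
    [CompleteSpace F] {w : EuclideanSpace ℝ (Fin n) → F} {A : Set (EuclideanSpace ℝ (Fin n))}
    {N : EuclideanSpace ℝ (Fin n) → EuclideanSpace ℝ (Fin n)} {δ r : ℝ}
    (hr : 1 ≤ r) (hA : MeasurableSet A) (hNm : Measurable N) (hN : ∀ x ∈ A, ‖N x‖ ≤ 1)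
    (hw : ∀ x ∈ A, ∀ t ∈ Icc (0 : ℝ) δ, DifferentiableAt ℝ w (x + t • N x))
    (hwm : Measurable fun y => ‖w y‖ₑ) (hwm' : Measurable fun y => ‖fderiv ℝ w y‖ₑ)
    {κ : EuclideanSpace ℝ (Fin n) → ℝ≥0∞} (hκ : Measurable κ) :
    ENNReal.ofReal δ * ∫⁻ x in A, κ x * ‖w x‖ₑ ^ r ≤
      2 ^ (r - 1) * (1 + ENNReal.ofReal δ ^ r) * ∫⁻ s in Ioc 0 δ, ∫⁻ x in A,
        κ x * (‖w (x + s • N x)‖ₑ ^ r + ‖fderiv ℝ w (x + s • N x)‖ₑ ^ r) := by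
  have hr0 : 0 ≤ r := by linarith
  have hH : Measurable fun y => ‖w y‖ₑ ^ r + ‖fderiv ℝ w y‖ₑ ^ r :=
    (hwm.pow_const r).add (hwm'.pow_const r)
  rw [← lintegral_const_mul' _ _ ofReal_ne_top]
  calc ∫⁻ x in A, ENNReal.ofReal δ * (κ x * ‖w x‖ₑ ^ r)
      ≤ ∫⁻ x in A, 2 ^ (r - 1) * (1 + ENNReal.ofReal δ ^ r) * ∫⁻ s in Ioc 0 δ,
        κ x * (‖w (x + s • N x)‖ₑ ^ r + ‖fderiv ℝ w (x + s • N x)‖ₑ ^ r) := by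
        refine setLIntegral_mono' hA fun x hx => ?_
        rw [lintegral_const_mul _ (show Measurable fun s : ℝ =>
          ‖w (x + s • N x)‖ₑ ^ r + ‖fderiv ℝ w (x + s • N x)‖ₑ ^ r from
          hH.comp (g := fun y => ‖w y‖ₑ ^ r + ‖fderiv ℝ w y‖ₑ ^ r)
            (f := fun s : ℝ => x + s • N x) (by fun_prop))]
        calc ENNReal.ofReal δ * (κ x * ‖w x‖ₑ ^ r) = κ x * (ENNReal.ofReal δ * ‖w x‖ₑ ^ r) := by
              ring
          _ ≤ κ x * (2 ^ (r - 1) * (1 + ENNReal.ofReal δ ^ r) * ∫⁻ s in Ioc 0 δ,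
              (‖w (x + s • N x)‖ₑ ^ r + ‖fderiv ℝ w (x + s • N x)‖ₑ ^ r)) := by
              exact mul_le_mul_right
                (rpow_enorm_le_lintegral_along hr (hN x hx) (hw x hx) hwm hwm') _
          _ = _ := by ring
    _ = 2 ^ (r - 1) * (1 + ENNReal.ofReal δ ^ r) * ∫⁻ x in A, ∫⁻ s in Ioc 0 δ,
        κ x * (‖w (x + s • N x)‖ₑ ^ r + ‖fderiv ℝ w (x + s • N x)‖ₑ ^ r) :=
        lintegral_const_mul' _ _ (by finiteness)
    _ = _ := by
        congr 1
        refine lintegral_lintegral_swap (Measurable.aemeasurable ?_)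
        exact (hκ.comp measurable_fst).mul (hH.comp
          (measurable_fst.add (measurable_snd.smul (hNm.comp measurable_fst))))

namespace IsNormalTube

variable {n : ℕ} {d : EuclideanSpace ℝ (Fin n) → ℝ}
  {N : EuclideanSpace ℝ (Fin n) → EuclideanSpace ℝ (Fin n)} {ρ L : ℝ}

/-- Trace inequality on the thin tube `|d| < ε`, for weights increasing along the normals. -/
theorem lintegral_trace_le (h : IsNormalTube d N ρ L) {F : Type*} [NormedAddCommGroup F]
    [NormedSpace ℝ F] [CompleteSpace F] {w : EuclideanSpace ℝ (Fin n) → F} {ε δ r : ℝ}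
    (hr : 1 ≤ r) (hδ : 0 < δ) (hδL : δ * L ≤ 1 / 2) (hεδ : ε + δ ≤ ρ)
    (hw : ∀ x, -ε < d x → DifferentiableAt ℝ w x)
    (hwm : Measurable fun y => ‖w y‖ₑ) (hwm' : Measurable fun y => ‖fderiv ℝ w y‖ₑ)
    {W : EuclideanSpace ℝ (Fin n) → ℝ≥0∞} (hWm : Measurable W)
    (hW : ∀ x, |d x| < ε → ∀ s ∈ Icc 0 δ, W x ≤ W (x + s • N x)) :
    ∫⁻ x in {x | |d x| < ε}, W x * ‖w x‖ₑ ^ r ≤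
      2 ^ (r - 1) * (1 + ENNReal.ofReal δ ^ r) / ENNReal.ofReal δ * 2 ^ n *
      (ENNReal.ofReal (2 * ε) *
      ∫⁻ x in {x | -ε < d x}, W x * (‖w x‖ₑ ^ r + ‖fderiv ℝ w x‖ₑ ^ r)) := by
  have hL := h.nonneg
  have hH : Measurable fun y => ‖w y‖ₑ ^ r + ‖fderiv ℝ w y‖ₑ ^ r :=
    (hwm.pow_const r).add (hwm'.pow_const r)
  have htube : ∀ x, |d x| < ε → ∀ s ∈ Icc 0 δ, |d x| < ρ ∧ |d x + s| < ρ := fun x hx s hs =>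
    ⟨by linarith, (abs_add_le _ _).trans_lt (by rw [abs_of_nonneg hs.1]; linarith [hs.2])⟩
  have hd : ∀ x, |d x| < ε → ∀ s ∈ Icc 0 δ, d (x + s • N x) = d x + s := fun x hx s hs =>
    (h.flow x s (htube x hx s hs).1 (htube x hx s hs).2).1
  have hmem : ∀ x, |d x| < ε → ∀ s ∈ Icc 0 δ, -ε < d (x + s • N x) := fun x hx s hs => by
    rw [hd x hx s hs]
    linarith [(abs_lt.1 hx).1, hs.1]
  have hA : MeasurableSet {x | |d x| < ε} := h.measurableSet_tube ε
  have hB : MeasurableSet {x | -ε < d x} := (isOpen_lt continuous_const h.continuous).measurableSet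
  have h1 := mul_lintegral_rpow_le_along (A := {x | |d x| < ε}) (δ := δ) hr hA h.measurable
    (fun x hx => (h.norm_eq x ((htube x hx 0 ⟨le_rfl, hδ.le⟩).1)).le)
    (fun x hx s hs => hw _ (hmem x hx s hs)) hwm hwm' hWm
  have hS : MeasurableSet {z : EuclideanSpace ℝ (Fin n) × ℝ | |d z.1 + -z.2| < ε} :=
    (isOpen_lt ((h.continuous.comp continuous_fst).add continuous_snd.neg).abs
      continuous_const).measurableSet
  have h2 := lintegral_family_le_of_expanding_on (δ := δ) (K := 2) (A := fun _ => {x | |d x| < ε})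
    (B := {x | -ε < d x}) (Φ := fun s x => x + s • N x) (κ := W)
    (κ' := fun y s => {z : EuclideanSpace ℝ (Fin n) × ℝ | |d z.1 + -z.2| < ε}.indicator
      (fun z => W z.1) (y, s)) (W := fun y => ENNReal.ofReal (2 * ε) * W y)
    (fun _ _ => hA) hB (fun s => h.measurable_shift s) (fun s hs x hx y hy => ?_)
    (fun s hs x hx => hmem x hx s ⟨hs.1.le, hs.2⟩)
    ((hWm.comp measurable_fst).indicator hS) (fun s hs x hx => ?_) (fun y _ => ?_) hH
  · rw [mul_assoc, ENNReal.mul_div_right_comm.symm, ENNReal.mul_div_right_comm,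
      ENNReal.div_eq_inv_mul, mul_assoc, ← ENNReal.div_eq_inv_mul,
      ENNReal.le_div_iff_mul_le (by simp [hδ]) (by simp), mul_comm]
    refine h1.trans ?_
    gcongr
    refine h2.trans (le_of_eq ?_)
    simp_rw [mul_assoc]
    rw [lintegral_const_mul' _ _ ofReal_ne_top]
    rfl
  · have := h.dist_le (s := s) (by rw [abs_of_pos hs.1]; nlinarith [hs.2])
      (htube x hx 0 ⟨le_rfl, hδ.le⟩).1 (htube y hy 0 ⟨le_rfl, hδ.le⟩).1
    refine this.trans ?_
    gcongr
    rw [abs_of_pos hs.1]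
    have : s * L ≤ δ * L := mul_le_mul_of_nonneg_right hs.2 hL
    norm_num
    linarith
  · have hs' : s ∈ Icc 0 δ := ⟨hs.1.le, hs.2⟩
    show W x ≤ indicator _ _ (x + s • N x, s)
    rw [indicator_of_mem]
    · exact hW x hx s hs'
    · show |d (x + s • N x) + -s| < ε
      rw [hd x hx s hs', add_neg_cancel_right]
      exact hx
  · have : ∀ s : ℝ, {z : EuclideanSpace ℝ (Fin n) × ℝ | |d z.1 + -z.2| < ε}.indicator
        (fun z => W z.1) (y, s) = (Ioo (d y - ε) (d y + ε)).indicator (fun _ => W y) s := by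
      intro s
      have hiff : (y, s) ∈ {z : EuclideanSpace ℝ (Fin n) × ℝ | |d z.1 + -z.2| < ε} ↔
          s ∈ Ioo (d y - ε) (d y + ε) := by
        simp only [mem_ofPred_eq, mem_Ioo, abs_lt]
        constructor <;> rintro ⟨h1, h2⟩ <;> constructor <;> linarith
      by_cases hs : s ∈ Ioo (d y - ε) (d y + ε)
      · rw [indicator_of_mem hs, indicator_of_mem (hiff.2 hs)]
      · rw [indicator_of_notMem hs, indicator_of_notMem (fun hc => hs (hiff.1 hc))]
    simp_rw [this]
    refine (lintegral_mono' Measure.restrict_le_self le_rfl).trans ?_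
    rw [lintegral_indicator measurableSet_Ioo]
    simp only [lintegral_const, Measure.restrict_apply_univ, Real.volume_Ioo]
    rw [mul_comm]
    gcongr
    linarith

/-- Integrating along the normals up to the zero level set. -/
theorem lintegral_lintegral_to_zero_le (h : IsNormalTube d N ρ L) {ε : ℝ} (hεL : ε * L ≤ 1 / 2)
    (hε : 0 < ε) (hερ : ε ≤ ρ) {W H : EuclideanSpace ℝ (Fin n) → ℝ≥0∞} (hWm : Measurable W)
    (hHm : Measurable H)
    (hW : ∀ x, -ε < d x → d x ≤ 0 → ∀ s ∈ Icc 0 (-d x), W x ≤ 2 * W (x + s • N x)) :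
    ∫⁻ x in {x | -ε < d x ∧ d x ≤ 0}, W x * ∫⁻ s in Ioc 0 (-d x), H (x + s • N x) ≤
      2 ^ n * ENNReal.ofReal (2 * ε) * ∫⁻ x in {x | -ε < d x ∧ d x ≤ 0}, W x * H x := by
  have hL := h.nonneg
  set A : Set (EuclideanSpace ℝ (Fin n)) := {x | -ε < d x ∧ d x ≤ 0} with hAdef
  have hA : MeasurableSet A := (isOpen_lt continuous_const h.continuous).measurableSet.inter
    (isClosed_le h.continuous continuous_const).measurableSet
  have hAs : ∀ s : ℝ, MeasurableSet {x | s ≤ -d x} := fun s =>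
    (isClosed_le continuous_const h.continuous.neg).measurableSet
  have htube : ∀ x ∈ A, ∀ s ∈ Ioc 0 ε, s ≤ -d x → |d x| < ρ ∧ |d x + s| < ρ :=
    fun x hx s hs hsx => ⟨abs_lt.2 ⟨by linarith [hx.1], by linarith [hx.2]⟩,
      abs_lt.2 ⟨by linarith [hx.1, hs.1], by linarith⟩⟩
  have hjm : Measurable fun z : EuclideanSpace ℝ (Fin n) × ℝ =>
      {z : EuclideanSpace ℝ (Fin n) × ℝ | z.2 ≤ -d z.1}.indicator
        (fun z => W z.1 * H (z.1 + z.2 • N z.1)) z :=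
    ((hWm.comp measurable_fst).mul (hHm.comp
      (measurable_fst.add (measurable_snd.smul (h.measurable.comp measurable_fst))))).indicator
      (isClosed_le continuous_snd (h.continuous.comp continuous_fst).neg).measurableSet
  calc ∫⁻ x in A, W x * ∫⁻ s in Ioc 0 (-d x), H (x + s • N x)
      = ∫⁻ x in A, ∫⁻ s in Ioc 0 ε, {z : EuclideanSpace ℝ (Fin n) × ℝ | z.2 ≤ -d z.1}.indicator
        (fun z => W z.1 * H (z.1 + z.2 • N z.1)) (x, s) := by
        refine setLIntegral_congr_fun hA fun x hx => ?_
        have hsub : Iic (-d x) ∩ Ioc 0 ε = Ioc 0 (-d x) := by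
          ext s
          simp only [mem_inter_iff, mem_Iic, mem_Ioc]
          constructor
          · rintro ⟨h1, h2, -⟩; exact ⟨h2, h1⟩
          · rintro ⟨h1, h2⟩; exact ⟨h2, h1, by linarith [hx.1]⟩
        show W x * _ = ∫⁻ s in Ioc 0 ε, (Iic (-d x)).indicator
          (fun s => W x * H (x + s • N x)) s
        rw [setLIntegral_indicator measurableSet_Iic, hsub,
          lintegral_const_mul _ (show Measurable fun s : ℝ => H (x + s • N x) from
            hHm.comp (g := H) (f := fun s : ℝ => x + s • N x) (by fun_prop))]
    _ = ∫⁻ s in Ioc 0 ε, ∫⁻ x in A, {z : EuclideanSpace ℝ (Fin n) × ℝ | z.2 ≤ -d z.1}.indicator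
        (fun z => W z.1 * H (z.1 + z.2 • N z.1)) (x, s) :=
        lintegral_lintegral_swap hjm.aemeasurable
    _ = ∫⁻ s in Ioc 0 ε, ∫⁻ x in {x | s ≤ -d x} ∩ A, W x * H (x + s • N x) := by
        refine lintegral_congr fun s => ?_
        exact setLIntegral_indicator (hAs s) fun x => W x * H (x + s • N x)
    _ ≤ (2 : NNReal) ^ n * ∫⁻ y in A, (ENNReal.ofReal (2 * ε) * W y) * H y := by
        refine lintegral_family_le_of_expanding_on (Φ := fun s x => x + s • N x)
          (κ' := fun y _ => 2 * W y) (fun s _ => (hAs s).inter hA) hA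
          (fun s => h.measurable_shift s)
          (fun s hs x hx y hy => ?_) (fun s hs x hx => ?_)
          ((hWm.comp measurable_fst).const_mul 2) (fun s hs x hx => ?_) (fun y _ => ?_) hHm
        · have := h.dist_le (s := s) (by rw [abs_of_pos hs.1]; nlinarith [hs.2])
            (htube x hx.2 s hs hx.1).1 (htube y hy.2 s hs hy.1).1
          refine this.trans ?_
          gcongr
          rw [abs_of_pos hs.1]
          have : s * L ≤ ε * L := mul_le_mul_of_nonneg_right hs.2 hL
          norm_num
          linarith
        · have ht := htube x hx.2 s hs hx.1
          show -ε < d _ ∧ d _ ≤ 0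
          rw [(h.flow x s ht.1 ht.2).1]
          have h1 : s ≤ -d x := hx.1
          exact ⟨by linarith [hx.2.1, hs.1], by linarith⟩
        · exact hW x hx.2.1 hx.2.2 s ⟨hs.1.le, hx.1⟩
        · simp only [lintegral_const, Measure.restrict_apply_univ, Real.volume_Ioc, sub_zero]
          rw [ENNReal.ofReal_mul zero_le_two, ofReal_ofNat]
          exact le_of_eq (by ring)
    _ = _ := by
        simp_rw [mul_assoc]
        rw [lintegral_const_mul' _ _ ofReal_ne_top]
        rfl

end IsNormalTube

/-- The properties of the signed distance to the boundary of an open set that are used below. -/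
structure IsSignedDist {E : Type*} [PseudoMetricSpace E] (D : Set E) (d : E → ℝ) : Prop where
  lipschitz : LipschitzWith 1 d
  neg_iff : ∀ x, d x < 0 ↔ x ∈ D
  zero_iff : ∀ x, d x = 0 ↔ x ∈ frontier D
  exists_nearest : ∀ x, ∃ y ∈ frontier D, dist x y = |d x|

theorem exists_frontier_dist_add {E : Type*} [NormedAddCommGroup E] [NormedSpace ℝ E] {D : Set E}
    {x y : E} (hx : x ∈ D) (hy : y ∉ D) : ∃ z ∈ frontier D, dist x z + dist z y = dist x y := by
  suffices h : (segment ℝ x y ∩ frontier D).Nonempty by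
    obtain ⟨z, hz, hzF⟩ := h
    exact ⟨z, hzF, dist_add_dist_of_mem_segment hz⟩
  by_contra hemp
  have hnot : ∀ z ∈ segment ℝ x y, z ∈ closure D → z ∈ interior D := fun z hz hzc => by
    by_contra hzi
    exact hemp ⟨z, hz, hzc, hzi⟩
  obtain ⟨z, -, hz1, hz2⟩ := (convex_segment x y).isPreconnected (interior D) (closure D)ᶜ
    isOpen_interior isClosed_closure.isOpen_compl
    (fun z hz => (em (z ∈ closure D)).imp (hnot z hz) id)
    ⟨x, left_mem_segment ℝ x y, hnot x (left_mem_segment ℝ x y) (subset_closure hx)⟩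
    ⟨y, right_mem_segment ℝ x y,
      fun hyc => hy (interior_subset (hnot y (right_mem_segment ℝ x y) hyc))⟩
  exact hz2 (interior_subset_closure hz1)

theorem isSignedDist_of_eq {E : Type*} [NormedAddCommGroup E] [NormedSpace ℝ E] [ProperSpace E]
    {D : Set E} (hD : IsOpen D) (hne : D.Nonempty) (hne' : Dᶜ.Nonempty) {d : E → ℝ}
    (hd : ∀ x, d x = Metric.infDist x D - Metric.infDist x Dᶜ) : IsSignedDist D d := by
  have hF : (frontier D).Nonempty := by
    obtain ⟨x, hx⟩ := hne
    obtain ⟨y, hy⟩ := hne'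
    obtain ⟨z, hz, -⟩ := exists_frontier_dist_add hx hy
    exact ⟨z, hz⟩
  have hdisj : ∀ x ∈ D, x ∉ frontier D := fun x hx hxF => by
    rw [hD.frontier_eq] at hxF
    exact hxF.2 hx
  have hin : ∀ x ∈ D, d x = -Metric.infDist x (frontier D) := fun x hx => by
    rw [hd, Metric.infDist_zero_of_mem hx, zero_sub]
    congr 1
    refine le_antisymm (Metric.infDist_le_infDist_of_subset (fun z hz hzD => hdisj z hzD hz) hF)
      ((Metric.le_infDist hne').2 fun y hy => ?_)
    obtain ⟨z, hz, hzd⟩ := exists_frontier_dist_add hx hy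
    exact (Metric.infDist_le_dist_of_mem hz).trans (by linarith [dist_nonneg (x := z) (y := y)])
  have hout : ∀ x, x ∉ D → d x = Metric.infDist x (frontier D) := fun x hx => by
    rw [hd, Metric.infDist_zero_of_mem (s := Dᶜ) hx, sub_zero]
    refine le_antisymm ?_ ((Metric.le_infDist hne).2 fun y hy => ?_)
    · rw [← Metric.infDist_closure (s := D)]
      exact Metric.infDist_le_infDist_of_subset frontier_subset_closure hF
    · obtain ⟨z, hz, hzd⟩ := exists_frontier_dist_add hy hx
      refine (Metric.infDist_le_dist_of_mem hz).trans ?_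
      rw [dist_comm x z, dist_comm x y]
      linarith [dist_nonneg (x := y) (y := z)]
  have hpos : ∀ x, 0 ≤ Metric.infDist x (frontier D) := fun x => Metric.infDist_nonneg
  have hcross : ∀ x ∈ D, ∀ y, y ∉ D → |d x - d y| ≤ dist x y := fun x hx y hy => by
    obtain ⟨z, hz, hzd⟩ := exists_frontier_dist_add hx hy
    rw [hin x hx, hout y hy, abs_le]
    have h1 := Metric.infDist_le_dist_of_mem (x := x) hz
    have h2 := Metric.infDist_le_dist_of_mem (x := y) hz
    rw [dist_comm y z] at h2
    constructor <;> linarith [hpos x, hpos y, dist_nonneg (x := x) (y := y)]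
  have hlip := fun x y => (Metric.lipschitz_infDist_pt (frontier D)).dist_le_mul x y
  simp only [NNReal.coe_one, one_mul, Real.dist_eq] at hlip
  refine ⟨LipschitzWith.of_dist_le_mul fun x y => ?_, fun x => ?_, fun x => ?_, fun x => ?_⟩
  · rw [NNReal.coe_one, one_mul, Real.dist_eq]
    by_cases hx : x ∈ D <;> by_cases hy : y ∈ D
    · rw [hin x hx, hin y hy, neg_sub_neg, abs_sub_comm]
      exact hlip x y
    · exact hcross x hx y hy
    · rw [abs_sub_comm, dist_comm]
      exact hcross y hy x hx
    · rw [hout x hx, hout y hy]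
      exact hlip x y
  · by_cases hx : x ∈ D
    · have := (isClosed_frontier.notMem_iff_infDist_pos hF).1 (hdisj x hx)
      simp only [hx, iff_true, hin x hx]
      linarith
    · simp only [hx, iff_false, hout x hx, not_lt, hpos x]
  · rw [isClosed_frontier.mem_iff_infDist_zero hF]
    by_cases hx : x ∈ D
    · rw [hin x hx, neg_eq_zero]
    · rw [hout x hx]
  · obtain ⟨y, hy, hxy⟩ := isClosed_frontier.exists_infDist_eq_dist hF x
    refine ⟨y, hy, ?_⟩
    rw [← hxy]
    by_cases hx : x ∈ D
    · rw [hin x hx, abs_neg, abs_of_nonneg (hpos x)]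
    · rw [hout x hx, abs_of_nonneg (hpos x)]

section Eikonal

variable {E : Type*} [NormedAddCommGroup E] [InnerProductSpace ℝ E] [CompleteSpace E]

theorem norm_gradient (d : E → ℝ) (x : E) : ‖gradient d x‖ = ‖fderiv ℝ d x‖ := by
  rw [gradient, LinearIsometryEquiv.norm_map]

theorem gradient_neg_fun (d : E → ℝ) (x : E) : gradient (fun y => -d y) x = -gradient d x := by
  simp only [gradient]
  rw [fderiv_fun_neg, map_neg]

theorem LipschitzWith.norm_gradient_le {d : E → ℝ} (hd : LipschitzWith 1 d) (x : E) :
    ‖gradient d x‖ ≤ 1 := by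
  rw [norm_gradient]
  simpa using norm_fderiv_le_of_lipschitz ℝ hd (x₀ := x)

omit [CompleteSpace E] in
/-- If a `1`-Lipschitz function decreases by `dist x z` from `x` to `z`, then it decreases at unit
speed along the segment from `x` to `z`. -/
theorem LipschitzWith.eq_sub_of_segment {d : E → ℝ} (hd : LipschitzWith 1 d) {x e : E} {s t : ℝ}
    (he : ‖e‖ = 1) (hs : d (x - s • e) = d x - s) (ht : t ∈ Icc 0 s) :
    d (x - t • e) = d x - t := by
  have h1 := hd.dist_le_mul x (x - t • e)
  have h2 := hd.dist_le_mul (x - t • e) (x - s • e)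
  have e1 : x - (x - t • e) = t • e := by abel
  have e2 : x - t • e - (x - s • e) = (s - t) • e := by rw [sub_smul]; abel
  rw [dist_eq_norm, dist_eq_norm, e1, norm_smul, he] at h1
  rw [dist_eq_norm, dist_eq_norm, e2, norm_smul, he, hs] at h2
  simp only [NNReal.coe_one, one_mul, mul_one, Real.norm_eq_abs, abs_of_nonneg ht.1,
    abs_of_nonneg (sub_nonneg.2 ht.2)] at h1 h2
  linarith [(abs_le.1 h1).2, (abs_le.1 h2).2]

theorem LipschitzWith.gradient_eq_of_segment {d : E → ℝ} (hd : LipschitzWith 1 d) {x e : E}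
    {s t : ℝ} (he : ‖e‖ = 1) (hs0 : 0 < s) (hs : d (x - s • e) = d x - s) (ht : t ∈ Icc 0 s)
    (hdiff : DifferentiableAt ℝ d (x - t • e)) : gradient d (x - t • e) = e := by
  have h1 : HasDerivWithinAt (fun t : ℝ => d (x - t • e)) (fderiv ℝ d (x - t • e) (-e))
      (Icc 0 s) t := by
    have hl : HasDerivAt (fun t : ℝ => x - t • e) (-e) t := by
      simpa using ((hasDerivAt_id t).smul_const e).const_sub x
    exact (hdiff.hasFDerivAt.comp_hasDerivAt t hl).hasDerivWithinAt
  have h2 : HasDerivWithinAt (fun t : ℝ => d (x - t • e)) (-1) (Icc 0 s) t := by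
    refine (((hasDerivAt_id t).const_sub (d x)).hasDerivWithinAt (s := Icc 0 s)).congr
      (fun r hr => hd.eq_sub_of_segment he hs hr) (hd.eq_sub_of_segment he hs ht)
  have h3 := (uniqueDiffOn_Icc hs0 t ht).eq_deriv _ h1 h2
  rw [← inner_gradient_left, inner_neg_right, neg_inj] at h3
  have hle := hd.norm_gradient_le (x - t • e)
  have : ‖gradient d (x - t • e) - e‖ ^ 2 ≤ 0 := by
    rw [@norm_sub_sq_real, h3, he]
    nlinarith [norm_nonneg (gradient d (x - t • e))]
  have h0 : ‖gradient d (x - t • e) - e‖ = 0 := by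
    have := norm_nonneg (gradient d (x - t • e) - e)
    nlinarith
  exact sub_eq_zero.1 (norm_eq_zero.1 h0)

omit [CompleteSpace E] in
theorem LipschitzWith.exists_eq_sub_of_norm_fderiv_eq_one [ProperSpace E] {d : E → ℝ}
    (hd : LipschitzWith 1 d) {x : E} {s : ℝ} (hs : 0 ≤ s)
    (hdiff : ∀ z ∈ Metric.closedBall x s, DifferentiableAt ℝ d z ∧ ‖fderiv ℝ d z‖ = 1) :
    ∃ z ∈ Metric.closedBall x s, d z ≤ d x - s := by
  obtain ⟨z₀, hz₀, hmin⟩ := (isCompact_closedBall x s).exists_isMinOn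
    ⟨x, Metric.mem_closedBall_self hs⟩ hd.continuous.continuousOn
  refine ⟨z₀, hz₀, ?_⟩
  suffices h : ∀ η ∈ Ioo (0 : ℝ) 1, d z₀ ≤ d x - (1 - η) * s by
    have hlim : Tendsto (fun η : ℝ => d x - (1 - η) * s) (𝓝[>] 0) (𝓝 (d x - (1 - 0) * s)) := by
      refine Tendsto.mono_left (Continuous.tendsto ?_ 0) nhdsWithin_le_nhds
      fun_prop
    rw [sub_zero, one_mul] at hlim
    refine ge_of_tendsto hlim ?_
    filter_upwards [Ioo_mem_nhdsGT zero_lt_one] with η hη using h η hη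
  intro η hη
  obtain ⟨z, hz, hzmin⟩ := (isCompact_closedBall x s).exists_isMinOn
    ⟨x, Metric.mem_closedBall_self hs⟩
    (f := fun z => d z + (1 - η) * dist z x)
    (hd.continuous.add (continuous_const.mul (continuous_id.dist continuous_const))).continuousOn
  have hx := hzmin (Metric.mem_closedBall_self hs)
  simp only [mem_ofPred_eq, dist_self, mul_zero, add_zero] at hx
  suffices hzs : dist z x = s by
    rw [hzs] at hx
    have := hmin hz
    simp only [mem_ofPred_eq] at this
    linarith
  by_contra hne
  have hlt : dist z x < s := lt_of_le_of_ne hz hne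
  have hbound : ∀ e : E, -((1 - η) * ‖e‖) ≤ fderiv ℝ d z e := fun e => by
    have hl : HasDerivAt (fun t : ℝ => z + t • e) e 0 := by
      simpa using ((hasDerivAt_id (0 : ℝ)).smul_const e).const_add z
    have hder : HasDerivAt (fun t : ℝ => d (z + t • e)) (fderiv ℝ d z e) 0 := by
      have h0 : DifferentiableAt ℝ d (z + (0 : ℝ) • e) := by simpa using (hdiff z hz).1
      have := h0.hasFDerivAt.comp_hasDerivAt (0 : ℝ) hl
      rwa [zero_smul, add_zero] at this
    have hslope := hder.tendsto_slope_zero_right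
    refine ge_of_tendsto hslope ?_
    have hnear : ∀ᶠ t : ℝ in 𝓝[>] 0, dist (z + t • e) x < s := by
      refine (hl.continuousAt.tendsto.dist tendsto_const_nhds).mono_left nhdsWithin_le_nhds
        |>.eventually_lt_const ?_
      simpa using hlt
    filter_upwards [hnear, self_mem_nhdsWithin] with t ht (ht0 : 0 < t)
    have hm := hzmin (Metric.mem_closedBall.2 ht.le)
    simp only [mem_ofPred_eq] at hm
    have htri : dist (z + t • e) x ≤ t * ‖e‖ + dist z x := by
      refine (dist_triangle _ z _).trans ?_
      rw [dist_eq_norm, add_sub_cancel_left, norm_smul, Real.norm_eq_abs, abs_of_pos ht0]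
    simp only [zero_add, zero_smul, add_zero, smul_eq_mul]
    rw [← div_eq_inv_mul, le_div_iff₀ ht0]
    have : (1 - η) * dist (z + t • e) x ≤ (1 - η) * (t * ‖e‖ + dist z x) := by
      have := hη.2
      gcongr
    nlinarith
  have hnorm : ‖fderiv ℝ d z‖ ≤ 1 - η := by
    refine ContinuousLinearMap.opNorm_le_bound _ (by linarith [hη.2]) fun e => ?_
    rw [Real.norm_eq_abs, abs_le]
    refine ⟨hbound e, ?_⟩
    have := hbound (-e)
    rw [map_neg, norm_neg] at this
    linarith
  rw [(hdiff z hz).2] at hnorm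
  linarith [hη.1]

theorem LipschitzWith.flow_sub [ProperSpace E] {d : E → ℝ}
    (hd : LipschitzWith 1 d) {x : E} {s : ℝ} (hs : 0 ≤ s)
    (hdiff : ∀ z ∈ Metric.closedBall x s, DifferentiableAt ℝ d z ∧ ‖fderiv ℝ d z‖ = 1) :
    d (x - s • gradient d x) = d x - s ∧ gradient d (x - s • gradient d x) = gradient d x := by
  rcases hs.eq_or_lt with rfl | hs0
  · simp
  obtain ⟨z, hz, hzd⟩ := hd.exists_eq_sub_of_norm_fderiv_eq_one hs hdiff
  have h1 := hd.dist_le_mul x z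
  rw [NNReal.coe_one, one_mul, Real.dist_eq, dist_comm x z] at h1
  have hz' : dist z x ≤ s := hz
  have h2 := (abs_le.1 h1).2
  have hzs : dist z x = s := by linarith
  have hzd' : d z = d x - s := by linarith
  set e := s⁻¹ • (x - z) with he
  have hse : x - s • e = z := by rw [he, smul_inv_smul₀ hs0.ne']; abel
  have he1 : ‖e‖ = 1 := by
    rw [he, norm_smul, ← dist_eq_norm, dist_comm, hzs, norm_inv, Real.norm_eq_abs, abs_of_pos hs0,
      inv_mul_cancel₀ hs0.ne']
  have hseg : d (x - s • e) = d x - s := by rw [hse, hzd']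
  have hg0 : gradient d x = e := by
    have := hd.gradient_eq_of_segment he1 hs0 hseg (t := 0) ⟨le_rfl, hs⟩
      (by simpa using (hdiff x (Metric.mem_closedBall_self hs)).1)
    simpa using this
  rw [hg0]
  refine ⟨hseg, hd.gradient_eq_of_segment he1 hs0 hseg ⟨hs, le_rfl⟩ ?_⟩
  rw [hse]
  exact (hdiff z hz).1

end Eikonal

namespace IsSignedDist

section

variable {E : Type*} [NormedAddCommGroup E] [InnerProductSpace ℝ E] [CompleteSpace E]
  {D : Set E} {d : E → ℝ}

omit [InnerProductSpace ℝ E] [CompleteSpace E] in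
theorem abs_le_dist (h : IsSignedDist D d) (x : E) {y : E} (hy : y ∈ frontier D) :
    |d x| ≤ dist x y := by
  have := h.lipschitz.dist_le_mul x y
  rwa [NNReal.coe_one, one_mul, Real.dist_eq, (h.zero_iff y).2 hy, sub_zero] at this

/-- At a point of differentiability outside `D`, the gradient of the signed distance points away
from the nearest boundary point. -/
theorem sub_smul_gradient_mem_frontier (h : IsSignedDist D d) {x : E} (hx : 0 < d x)
    (hdiff : DifferentiableAt ℝ d x) :
    ‖gradient d x‖ = 1 ∧ x - d x • gradient d x ∈ frontier D := by
  obtain ⟨y, hy, hxy⟩ := h.exists_nearest x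
  rw [abs_of_pos hx] at hxy
  set e := (d x)⁻¹ • (x - y) with he
  have hxe : x - d x • e = y := by rw [he, smul_inv_smul₀ hx.ne']; abel
  have he1 : ‖e‖ = 1 := by
    rw [he, norm_smul, ← dist_eq_norm, hxy, norm_inv, Real.norm_eq_abs, abs_of_pos hx,
      inv_mul_cancel₀ hx.ne']
  have := h.lipschitz.gradient_eq_of_segment he1 hx (t := 0)
    (by rw [hxe, sub_self, (h.zero_iff y).2 hy]) ⟨le_rfl, hx.le⟩ (by simpa using hdiff)
  rw [zero_smul, sub_zero] at this
  rw [this, hxe]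
  exact ⟨he1, hy⟩

theorem norm_fderiv_eq_one (h : IsSignedDist D d) {U : Set E} (hU : IsOpen U)
    (hdiff : DifferentiableOn ℝ d U) (hcont : ContinuousOn (fderiv ℝ d) U) {x : E} (hx : x ∈ U) :
    ‖fderiv ℝ d x‖ = 1 := by
  have hdiffAt : ∀ z ∈ U, DifferentiableAt ℝ d z :=
    fun z hz => hdiff.differentiableAt (hU.mem_nhds hz)
  have hneg : ∀ z ∈ U, d z < 0 → ‖fderiv ℝ d z‖ = 1 := fun z hz hdz => by
    obtain ⟨y, hy, hzy⟩ := h.exists_nearest z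
    rw [abs_of_neg hdz] at hzy
    set e := (-d z)⁻¹ • (z - y) with he
    have hd0 : 0 < -d z := by linarith
    have hze : z - (-d z) • e = y := by rw [he, smul_inv_smul₀ hd0.ne']; abel
    have he1 : ‖e‖ = 1 := by
      rw [he, norm_smul, ← dist_eq_norm, hzy, norm_inv, Real.norm_eq_abs, abs_of_pos hd0,
        inv_mul_cancel₀ hd0.ne']
    have hlip : LipschitzWith 1 fun w => -d w := h.lipschitz.neg
    have := hlip.gradient_eq_of_segment he1 hd0 (t := 0)
      (by rw [hze, sub_self, (h.zero_iff y).2 hy, neg_zero]) ⟨le_rfl, hd0.le⟩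
      (by simpa using (hdiffAt z hz).neg)
    rw [zero_smul, sub_zero, gradient_neg_fun] at this
    rw [← norm_gradient, ← norm_neg, this, he1]
  rcases lt_trichotomy (d x) 0 with hdx | hdx | hdx
  · exact hneg x hx hdx
  · by_contra hne
    have hev : ∀ᶠ z in 𝓝 x, ‖fderiv ℝ d z‖ ≠ 1 :=
      ((hcont.continuousAt (hU.mem_nhds hx)).norm.tendsto).eventually_ne hne
    have hcl : x ∈ closure D := frontier_subset_closure ((h.zero_iff x).1 hdx)
    obtain ⟨z, ⟨hz1, hz2⟩, hzD⟩ := mem_closure_iff_nhds.1 hcl _ (hev.and (hU.mem_nhds hx))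
    exact hz1 (hneg z hz2 ((h.neg_iff z).2 hzD))
  · rw [← norm_gradient]
    exact (h.sub_smul_gradient_mem_frontier hdx (hdiffAt x hx)).1

/-- Semiconcavity of the distance function: away from the boundary, the maps
`x ↦ x - s ∇d(x)` expand distances up to a factor. -/
theorem dist_le_two_mul_dist_sub_smul_gradient (h : IsSignedDist D d) {c s : ℝ} (hc : 0 < c)
    (hs : s ∈ Icc 0 (c / 2)) {x y : E} (hx : c ≤ d x) (hy : c ≤ d y)
    (hdx : DifferentiableAt ℝ d x) (hdy : DifferentiableAt ℝ d y) :
    dist x y ≤ 2 * dist (x - s • gradient d x) (y - s • gradient d y) := by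
  have key : ∀ x y : E, c ≤ d x → c ≤ d y → DifferentiableAt ℝ d x →
      d y ≤ d x + ⟪gradient d x, y - x⟫ + ‖y - x‖ ^ 2 / (2 * c) := fun x y hx hy hdx => by
    have hx0 : 0 < d x := hc.trans_le hx
    have hy0 : 0 < d y := hc.trans_le hy
    obtain ⟨h1, h2⟩ := h.sub_smul_gradient_mem_frontier hx0 hdx
    have h3 := h.abs_le_dist y h2
    rw [abs_of_pos hy0, dist_eq_norm] at h3
    have h4 : y - (x - d x • gradient d x) = d x • gradient d x + (y - x) := by abel
    have h5 : d y ^ 2 ≤ d x ^ 2 + 2 * (d x * ⟪gradient d x, y - x⟫) + ‖y - x‖ ^ 2 := by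
      calc d y ^ 2 ≤ ‖y - (x - d x • gradient d x)‖ ^ 2 := by gcongr
        _ = _ := by
          rw [h4, @norm_add_sq_real, norm_smul, h1, real_inner_smul_left, Real.norm_eq_abs,
            mul_one, sq_abs]
    set a := ⟪gradient d x, y - x⟫
    set b := ‖y - x‖ ^ 2 with hb
    have hb0 : 0 ≤ b := sq_nonneg _
    have h6 : b / (2 * d x) ≤ b / (2 * c) := by gcongr
    have h7 : d y ≤ d x + a + b / (2 * d x) := by
      have h8 : d x + a + b / (2 * d x) = (2 * d x ^ 2 + 2 * (d x * a) + b) / (2 * d x) := by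
        field_simp
      rw [h8, le_div_iff₀ (by positivity)]
      nlinarith [sq_nonneg (d y - d x)]
    linarith
  have k1 := key x y hx hy hdx
  have k2 := key y x hy hx hdy
  set w := x - y with hw
  have hyx : y - x = -w := by rw [hw]; abel
  rw [hyx, inner_neg_right, norm_neg] at k1
  have k3 : ⟪gradient d x - gradient d y, w⟫ ≤ ‖w‖ ^ 2 / c := by
    rw [inner_sub_left]
    have : ‖w‖ ^ 2 / c = ‖w‖ ^ 2 / (2 * c) + ‖w‖ ^ 2 / (2 * c) := by field_simp; ring
    linarith
  set z := (x - s • gradient d x) - (y - s • gradient d y) with hz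
  have hzw : z = w - s • (gradient d x - gradient d y) := by rw [hz, hw, smul_sub]; abel
  have k4 : ‖w‖ ^ 2 / 2 ≤ ⟪z, w⟫ := by
    rw [hzw, inner_sub_left, real_inner_self_eq_norm_sq, real_inner_smul_left]
    have h1 : s * ⟪gradient d x - gradient d y, w⟫ ≤ s * (‖w‖ ^ 2 / c) :=
      mul_le_mul_of_nonneg_left k3 hs.1
    have h2 : s * (‖w‖ ^ 2 / c) ≤ (c / 2) * (‖w‖ ^ 2 / c) := by gcongr; exact hs.2
    have h3 : (c / 2) * (‖w‖ ^ 2 / c) = ‖w‖ ^ 2 / 2 := by field_simp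
    linarith
  have k5 := real_inner_le_norm z w
  rw [dist_eq_norm, dist_eq_norm]
  change ‖w‖ ≤ 2 * ‖z‖
  rcases (norm_nonneg w).eq_or_lt with h0 | h0
  · rw [← h0]; positivity
  · nlinarith

theorem gradient_flow_neg (h : IsSignedDist D d) {x : E} (hx : 0 < d x)
    (hdiff : DifferentiableAt ℝ d x) {s : ℝ} (hs : s ∈ Icc 0 (d x)) :
    d (x - s • gradient d x) = d x - s := by
  obtain ⟨h1, h2⟩ := h.sub_smul_gradient_mem_frontier hx hdiff
  exact h.lipschitz.eq_sub_of_segment h1 (by rw [(h.zero_iff _).2 h2, sub_self]) hs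

end

/-- The gradient of the signed distance to a bounded `C^{1,1}` boundary is the normal field of
a tube around the boundary. -/
theorem exists_isNormalTube {n : ℕ} {D : Set (EuclideanSpace ℝ (Fin n))}
    {d : EuclideanSpace ℝ (Fin n) → ℝ} (h : IsSignedDist D d) (hD : Bornology.IsBounded D)
    {U : Set (EuclideanSpace ℝ (Fin n))} (hU : IsOpen U) (hFU : frontier D ⊆ U)
    (hdiff : DifferentiableOn ℝ d U) {K : NNReal} (hK : LipschitzOnWith K (fderiv ℝ d) U) :
    ∃ ρ L : ℝ, 0 < ρ ∧ ρ * L ≤ 1 / 2 ∧ IsNormalTube d (gradient d) ρ L ∧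
      ∀ x, |d x| < ρ → DifferentiableAt ℝ d x := by
  have hFc : IsCompact (frontier D) :=
    Metric.isCompact_of_isClosed_isBounded isClosed_frontier
      (hD.closure.subset frontier_subset_closure)
  obtain ⟨δ, hδ, hδU⟩ := hFc.exists_cthickening_subset_open hU hFU
  set ρ := min (δ / 3) (1 / (2 * (K + 1))) with hρ
  have hK0 : (0 : ℝ) ≤ K := K.2
  have hρ0 : 0 < ρ := by positivity
  have hball : ∀ x, |d x| < ρ → ∀ z ∈ Metric.closedBall x (2 * ρ), z ∈ U := fun x hx z hz => by
    obtain ⟨y, hy, hxy⟩ := h.exists_nearest x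
    refine hδU (Metric.mem_cthickening_of_dist_le z y δ _ hy ?_)
    have h1 := dist_triangle z x y
    have h2 : dist z x ≤ 2 * ρ := hz
    have h3 : ρ ≤ δ / 3 := min_le_left _ _
    linarith
  have hself : ∀ x, |d x| < ρ → x ∈ U := fun x hx =>
    hball x hx x (Metric.mem_closedBall_self (by positivity))
  have hdiffAt : ∀ z ∈ U, DifferentiableAt ℝ d z :=
    fun z hz => hdiff.differentiableAt (hU.mem_nhds hz)
  have hone : ∀ x ∈ U, ‖fderiv ℝ d x‖ = 1 := fun x hx =>
    h.norm_fderiv_eq_one hU hdiff hK.continuousOn hx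
  refine ⟨ρ, K, hρ0, ?_, ⟨hK0, h.lipschitz.continuous, ?_, fun x hx => ?_, fun x y hx hy => ?_,
    fun x s hx hs => ?_⟩, fun x hx => hdiffAt x (hself x hx)⟩
  · calc ρ * K ≤ 1 / (2 * (K + 1)) * K := by gcongr; exact min_le_right _ _
      _ ≤ 1 / 2 := by
        rw [div_mul_eq_mul_div, one_mul, div_le_div_iff₀ (by positivity) two_pos]
        linarith
  · exact (InnerProductSpace.toDual ℝ _).symm.continuous.measurable.comp (measurable_fderiv ℝ d)
  · rw [norm_gradient, hone x (hself x hx)]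
  · rw [gradient, gradient, ← map_sub, LinearIsometryEquiv.norm_map, ← dist_eq_norm, ← dist_eq_norm]
    exact hK.dist_le_mul x (hself x hx) y (hself y hy)
  · have hsρ : |s| ≤ 2 * ρ := by
      have := abs_sub (d x + s) (d x)
      rw [add_sub_cancel_left] at this
      linarith
    have hb : ∀ z ∈ Metric.closedBall x |s|, z ∈ U := fun z hz =>
      hball x hx z (Metric.closedBall_subset_closedBall hsρ hz)
    rcases le_total 0 s with h0 | h0
    · rw [abs_of_nonneg h0] at hb
      have hlip : LipschitzWith 1 fun w => -d w := h.lipschitz.neg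
      have := hlip.flow_sub h0 (x := x) fun z hz => ⟨(hdiffAt z (hb z hz)).neg, by
        rw [fderiv_fun_neg, norm_neg, hone z (hb z hz)]⟩
      simp only [gradient_neg_fun, smul_neg, sub_neg_eq_add, neg_inj] at this
      exact ⟨by linarith [this.1], this.2⟩
    · rw [abs_of_nonpos h0] at hb
      have := h.lipschitz.flow_sub (neg_nonneg.2 h0) (x := x)
        fun z hz => ⟨hdiffAt z (hb z hz), hone z (hb z hz)⟩
      simpa only [neg_smul, sub_neg_eq_add] using this

end IsSignedDist

/-- A monotone transition profile from `1` to `0` across the interval `(-ε, ε)`. -/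
structure IsProfile (θ : ℝ → ℝ) (ε : ℝ) (K : NNReal) : Prop where
  pos : 0 < ε
  lipschitz : LipschitzWith K θ
  deriv_neg : ∀ t, |t| < ε → deriv θ t < 0
  eq_one : ∀ t, t ≤ -ε → θ t = 1
  eq_zero : ∀ t, ε ≤ t → θ t = 0
  symm : ∀ t, θ (-t) = 1 - θ t

namespace IsProfile

variable {θ : ℝ → ℝ} {ε : ℝ} {K : NNReal}

theorem antitone (h : IsProfile θ ε K) : Antitone θ := by
  have h1 : AntitoneOn θ (Icc (-ε) ε) :=
    (strictAntiOn_of_deriv_neg (convex_Icc _ _) h.lipschitz.continuous.continuousOn fun t ht => by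
      rw [interior_Icc] at ht
      exact h.deriv_neg t (abs_lt.2 ht)).antitoneOn
  have hε := h.pos
  have h2 : AntitoneOn θ (Iic (-ε)) := fun x hx y hy _ => by rw [h.eq_one x hx, h.eq_one y hy]
  have h3 : AntitoneOn θ (Ici ε) := fun x hx y hy _ => by rw [h.eq_zero x hx, h.eq_zero y hy]
  have h4 : AntitoneOn θ (Iic ε) := by
    have := h2.union_right h1 isGreatest_Iic (isLeast_Icc (by linarith))
    rwa [Iic_union_Icc_eq_Iic (by linarith)] at this
  have := h4.union_right h3 isGreatest_Iic isLeast_Ici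
  rwa [Iic_union_Ici, antitoneOn_univ] at this

theorem nonneg (h : IsProfile θ ε K) (t : ℝ) : 0 ≤ θ t := by
  rw [← h.eq_zero (max t ε) (le_max_right _ _)]
  exact h.antitone (le_max_left _ _)

theorem le_one (h : IsProfile θ ε K) (t : ℝ) : θ t ≤ 1 := by
  rw [← h.eq_one (min t (-ε)) (min_le_right _ _)]
  exact h.antitone (min_le_left _ _)

theorem half_le (h : IsProfile θ ε K) {t : ℝ} (ht : t ≤ 0) : 1 / 2 ≤ θ t := by
  have h0 := h.symm 0
  rw [neg_zero] at h0
  have := h.antitone ht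
  linarith

theorem differentiableAt (h : IsProfile θ ε K) {t : ℝ} (ht : |t| < ε) : DifferentiableAt ℝ θ t :=
  differentiableAt_of_deriv_ne_zero (h.deriv_neg t ht).ne

theorem deriv_even (h : IsProfile θ ε K) (t : ℝ) : deriv θ (-t) = deriv θ t := by
  have h1 : θ = fun s => 1 - θ (-s) := by
    ext s
    rw [h.symm]; ring
  conv_rhs => rw [h1]
  rw [deriv_const_sub, deriv_comp_neg, neg_neg]

theorem abs_deriv_le (h : IsProfile θ ε K) (t : ℝ) : |deriv θ t| ≤ K :=
  norm_deriv_le_of_lipschitz h.lipschitz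

/-- Truncated first and second antiderivatives of the derivative of the profile (in the even
reflection), used to integrate by parts twice inside the interface. -/
theorem exists_antiderivatives (h : IsProfile θ ε K) {r : ℝ} (hr0 : 0 < r) (hr : r < ε) :
    ∃ a M : ℝ → ℝ, Measurable a ∧ Continuous M ∧ (∀ t, t ≠ 0 → ContinuousAt a t) ∧
      (∀ t, r ≤ |t| → a t = 0) ∧ (∀ t, r ≤ |t| → M t = 0) ∧ (∀ t, |a t| ≤ θ t) ∧
      (∀ t, |M t| ≤ ε * θ t) ∧
      (∀ t, t ∉ ({0, r, -r} : Set ℝ) → HasDerivAt a (if |t| < r then deriv θ t else 0) t) ∧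
      (∀ t, t ∉ ({0, r, -r} : Set ℝ) → HasDerivAt M (-a t) t) := by
  set m : ℝ → ℝ := fun t => max (θ t - θ r) 0 with hm
  have hmc : Continuous m := (h.lipschitz.continuous.sub continuous_const).max continuous_const
  have hm0 : ∀ t, 0 ≤ m t := fun t => le_max_right _ _
  have hmθ : ∀ t, m t ≤ θ t := fun t => max_le (by linarith [h.nonneg r]) (h.nonneg t)
  have hma : Antitone m := fun x y hxy => max_le_max (by linarith [h.antitone hxy]) le_rfl
  have hmr : ∀ t, r ≤ t → m t = 0 := fun t ht => max_eq_right (by linarith [h.antitone ht])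
  have hml : ∀ t, t ≤ r → m t = θ t - θ r := fun t ht => max_eq_left (by linarith [h.antitone ht])
  have hmabs : ∀ t, m |t| ≤ θ t := fun t => (hmθ _).trans (h.antitone (le_abs_self t))
  set P : ℝ → ℝ := fun t => ∫ τ in t..r, m τ with hP
  have hPd : ∀ t, HasDerivAt P (-m t) t := fun t =>
    intervalIntegral.integral_hasDerivAt_left (hmc.intervalIntegrable _ _)
      hmc.aestronglyMeasurable.stronglyMeasurableAtFilter hmc.continuousAt
  have hPr : ∀ t, r ≤ t → P t = 0 := fun t ht => by
    have : EqOn m (fun _ => 0) (uIcc t r) := fun τ hτ => by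
      rw [uIcc_of_ge ht] at hτ
      exact hmr τ hτ.1
    rw [hP]
    simp only
    rw [intervalIntegral.integral_congr this, intervalIntegral.integral_zero]
  have hPb : ∀ t, 0 ≤ t → |P t| ≤ ε * m t := fun t ht => by
    rcases le_total r t with hrt | hrt
    · rw [hPr t hrt, abs_zero]
      exact mul_nonneg h.pos.le (hm0 t)
    · have := intervalIntegral.norm_integral_le_of_norm_le_const (a := t) (b := r) (f := m)
        (C := m t) fun τ hτ => by
          rw [uIoc_of_le hrt] at hτ
          rw [Real.norm_eq_abs, abs_of_nonneg (hm0 τ)]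
          exact hma hτ.1.le
      rw [Real.norm_eq_abs] at this
      refine this.trans ?_
      rw [mul_comm, abs_of_nonneg (by linarith)]
      exact mul_le_mul_of_nonneg_right (by linarith) (hm0 t)
  have hsign : ∀ t : ℝ, t ≠ 0 → ∀ᶠ s in 𝓝 t, Real.sign s = Real.sign t := fun t ht => by
    rcases ht.lt_or_gt with h0 | h0
    · filter_upwards [Iio_mem_nhds h0] with s (hs : s < 0)
      rw [Real.sign_of_neg hs, Real.sign_of_neg h0]
    · filter_upwards [Ioi_mem_nhds h0] with s (hs : 0 < s)
      rw [Real.sign_of_pos hs, Real.sign_of_pos h0]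
  have habs : ∀ t : ℝ, t ≠ 0 → HasDerivAt (fun s : ℝ => |s|) (Real.sign t) t := fun t ht => by
    rcases ht.lt_or_gt with h0 | h0
    · rw [Real.sign_of_neg h0]; exact hasDerivAt_abs_neg h0
    · rw [Real.sign_of_pos h0]; exact hasDerivAt_abs_pos h0
  have hss : ∀ t : ℝ, t ≠ 0 → Real.sign t * Real.sign t = 1 := fun t ht => by
    rcases ht.lt_or_gt with h0 | h0
    · rw [Real.sign_of_neg h0]; norm_num
    · rw [Real.sign_of_pos h0]; norm_num
  have hsabs : ∀ t : ℝ, |Real.sign t| ≤ 1 := fun t => by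
    rcases Real.sign_apply_eq t with h0 | h0 | h0 <;> rw [h0] <;> norm_num
  have hsm : Measurable Real.sign := by
    unfold Real.sign
    exact Measurable.ite measurableSet_Iio measurable_const
      (Measurable.ite measurableSet_Ioi measurable_const measurable_const)
  refine ⟨fun t => Real.sign t * m |t|, fun t => P |t|,
    hsm.mul (hmc.measurable.comp continuous_abs.measurable), ?_, fun t ht => ?_, fun t ht => ?_,
    fun t ht => hPr _ ht, fun t => ?_, fun t => ?_, fun t ht => ?_, fun t ht => ?_⟩
  · exact (continuous_iff_continuousAt.2 fun t => (hPd t).continuousAt).comp continuous_abs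
  · refine ContinuousAt.mul ?_ (hmc.comp continuous_abs).continuousAt
    exact continuousAt_const.congr ((hsign t ht).mono fun s hs => hs.symm)
  · simp only [hmr _ ht, mul_zero]
  · rw [abs_mul, abs_of_nonneg (hm0 |t|)]
    exact (mul_le_of_le_one_left (hm0 _) (hsabs t)).trans (hmabs t)
  · exact (hPb _ (abs_nonneg t)).trans (mul_le_mul_of_nonneg_left (hmabs t) h.pos.le)
  · simp only [mem_insert_iff, mem_singleton_iff, not_or] at ht
    have htr : |t| ≠ r := fun hc => by
      rcases (abs_eq hr0.le).1 hc with h1 | h1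
      · exact ht.2.1 h1
      · exact ht.2.2 h1
    have hmd : HasDerivAt m (if |t| < r then deriv θ t else 0) |t| := by
      split_ifs with hlt
      · have h1 : HasDerivAt θ (deriv θ t) |t| := by
          have h2 := (h.differentiableAt (t := |t|) (by rw [abs_abs]; linarith)).hasDerivAt
          rcases abs_choice t with h3 | h3
          · rwa [h3] at h2 ⊢
          · rw [h3] at h2 ⊢
            rwa [h.deriv_even] at h2
        refine (h1.sub_const (θ r)).congr_of_eventuallyEq ?_
        filter_upwards [Iio_mem_nhds hlt] with s hs
        exact hml s (le_of_lt hs)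
      · refine (hasDerivAt_const _ (0 : ℝ)).congr_of_eventuallyEq ?_
        filter_upwards [Ioi_mem_nhds (lt_of_le_of_ne (not_lt.1 hlt) htr.symm)] with s hs
        exact hmr s (le_of_lt hs)
    have h1 := (hmd.comp t (habs t ht.1)).const_mul (Real.sign t)
    have h2 : Real.sign t * ((if |t| < r then deriv θ t else 0) * Real.sign t) =
        if |t| < r then deriv θ t else 0 := by
      rw [mul_comm, mul_assoc, hss t ht.1, mul_one]
    rw [h2] at h1
    refine h1.congr_of_eventuallyEq ((hsign t ht.1).mono fun s hs => ?_)
    simp only [hs, Function.comp_apply]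
  · simp only [mem_insert_iff, mem_singleton_iff, not_or] at ht
    have h1 := (hPd |t|).comp t (habs t ht.1)
    have h2 : -m |t| * Real.sign t = -(Real.sign t * m |t|) := by ring
    rwa [h2] at h1

end IsProfile

theorem Measurable.clm_apply_of_measurable {X E F : Type*} [MeasurableSpace X]
    [NormedAddCommGroup E] [NormedSpace ℝ E] [MeasurableSpace E] [BorelSpace E]
    [SecondCountableTopology E] [NormedAddCommGroup F] [NormedSpace ℝ F] [MeasurableSpace F]
    [BorelSpace F] {φ : X → E →L[ℝ] F} {g : X → E} (hφ : Measurable φ) (hg : Measurable g) :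
    Measurable fun x => φ x (g x) :=
  (isBoundedBilinearMap_apply (𝕜 := ℝ) (E := E) (F := F)).continuous.measurable.comp
    (hφ.prodMk hg)

theorem enorm_clm_apply_le {E F : Type*} [NormedAddCommGroup E] [NormedSpace ℝ E]
    [NormedAddCommGroup F] [NormedSpace ℝ F] (φ : E →L[ℝ] F) {e : E} (he : ‖e‖ ≤ 1) :
    ‖φ e‖ₑ ≤ ‖φ‖ₑ := by
  rw [enorm_le_iff_norm_le]
  exact (φ.le_opNorm e).trans (mul_le_of_le_one_right (norm_nonneg _) he)

namespace IsNormalTube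

variable {n : ℕ} {d : EuclideanSpace ℝ (Fin n) → ℝ}
  {N : EuclideanSpace ℝ (Fin n) → EuclideanSpace ℝ (Fin n)} {ρ L : ℝ}

/-- Two integrations by parts along the normals, for a function `u` that vanishes on `d = 0`. -/
theorem enorm_integral_mul_le (h : IsNormalTube d N ρ L) {r ε A : ℝ} (hrε : r < ε)
    (hερ : ε ≤ ρ) {a M k : ℝ → ℝ} (ham : Measurable a) (hMc : Continuous M) (hkm : Measurable k)
    (hac : ∀ t, t ≠ 0 → ContinuousAt a t) (ha0 : ∀ t, r ≤ |t| → a t = 0)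
    (hM0 : ∀ t, r ≤ |t| → M t = 0) (hk0 : ∀ t, r ≤ |t| → k t = 0) (haA : ∀ t, |a t| ≤ A)
    (ha' : ∀ t, t ∉ ({0, r, -r} : Set ℝ) → HasDerivAt a (k t) t)
    (hM' : ∀ t, t ∉ ({0, r, -r} : Set ℝ) → HasDerivAt M (-a t) t)
    {u v : EuclideanSpace ℝ (Fin n) → ℝ} (hum : Measurable u) (hvm : Measurable v)
    (hu : ∀ x, |d x| < ε → DifferentiableAt ℝ u x)
    (hu' : ∀ x, |d x| < ε → DifferentiableAt ℝ (fun y => fderiv ℝ u y) x)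
    (hu0 : ∀ x, d x = 0 → u x = 0) (hv : ∀ x, |d x| < ε → DifferentiableAt ℝ v x)
    (hint : Integrable fun x => k (d x) * (u x * v x)) :
    ‖∫ x, k (d x) * (u x * v x)‖ₑ ≤
      (∫⁻ x, (‖a (d x)‖ₑ * (‖u x‖ₑ * ‖fderiv ℝ v x‖ₑ) +
        ‖M (d x)‖ₑ * (‖fderiv ℝ u x‖ₑ * ‖fderiv ℝ v x‖ₑ +
          ‖fderiv ℝ (fun y => fderiv ℝ u y) x‖ₑ * ‖v x‖ₑ))) +
      ENNReal.ofReal (3 ^ n * (2 * L + 1)) * ∫⁻ x, (‖a (d x)‖ₑ * (‖u x‖ₑ * ‖v x‖ₑ) +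
        ‖M (d x)‖ₑ * (‖fderiv ℝ u x‖ₑ * ‖v x‖ₑ)) := by
  have hL := h.nonneg
  have hc0 : 0 < 3 ^ n * (2 * L + 1) := by positivity
  set I₁ := ∫⁻ x, (‖a (d x)‖ₑ * (‖u x‖ₑ * ‖fderiv ℝ v x‖ₑ) +
        ‖M (d x)‖ₑ * (‖fderiv ℝ u x‖ₑ * ‖fderiv ℝ v x‖ₑ +
          ‖fderiv ℝ (fun y => fderiv ℝ u y) x‖ₑ * ‖v x‖ₑ)) with hI₁
  set I₂ := ∫⁻ x, (‖a (d x)‖ₑ * (‖u x‖ₑ * ‖v x‖ₑ) +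
        ‖M (d x)‖ₑ * (‖fderiv ℝ u x‖ₑ * ‖v x‖ₑ)) with hI₂
  by_cases hI₁t : I₁ = ⊤
  · rw [hI₁t, top_add]; exact le_top
  by_cases hI₂t : I₂ = ⊤
  · rw [hI₂t, ENNReal.mul_top (by simpa using hc0), add_top]; exact le_top
  have hdm : Measurable d := h.continuous.measurable
  have hNm := h.measurable
  have hum' : Measurable (fderiv ℝ u) := measurable_fderiv ℝ u
  have hvm' : Measurable (fderiv ℝ v) := measurable_fderiv ℝ v
  have hum'' : Measurable (fderiv ℝ fun y => fderiv ℝ u y) := measurable_fderiv ℝ _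
  have hadm : Measurable fun x => a (d x) := ham.comp hdm
  have hMdm : Measurable fun x => M (d x) := hMc.measurable.comp hdm
  have hkdm : Measurable fun x => k (d x) := hkm.comp hdm
  have hun : Measurable fun x => fderiv ℝ u x (N x) := hum'.clm_apply_of_measurable hNm
  have hvn : Measurable fun x => fderiv ℝ v x (N x) := hvm'.clm_apply_of_measurable hNm
  have hunn : Measurable fun x => fderiv ℝ (fun y => fderiv ℝ u y) x (N x) (N x) :=
    (hum''.clm_apply_of_measurable hNm).clm_apply_of_measurable hNm
  set f : EuclideanSpace ℝ (Fin n) → ℝ := fun x =>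
    a (d x) * (u x * v x) + M (d x) * (fderiv ℝ u x (N x) * v x) with hf
  set G : EuclideanSpace ℝ (Fin n) → ℝ := fun x => a (d x) * (u x * fderiv ℝ v x (N x)) +
    M (d x) * (fderiv ℝ u x (N x) * fderiv ℝ v x (N x) +
      fderiv ℝ (fun y => fderiv ℝ u y) x (N x) (N x) * v x) with hG
  have hfm : Measurable f := (hadm.mul (hum.mul hvm)).add (hMdm.mul (hun.mul hvm))
  have hGm : Measurable G := (hadm.mul (hum.mul hvn)).add
    (hMdm.mul ((hun.mul hvn).add (hunn.mul hvm)))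
  have hN1 : ∀ x, |d x| < r → ‖N x‖ ≤ 1 := fun x hx => (h.norm_eq x (by linarith)).le
  have hfle : ∀ x, ‖f x‖ₑ ≤ ‖a (d x)‖ₑ * (‖u x‖ₑ * ‖v x‖ₑ) +
        ‖M (d x)‖ₑ * (‖fderiv ℝ u x‖ₑ * ‖v x‖ₑ) := fun x => by
    rcases lt_or_ge |d x| r with hx | hx
    · refine (enorm_add_le _ _).trans ?_
      simp only [enorm_mul]
      gcongr
      exact enorm_clm_apply_le _ (hN1 x hx)
    · simp [hf, ha0 _ hx, hM0 _ hx]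
  have hGle : ∀ x, ‖G x‖ₑ ≤ ‖a (d x)‖ₑ * (‖u x‖ₑ * ‖fderiv ℝ v x‖ₑ) +
        ‖M (d x)‖ₑ * (‖fderiv ℝ u x‖ₑ * ‖fderiv ℝ v x‖ₑ +
          ‖fderiv ℝ (fun y => fderiv ℝ u y) x‖ₑ * ‖v x‖ₑ) := fun x => by
    rcases lt_or_ge |d x| r with hx | hx
    · refine (enorm_add_le _ _).trans ?_
      rw [enorm_mul, enorm_mul, enorm_mul]
      have h1 := enorm_clm_apply_le (fderiv ℝ v x) (hN1 x hx)
      have h2 := enorm_clm_apply_le (fderiv ℝ u x) (hN1 x hx)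
      have h3 := (enorm_clm_apply_le _ (hN1 x hx)).trans
        (enorm_clm_apply_le (fderiv ℝ (fun y => fderiv ℝ u y) x) (hN1 x hx))
      gcongr
      refine (enorm_add_le _ _).trans ?_
      rw [enorm_mul, enorm_mul]
      gcongr
    · simp [hG, ha0 _ hx, hM0 _ hx]
  have hfi : Integrable f := ⟨hfm.aestronglyMeasurable,
    (lintegral_mono hfle).trans_lt (lt_top_iff_ne_top.2 hI₂t)⟩
  have hGi : Integrable G := ⟨hGm.aestronglyMeasurable,
    (lintegral_mono hGle).trans_lt (lt_top_iff_ne_top.2 hI₁t)⟩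
  have hline : ∀ x s, HasDerivAt (fun s : ℝ => x + s • N x) (N x) s := fun x s => by
    simpa using ((hasDerivAt_id s).smul_const (N x)).const_add x
  have hflow : ∀ x, |d x| < ρ → ∀ s, |d x + s| < ρ → ∀ᶠ s' in 𝓝 s,
      d (x + s' • N x) = d x + s' ∧ N (x + s' • N x) = N x := fun x hx s hs => by
    have : ∀ᶠ s' : ℝ in 𝓝 s, |d x + s'| < ρ :=
      (continuous_const.add continuous_id).abs.continuousAt.eventually_lt_const hs
    exact this.mono fun s' hs' => h.flow x s' hx hs'
  have hfline : ∀ x, |d x| < ρ → ∀ s, |d x + s| < ρ →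
      (fun s : ℝ => f (x + s • N x)) =ᶠ[𝓝 s] fun s => a (d x + s) *
        (u (x + s • N x) * v (x + s • N x)) +
        M (d x + s) * (fderiv ℝ u (x + s • N x) (N x) * v (x + s • N x)) := fun x hx s hs =>
    (hflow x hx s hs).mono fun s' hs' => by simp only [hf, hs'.1, hs'.2]
  have hfzero : ∀ x, |d x| < ρ → ∀ s, |d x + s| < ρ → r < |d x + s| →
      (fun s : ℝ => f (x + s • N x)) =ᶠ[𝓝 s] fun _ => 0 := fun x hx s hs hrs => by
    have : ∀ᶠ s' : ℝ in 𝓝 s, r < |d x + s'| :=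
      (continuous_const.add continuous_id).abs.continuousAt.eventually_const_lt hrs
    filter_upwards [this, hfline x hx s hs] with s' h1 h2
    rw [h2, ha0 _ h1.le, hM0 _ h1.le, zero_mul, zero_mul, add_zero]
  have hdu : ∀ x s, d (x + s • N x) = d x + s → |d x + s| < ε →
      HasDerivAt (fun s : ℝ => u (x + s • N x)) (fderiv ℝ u (x + s • N x) (N x)) s :=
    fun x s hd hs => (hu _ (by rwa [hd])).hasFDerivAt.comp_hasDerivAt s (hline x s)
  have hdv : ∀ x s, d (x + s • N x) = d x + s → |d x + s| < ε →
      HasDerivAt (fun s : ℝ => v (x + s • N x)) (fderiv ℝ v (x + s • N x) (N x)) s :=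
    fun x s hd hs => (hv _ (by rwa [hd])).hasFDerivAt.comp_hasDerivAt s (hline x s)
  have hddu : ∀ x s, d (x + s • N x) = d x + s → |d x + s| < ε →
      HasDerivAt (fun s : ℝ => fderiv ℝ u (x + s • N x) (N x))
        (fderiv ℝ (fun y => fderiv ℝ u y) (x + s • N x) (N x) (N x)) s := fun x s hd hs => by
    have h1 : HasDerivAt (fun s : ℝ => fderiv ℝ u (x + s • N x))
        (fderiv ℝ (fun y => fderiv ℝ u y) (x + s • N x) (N x)) s :=
      (hu' _ (by rwa [hd])).hasFDerivAt.comp_hasDerivAt s (hline x s)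
    simpa using h1.clm_apply (hasDerivAt_const s (N x))
  have hshift : ∀ x s, HasDerivAt (fun s : ℝ => d x + s) 1 s := fun x s =>
    (hasDerivAt_id s).const_add (d x)
  have hF := h.abs_integral_normal_deriv_le (ε := r) (T := {0, r, -r})
    (F := fun x => k (d x) * (u x * v x) + G x)
    (lt_of_lt_of_le hrε hερ) hfm hfi ((hkdm.mul (hum.mul hvm)).add hGm) (hint.add hGi)
    (fun x hx => by simp only [hf, ha0 _ hx, hM0 _ hx, zero_mul, add_zero])
    (fun x hx => by simp only [hG, ha0 _ hx, hM0 _ hx, hk0 _ hx, zero_mul, add_zero])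
    (fun x hx s hs => ?_) (by simp) (fun x hx s hs hsT => ?_)
  · have hGint : ∫ x, k (d x) * (u x * v x) =
        (∫ x, (k (d x) * (u x * v x) + G x)) - ∫ x, G x := by
      rw [integral_add hint hGi, add_sub_cancel_right]
    rw [hGint]
    refine enorm_sub_le.trans ?_
    rw [add_comm]
    gcongr
    · exact (enorm_integral_le_lintegral_enorm _).trans (lintegral_mono hGle)
    · have h1 : ‖∫ x, (k (d x) * (u x * v x) + G x)‖ₑ ≤
          ENNReal.ofReal (3 ^ n * (2 * L + 1) * ∫ x, ‖f x‖) := by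
        rw [← ofReal_norm]
        refine ENNReal.ofReal_le_ofReal (hF.trans ?_)
        have : 0 ≤ ∫ x, ‖f x‖ := integral_nonneg fun _ => norm_nonneg _
        simp only [Real.norm_eq_abs] at this ⊢
        gcongr
        linarith
      refine h1.trans ?_
      rw [ENNReal.ofReal_mul hc0.le]
      gcongr
      rw [ofReal_integral_norm_eq_lintegral_enorm hfi]
      exact lintegral_mono hfle
  · rcases lt_or_ge r |d x + s| with hrs | hrs
    · exact continuousAt_const.congr (hfzero x hx s hs hrs).symm
    · have hd := (h.flow x s hx hs).1
      have hsε : |d x + s| < ε := by linarith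
      refine ContinuousAt.congr ?_ (hfline x hx s hs).symm
      have cu := (hdu x s hd hsε).continuousAt
      have cv := (hdv x s hd hsε).continuousAt
      refine ContinuousAt.add ?_ (((hMc.comp (continuous_const.add continuous_id)).continuousAt).mul
        ((hddu x s hd hsε).continuousAt.mul cv))
      by_cases h0 : d x + s = 0
      · have hus : u (x + s • N x) = 0 := hu0 _ (by rw [hd, h0])
        rw [ContinuousAt, hus, zero_mul, mul_zero]
        have htend : Tendsto (fun s : ℝ => A * |u (x + s • N x) * v (x + s • N x)|)
            (𝓝 s) (𝓝 0) := by
          have := ((cu.tendsto.mul cv.tendsto).abs).const_mul A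
          simpa only [hus, zero_mul, abs_zero, mul_zero] using this
        refine squeeze_zero_norm (fun s' => ?_) htend
        rw [norm_mul, Real.norm_eq_abs, Real.norm_eq_abs]
        exact mul_le_mul_of_nonneg_right (haA _) (abs_nonneg _)
      · exact (ContinuousAt.comp (f := fun s : ℝ => d x + s) (hac _ h0)
          (hshift x s).continuousAt).mul (cu.mul cv)
  · rcases lt_or_ge r |d x + s| with hrs | hrs
    · have hd := h.flow x s hx hs
      have h0 : k (d (x + s • N x)) * (u (x + s • N x) * v (x + s • N x)) + G (x + s • N x) =
          0 := by
        simp only [hG, hd.1, ha0 _ hrs.le, hM0 _ hrs.le, hk0 _ hrs.le, zero_mul, add_zero]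
      rw [h0]
      exact (hasDerivAt_const s (0 : ℝ)).congr_of_eventuallyEq (hfzero x hx s hs hrs)
    · have hd := h.flow x s hx hs
      have hsε : |d x + s| < ε := by linarith
      refine HasDerivAt.congr_of_eventuallyEq ?_ (hfline x hx s hs)
      have da := (ha' _ hsT).comp s (hshift x s)
      have dM := (hM' _ hsT).comp s (hshift x s)
      have du := hdu x s hd.1 hsε
      have dv := hdv x s hd.1 hsε
      have ddu := hddu x s hd.1 hsε
      refine ((da.mul (du.mul dv)).add (dM.mul (ddu.mul dv))).congr_deriv ?_
      simp only [hG, hd.1, hd.2, Function.comp_apply, Pi.mul_apply]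
      ring

theorem enorm_setIntegral_deriv_profile_mul_le (h : IsNormalTube d N ρ L) {θ : ℝ → ℝ} {ε : ℝ}
    {K : NNReal} (hθ : IsProfile θ ε K) (hερ : ε ≤ ρ)
    {u v : EuclideanSpace ℝ (Fin n) → ℝ} (hum : Measurable u) (hvm : Measurable v)
    (hu : ∀ x, |d x| < ε → DifferentiableAt ℝ u x)
    (hu' : ∀ x, |d x| < ε → DifferentiableAt ℝ (fun y => fderiv ℝ u y) x)
    (hu0 : ∀ x, d x = 0 → u x = 0) (hv : ∀ x, |d x| < ε → DifferentiableAt ℝ v x) :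
    ‖∫ x in {x | |d x| < ε}, deriv θ (d x) * (u x * v x)‖ₑ ≤
      (∫⁻ x in {x | |d x| < ε}, ENNReal.ofReal (θ (d x)) * (‖u x‖ₑ * ‖fderiv ℝ v x‖ₑ +
        ENNReal.ofReal ε * (‖fderiv ℝ u x‖ₑ * ‖fderiv ℝ v x‖ₑ +
          ‖fderiv ℝ (fun y => fderiv ℝ u y) x‖ₑ * ‖v x‖ₑ))) +
      ENNReal.ofReal (3 ^ n * (2 * L + 1)) * ∫⁻ x in {x | |d x| < ε},
        ENNReal.ofReal (θ (d x)) * (‖u x‖ₑ * ‖v x‖ₑ +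
          ENNReal.ofReal ε * (‖fderiv ℝ u x‖ₑ * ‖v x‖ₑ)) := by
  set T := {x | |d x| < ε} with hT
  have hTm : MeasurableSet T := h.measurableSet_tube ε
  by_cases hint : IntegrableOn (fun x => deriv θ (d x) * (u x * v x)) T
  swap
  · rw [integral_undef hint]; simp
  have hdm : Measurable d := h.continuous.measurable
  obtain ⟨r, hr_mono, hr_mem, hr_lim⟩ := exists_seq_strictMono_tendsto' hθ.pos
  have hsets : (⋃ m, {x | |d x| < r m}) = T := by
    ext x
    simp only [mem_iUnion, Set.mem_ofPred_eq, hT]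
    refine ⟨fun ⟨m, hm⟩ => hm.trans (hr_mem m).2, fun hx => ?_⟩
    exact ((hr_lim.eventually_const_lt hx)).exists
  have hlim := tendsto_setIntegral_of_monotone (μ := volume)
    (f := fun x => deriv θ (d x) * (u x * v x)) (s := fun m => {x | |d x| < r m})
    (fun m => h.measurableSet_tube (r m))
    (fun i j hij x hx => lt_of_lt_of_le hx (hr_mono.monotone hij)) (by rwa [hsets])
  rw [hsets] at hlim
  refine le_of_tendsto hlim.enorm (Eventually.of_forall fun m => ?_)
  obtain ⟨hr0, hrε⟩ := hr_mem m
  obtain ⟨a, M, ham, hMc, hac, ha0, hM0, haθ, hMθ, ha', hM'⟩ := hθ.exists_antiderivatives hr0 hrε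
  set k : ℝ → ℝ := fun t => if |t| < r m then deriv θ t else 0 with hk
  have hkm : Measurable k := Measurable.ite
    (isOpen_lt continuous_abs continuous_const).measurableSet (measurable_deriv θ) measurable_const
  have hkeq : (fun x => k (d x) * (u x * v x)) =
      {x | |d x| < r m}.indicator fun x => deriv θ (d x) * (u x * v x) := by
    ext x
    by_cases hx : |d x| < r m <;> simp [hk, hx]
  have hsub : {x | |d x| < r m} ⊆ T := fun x hx => lt_trans hx hrε
  have hki : Integrable fun x => k (d x) * (u x * v x) := by
    rw [hkeq, integrable_indicator_iff (h.measurableSet_tube _)]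
    exact hint.mono_set hsub
  have hmain := h.enorm_integral_mul_le (A := 1) hrε hερ ham hMc hkm hac ha0 hM0
    (fun t ht => by simp [hk, not_lt.2 ht]) (fun t => (haθ t).trans (hθ.le_one t)) ha' hM'
    hum hvm hu hu' hu0 hv hki
  rw [hkeq, integral_indicator (h.measurableSet_tube _)] at hmain
  refine hmain.trans ?_
  have ha : ∀ x, ‖a (d x)‖ₑ ≤ T.indicator (fun x => ENNReal.ofReal (θ (d x))) x := fun x => by
    by_cases hx : x ∈ T
    · rw [indicator_of_mem hx, ← ofReal_norm]
      exact ENNReal.ofReal_le_ofReal (haθ _)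
    · have : r m ≤ |d x| := hrε.le.trans (not_lt.1 hx)
      simp [ha0 _ this]
  have hM : ∀ x, ‖M (d x)‖ₑ ≤
      T.indicator (fun x => ENNReal.ofReal ε * ENNReal.ofReal (θ (d x))) x := fun x => by
    by_cases hx : x ∈ T
    · rw [indicator_of_mem hx, ← ofReal_norm, ← ENNReal.ofReal_mul hθ.pos.le]
      exact ENNReal.ofReal_le_ofReal (hMθ _)
    · have : r m ≤ |d x| := hrε.le.trans (not_lt.1 hx)
      simp [hM0 _ this]
  rw [← lintegral_indicator hTm, ← lintegral_indicator hTm]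
  gcongr with x x
  · refine (add_le_add (mul_le_mul_left (ha x) _) (mul_le_mul_left (hM x) _)).trans ?_
    by_cases hx : x ∈ T
    · simp only [indicator_of_mem hx]
      exact le_of_eq (by ring)
    · simp [indicator_of_notMem hx]
  · refine (add_le_add (mul_le_mul_left (ha x) _) (mul_le_mul_left (hM x) _)).trans ?_
    by_cases hx : x ∈ T
    · simp only [indicator_of_mem hx]
      exact le_of_eq (by ring)
    · simp [indicator_of_notMem hx]

end IsNormalTube

section wMeas

variable {n : ℕ} {U V : Set (EuclideanSpace ℝ (Fin n))} {w : EuclideanSpace ℝ (Fin n) → ℝ}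

theorem lintegral_wMeas (hw : Measurable w) {f : EuclideanSpace ℝ (Fin n) → ℝ≥0∞}
    (hf : Measurable f) : ∫⁻ x, f x ∂wMeas U w = ∫⁻ x in U, ENNReal.ofReal (w x) * f x :=
  lintegral_withDensity_eq_lintegral_mul _ hw.ennreal_ofReal hf

theorem wMeas_mono (hUV : U ⊆ V) : wMeas U w ≤ wMeas V w :=
  Measure.le_intro fun s hs _ => by
    rw [wMeas, wMeas, withDensity_apply _ hs, withDensity_apply _ hs]
    exact lintegral_mono' (Measure.restrict_mono_measure (Measure.restrict_mono hUV le_rfl) s)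
        le_rfl

theorem wMeas_univ_le (hw : Measurable w) (hw1 : ∀ x, w x ≤ 1) : wMeas U w univ ≤ volume U := by
  rw [← lintegral_one, lintegral_wMeas hw measurable_const]
  calc ∫⁻ x in U, ENNReal.ofReal (w x) * 1 ≤ ∫⁻ _ in U, 1 := lintegral_mono fun x => by
        rw [mul_one]; exact ENNReal.ofReal_le_one.2 (hw1 x)
    _ = volume U := by simp

theorem eLpNorm_wMeas (hw : Measurable w) {F : Type*} [NormedAddCommGroup F]
    {g : EuclideanSpace ℝ (Fin n) → F} (hg : Measurable fun x => ‖g x‖ₑ) {p : ℝ≥0∞} (hp : 1 ≤ p)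
    (hp' : p ≠ ⊤) : eLpNorm g p (wMeas U w) =
      (∫⁻ x in U, ENNReal.ofReal (w x) * ‖g x‖ₑ ^ p.toReal) ^ (1 / p.toReal) := by
  rw [eLpNorm_eq_lintegral_rpow_enorm_toReal (by positivity) hp',
    lintegral_wMeas hw (hg.pow_const _)]

end wMeas

namespace IsNormalTube

variable {n : ℕ} {d : EuclideanSpace ℝ (Fin n) → ℝ}
  {N : EuclideanSpace ℝ (Fin n) → EuclideanSpace ℝ (Fin n)} {ρ L : ℝ}

/-- Trace inequality on the diffuse boundary layer. -/
theorem exists_eLpNorm_trace_le (h : IsNormalTube d N ρ L) (hρ : 0 < ρ) (hρL : ρ * L ≤ 1 / 2)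
    (F : Type*) [NormedAddCommGroup F] [NormedSpace ℝ F] [CompleteSpace F] {p : ℝ≥0∞}
    (hp : 1 ≤ p) : ∃ C : ℝ≥0∞, C ≠ ⊤ ∧ ∀ (θ : ℝ → ℝ) (ε : ℝ) (K : NNReal), IsProfile θ ε K →
      ε ≤ ρ / 2 → ∀ w : EuclideanSpace ℝ (Fin n) → F, (∀ x, d x < ε → DifferentiableAt ℝ w x) →
      (Measurable fun x => ‖w x‖ₑ) → (Measurable fun x => ‖fderiv ℝ w x‖ₑ) →
      eLpNorm w p (wMeas {x | |d x| < ε} fun x => θ (d x)) ≤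
        C * ENNReal.ofReal ε ^ (1 / p).toReal *
          (eLpNorm w p (wMeas {x | d x < ε} fun x => θ (d x)) +
            eLpNorm (fderiv ℝ w) p (wMeas {x | d x < ε} fun x => θ (d x))) := by
  by_cases hpt : p = ⊤
  · refine ⟨1, one_ne_top, fun θ ε K hθ hε w hw hwm hwm' => ?_⟩
    simp only [hpt, div_top, toReal_zero, rpow_zero, one_mul]
    have hsub : {x | |d x| < ε} ⊆ {x | d x < ε} := fun x (hx : |d x| < ε) =>
      (le_abs_self _).trans_lt hx
    have h1 := eLpNorm_mono_measure (p := ⊤) w (wMeas_mono (w := fun x => θ (d x)) hsub)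
    exact h1.trans (self_le_add_right _ _)
  have hr : 1 ≤ p.toReal := by simpa using ENNReal.toReal_mono hpt hp
  set r := p.toReal with hr_def
  have hr0 : 0 < r := by linarith
  have hir : (1 / p).toReal = 1 / r := by rw [toReal_div, toReal_one]
  rw [hir]
  set C₁ : ℝ≥0∞ := 2 ^ (r - 1) * (1 + ENNReal.ofReal (ρ / 2) ^ r) / ENNReal.ofReal (ρ / 2) * 2 ^ n
  have hC₁ : C₁ ≠ ⊤ := by
    refine mul_ne_top (div_ne_top (mul_ne_top (rpow_ne_top_of_nonneg (by linarith) (by simp))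
      (add_ne_top.2 ⟨one_ne_top, rpow_ne_top_of_nonneg hr0.le ofReal_ne_top⟩)) ?_) (by simp)
    simpa using hρ
  refine ⟨(C₁ * 2) ^ (1 / r), rpow_ne_top_of_nonneg (by positivity) (mul_ne_top hC₁ (by simp)),
    fun θ ε K hθ hε w hw hwm hwm' => ?_⟩
  have hdm : Measurable d := h.continuous.measurable
  have hθm : Measurable fun x => θ (d x) := hθ.lipschitz.continuous.measurable.comp hdm
  have hT := h.neg.lintegral_trace_le (ε := ε) (δ := ρ / 2) hr (by linarith)
    (by linarith) (by linarith) (w := w) (fun x hx => hw x (by linarith)) hwm hwm'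
    (W := fun x => ENNReal.ofReal (θ (d x))) hθm.ennreal_ofReal (fun x hx s hs => by
      rw [abs_neg] at hx
      refine ENNReal.ofReal_le_ofReal (hθ.antitone ?_)
      have h1 := (h.neg.flow x s (by rw [abs_neg]; linarith) ?_).1
      · linarith [hs.1]
      · rw [abs_lt] at hx ⊢
        constructor <;> linarith [hs.1, hs.2, hx.1, hx.2])
  simp only [abs_neg, neg_lt_neg_iff] at hT
  rw [eLpNorm_wMeas hθm hwm hp hpt, eLpNorm_wMeas hθm hwm hp hpt, eLpNorm_wMeas hθm hwm' hp hpt,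
    ← hr_def]
  have hir0 : 0 ≤ 1 / r := by positivity
  calc _ ≤ _ := ENNReal.rpow_le_rpow hT hir0
    _ = ((C₁ * 2) * ENNReal.ofReal ε * ((∫⁻ x in {x | d x < ε}, ENNReal.ofReal (θ (d x)) *
          ‖w x‖ₑ ^ r) + ∫⁻ x in {x | d x < ε}, ENNReal.ofReal (θ (d x)) *
          ‖fderiv ℝ w x‖ₑ ^ r)) ^ (1 / r) := by
        rw [← lintegral_add_left
          (show Measurable fun x => ENNReal.ofReal (θ (d x)) * ‖w x‖ₑ ^ r from
          hθm.ennreal_ofReal.mul (hwm.pow_const _)), ENNReal.ofReal_mul zero_le_two, ofReal_ofNat]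
        simp only [← mul_add, ← mul_assoc]
        rfl
    _ ≤ _ := by
        rw [ENNReal.mul_rpow_of_nonneg _ _ hir0, ENNReal.mul_rpow_of_nonneg _ _ hir0]
        gcongr
        exact ENNReal.rpow_add_le_add_rpow _ _ hir0 (by rw [div_le_one hr0]; exact hr)

theorem enorm_le_lintegral_of_eq_zero (h : IsNormalTube d N ρ L) {ε : ℝ} (hερ : ε ≤ ρ)
    {u : EuclideanSpace ℝ (Fin n) → ℝ} (hu : ∀ x, |d x| < ε → DifferentiableAt ℝ u x)
    (hu0 : ∀ x, d x = 0 → u x = 0) {x : EuclideanSpace ℝ (Fin n)} (hx : -ε < d x)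
    (hx0 : d x ≤ 0) : ‖u x‖ₑ ≤ ∫⁻ s in Ioc 0 (-d x), ‖fderiv ℝ u (x + s • N x)‖ₑ := by
  have hxρ : |d x| < ρ := abs_lt.2 ⟨by linarith, by linarith⟩
  have hfl : ∀ t ∈ Icc 0 (-d x), d (x + t • N x) = d x + t := fun t ht =>
    (h.flow x t hxρ (abs_lt.2 ⟨by linarith [ht.1], by linarith [ht.2]⟩)).1
  have h1 := enorm_sub_le_lintegral_fderiv (w := u) (x := x) (e := N x) (s := -d x)
    (by linarith) (h.norm_eq x hxρ).le fun t ht => hu _ (by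
      rw [hfl t ht]
      exact abs_lt.2 ⟨by linarith [ht.1], by linarith [ht.2]⟩)
  rwa [hu0 _ (by rw [hfl _ ⟨by linarith, le_rfl⟩]; ring), zero_sub, enorm_neg] at h1

/-- Poincaré inequality on one side of the diffuse boundary layer. -/
theorem lintegral_rpow_le_of_eq_zero (h : IsNormalTube d N ρ L) {ε r : ℝ} (hr : 1 ≤ r)
    (hεL : ε * L ≤ 1 / 2) (hε : 0 < ε) (hερ : ε ≤ ρ)
    {W : EuclideanSpace ℝ (Fin n) → ℝ≥0∞} (hWm : Measurable W)
    (hW : ∀ x, -ε < d x → d x ≤ 0 → ∀ s ∈ Icc 0 (-d x), W x ≤ 2 * W (x + s • N x))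
    {u : EuclideanSpace ℝ (Fin n) → ℝ} (hu : ∀ x, |d x| < ε → DifferentiableAt ℝ u x)
    (hu0 : ∀ x, d x = 0 → u x = 0) :
    ∫⁻ x in {x | -ε < d x ∧ d x ≤ 0}, W x * ‖u x‖ₑ ^ r ≤
      2 ^ (n + 1) * ENNReal.ofReal ε ^ r *
        ∫⁻ x in {x | -ε < d x ∧ d x ≤ 0}, W x * ‖fderiv ℝ u x‖ₑ ^ r := by
  have hAm : MeasurableSet {x | -ε < d x ∧ d x ≤ 0} :=
    (isOpen_lt continuous_const h.continuous).measurableSet.inter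
      (isClosed_le h.continuous continuous_const).measurableSet
  have hum' : Measurable fun x => ‖fderiv ℝ u x‖ₑ := (measurable_fderiv ℝ u).enorm
  calc ∫⁻ x in {x | -ε < d x ∧ d x ≤ 0}, W x * ‖u x‖ₑ ^ r
      ≤ ∫⁻ x in {x | -ε < d x ∧ d x ≤ 0}, ENNReal.ofReal ε ^ (r - 1) *
          (W x * ∫⁻ s in Ioc 0 (-d x), ‖fderiv ℝ u (x + s • N x)‖ₑ ^ r) := by
        refine setLIntegral_mono' hAm fun x hx => ?_
        rw [mul_left_comm]
        gcongr
        refine (ENNReal.rpow_le_rpow (h.enorm_le_lintegral_of_eq_zero hερ hu hu0 hx.1 hx.2)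
          (by linarith)).trans ((lintegral_Ioc_rpow_le hr (hum'.comp
            (show Measurable fun s : ℝ => x + s • N x by fun_prop))).trans ?_)
        simp only [Function.comp_apply]
        gcongr
        linarith [hx.1]
    _ ≤ ENNReal.ofReal ε ^ (r - 1) * (2 ^ n * ENNReal.ofReal (2 * ε) *
          ∫⁻ x in {x | -ε < d x ∧ d x ≤ 0}, W x * ‖fderiv ℝ u x‖ₑ ^ r) := by
        rw [lintegral_const_mul' _ _ (rpow_ne_top_of_nonneg (by linarith) ofReal_ne_top)]
        gcongr
        exact h.lintegral_lintegral_to_zero_le hεL hε hερ hWm (hum'.pow_const r) hW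
    _ = _ := by
        have h1 : ENNReal.ofReal ε ^ r = ENNReal.ofReal ε ^ (r - 1) * ENNReal.ofReal ε := by
          conv_rhs => rw [← ENNReal.rpow_one (ENNReal.ofReal ε)]
          rw [← ENNReal.rpow_mul, one_mul,
            ← ENNReal.rpow_add _ _ (by simpa using hε) ofReal_ne_top, sub_add_cancel]
        rw [h1, ENNReal.ofReal_mul zero_le_two, ofReal_ofNat, pow_succ]
        ring

end IsNormalTube

namespace IsProfile

variable {n : ℕ} {d : EuclideanSpace ℝ (Fin n) → ℝ}
  {N : EuclideanSpace ℝ (Fin n) → EuclideanSpace ℝ (Fin n)} {ρ L : ℝ}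
  {θ : ℝ → ℝ} {ε : ℝ} {K : NNReal}

theorem weight_le_two_mul_inside (hθ : IsProfile θ ε K) (h : IsNormalTube d N ρ L) (hερ : ε ≤ ρ)
    (x : EuclideanSpace ℝ (Fin n)) (hx : -ε < d x) (hx0 : d x ≤ 0) (s : ℝ)
    (hs : s ∈ Icc 0 (-d x)) :
    ENNReal.ofReal (θ (d x)) ≤ 2 * ENNReal.ofReal (θ (d (x + s • N x))) := by
  rw [(h.flow x s (abs_lt.2 ⟨by linarith, by linarith⟩)
    (abs_lt.2 ⟨by linarith [hs.1], by linarith [hs.2]⟩)).1, ← ofReal_ofNat 2,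
    ← ENNReal.ofReal_mul (by norm_num)]
  refine ENNReal.ofReal_le_ofReal ?_
  have h1 := hθ.le_one (d x)
  have h2 := hθ.half_le (t := d x + s) (by linarith [hs.2])
  norm_num
  linarith

theorem weight_le_two_mul_outside (hθ : IsProfile θ ε K) (h : IsNormalTube d N ρ L) (hερ : ε ≤ ρ)
    (x : EuclideanSpace ℝ (Fin n)) (hx : -ε < -d x) (hx0 : -d x ≤ 0) (s : ℝ)
    (hs : s ∈ Icc 0 (-(-d x))) :
    ENNReal.ofReal (θ (d x)) ≤ 2 * ENNReal.ofReal (θ (d (x + s • -N x))) := by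
  have hfl := (h.neg.flow x s (abs_lt.2 ⟨by linarith, by linarith⟩)
    (abs_lt.2 ⟨by linarith [hs.1], by linarith [hs.2]⟩)).1
  have : θ (d x) ≤ θ (d (x + s • -N x)) := hθ.antitone (by linarith [hs.1])
  refine (ENNReal.ofReal_le_ofReal this).trans ?_
  rw [two_mul]
  exact le_self_add

end IsProfile

namespace IsNormalTube

variable {n : ℕ} {d : EuclideanSpace ℝ (Fin n) → ℝ}
  {N : EuclideanSpace ℝ (Fin n) → EuclideanSpace ℝ (Fin n)} {ρ L : ℝ}

theorem tube_subset_union (ε : ℝ) : {x | |d x| < ε} ⊆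
    {x | -ε < d x ∧ d x ≤ 0} ∪ {x | -ε < -d x ∧ -d x ≤ 0} := fun x (hx : |d x| < ε) => by
  rw [abs_lt] at hx
  rcases le_total (d x) 0 with h0 | h0
  · exact Or.inl ⟨hx.1, h0⟩
  · exact Or.inr ⟨by linarith [hx.2], by linarith⟩

theorem half_tube_subset {ε : ℝ} (hε : 0 < ε) :
    {x | -ε < d x ∧ d x ≤ 0} ⊆ {x | |d x| < ε} :=
  fun x (hx : -ε < d x ∧ d x ≤ 0) => abs_lt.2 ⟨hx.1, by linarith [hx.2]⟩

theorem half_tube_neg_subset {ε : ℝ} (hε : 0 < ε) :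
    {x | -ε < -d x ∧ -d x ≤ 0} ⊆ {x | |d x| < ε} :=
  fun x (hx : -ε < -d x ∧ -d x ≤ 0) => show |d x| < ε from
    abs_lt.2 ⟨by linarith [hx.2], by linarith [hx.1]⟩

theorem measurableSet_half_tube (h : IsNormalTube d N ρ L) (ε : ℝ) :
    MeasurableSet {x | -ε < d x ∧ d x ≤ 0} :=
  (isOpen_lt continuous_const h.continuous).measurableSet.inter
    (isClosed_le h.continuous continuous_const).measurableSet

theorem ae_enorm_le_of_eq_zero (h : IsNormalTube d N ρ L) {ε : ℝ}
    (hεL : ε * L ≤ 1 / 2) (hε : 0 < ε) (hερ : ε ≤ ρ)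
    {W : EuclideanSpace ℝ (Fin n) → ℝ≥0∞} (hWm : Measurable W)
    (hW : ∀ x, -ε < d x → d x ≤ 0 → ∀ s ∈ Icc 0 (-d x), W x ≤ 2 * W (x + s • N x))
    {u : EuclideanSpace ℝ (Fin n) → ℝ} (hu : ∀ x, |d x| < ε → DifferentiableAt ℝ u x)
    (hu0 : ∀ x, d x = 0 → u x = 0) {Λ : ℝ≥0∞}
    (hΛ : ∀ᵐ x, |d x| < ε → W x ≠ 0 → ‖fderiv ℝ u x‖ₑ ≤ Λ) :
    ∀ᵐ x, (-ε < d x ∧ d x ≤ 0) → W x ≠ 0 → ‖u x‖ₑ ≤ ENNReal.ofReal ε * Λ := by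
  have hAm := h.measurableSet_half_tube ε
  set H : EuclideanSpace ℝ (Fin n) → ℝ≥0∞ := fun x => ‖fderiv ℝ u x‖ₑ - Λ with hH
  have hHm : Measurable H := (measurable_fderiv ℝ u).enorm.sub measurable_const
  have hzero : ∫⁻ x in {x | -ε < d x ∧ d x ≤ 0}, W x * H x = 0 := by
    rw [lintegral_eq_zero_iff (show Measurable fun x => W x * H x from hWm.mul hHm), EventuallyEq,
        ae_restrict_iff' hAm]
    filter_upwards [hΛ] with x hx hxA
    by_cases hWx : W x = 0
    · simp [hWx]
    · simp [hH, tsub_eq_zero_of_le (hx (half_tube_subset hε hxA) hWx)]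
  have hIm : Measurable fun x => ∫⁻ s in Ioc 0 (-d x), H (x + s • N x) := by
    have hjm : Measurable fun z : EuclideanSpace ℝ (Fin n) × ℝ =>
        {z : EuclideanSpace ℝ (Fin n) × ℝ | 0 < z.2 ∧ z.2 ≤ -d z.1}.indicator
          (fun z => H (z.1 + z.2 • N z.1)) z :=
      (hHm.comp (measurable_fst.add (measurable_snd.smul
        (h.measurable.comp measurable_fst)))).indicator
        ((isOpen_lt continuous_const continuous_snd).measurableSet.inter
          (isClosed_le continuous_snd (h.continuous.comp continuous_fst).neg).measurableSet)
    convert hjm.lintegral_prod_right' (ν := volume) using 2 with x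
    exact (lintegral_indicator measurableSet_Ioc _).symm
  have hI := h.lintegral_lintegral_to_zero_le hεL hε hερ hWm hHm hW
  rw [hzero, mul_zero, nonpos_iff_eq_zero, lintegral_eq_zero_iff (show Measurable fun x =>
    W x * ∫⁻ s in Ioc 0 (-d x), H (x + s • N x) from hWm.mul hIm), EventuallyEq,
    ae_restrict_iff' hAm] at hI
  filter_upwards [hI] with x hx hxA hWx
  have h0 : ∫⁻ s in Ioc 0 (-d x), H (x + s • N x) = 0 := by simpa [hWx] using hx hxA
  calc ‖u x‖ₑ ≤ ∫⁻ s in Ioc 0 (-d x), ‖fderiv ℝ u (x + s • N x)‖ₑ :=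
        h.enorm_le_lintegral_of_eq_zero hερ hu hu0 hxA.1 hxA.2
    _ ≤ ∫⁻ s in Ioc 0 (-d x), (Λ + H (x + s • N x)) := lintegral_mono fun s => le_add_tsub
    _ = Λ * ENNReal.ofReal (-d x) := by
        rw [lintegral_add_left measurable_const, h0, add_zero, lintegral_const,
          Measure.restrict_apply_univ, Real.volume_Ioc, sub_zero]
    _ ≤ _ := by
        rw [mul_comm]
        gcongr
        linarith [hxA.1]

/-- Poincaré inequality on the diffuse boundary layer. -/
theorem exists_eLpNorm_le_of_eq_zero (h : IsNormalTube d N ρ L) (hρL : ρ * L ≤ 1 / 2)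
    {p : ℝ≥0∞} (hp : 1 ≤ p) : ∃ C : ℝ≥0∞, C ≠ ⊤ ∧ ∀ (θ : ℝ → ℝ) (ε : ℝ) (K : NNReal),
      IsProfile θ ε K → ε ≤ ρ → ∀ u : EuclideanSpace ℝ (Fin n) → ℝ, Measurable u →
      (∀ x, |d x| < ε → DifferentiableAt ℝ u x) → (∀ x, d x = 0 → u x = 0) →
      eLpNorm u p (wMeas {x | |d x| < ε} fun x => θ (d x)) ≤
        C * ENNReal.ofReal ε * eLpNorm (fderiv ℝ u) p (wMeas {x | |d x| < ε} fun x => θ (d x)) := by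
  have hdm : Measurable d := h.continuous.measurable
  by_cases hpt : p = ⊤
  · refine ⟨1, one_ne_top, fun θ ε K hθ hε u hum hu hu0 => ?_⟩
    have hTm := h.measurableSet_tube ε
    have hWm : Measurable fun x => ENNReal.ofReal (θ (d x)) :=
      (hθ.lipschitz.continuous.measurable.comp hdm).ennreal_ofReal
    have hεL : ε * L ≤ 1 / 2 := (mul_le_mul_of_nonneg_right hε h.nonneg).trans hρL
    rw [hpt, eLpNorm_exponent_top, eLpNorm_exponent_top, one_mul]
    set Λ := eLpNormEssSup (fderiv ℝ u) (wMeas {x | |d x| < ε} fun x => θ (d x))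
    have hΛ : ∀ᵐ x, |d x| < ε → ENNReal.ofReal (θ (d x)) ≠ 0 → ‖fderiv ℝ u x‖ₑ ≤ Λ := by
      have := enorm_ae_le_eLpNormEssSup (fderiv ℝ u) (wMeas {x | |d x| < ε} fun x => θ (d x))
      rwa [wMeas, ae_withDensity_iff hWm, ae_restrict_iff' hTm] at this
    refine eLpNormEssSup_le_of_ae_enorm_bound ?_
    rw [wMeas, ae_withDensity_iff hWm, ae_restrict_iff' hTm]
    filter_upwards [h.ae_enorm_le_of_eq_zero hεL hθ.pos hε hWm
      (hθ.weight_le_two_mul_inside h hε) hu hu0 hΛ,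
      h.neg.ae_enorm_le_of_eq_zero hεL hθ.pos hε hWm (hθ.weight_le_two_mul_outside h hε)
      (fun x hx => hu x (by rwa [abs_neg] at hx)) (fun x hx => hu0 x (neg_eq_zero.1 hx))
      (by simpa only [abs_neg] using hΛ)] with x h1 h2 hx
    exact (tube_subset_union ε hx).elim h1 h2
  have hr : 1 ≤ p.toReal := by simpa using ENNReal.toReal_mono hpt hp
  set r := p.toReal with hr_def
  have hr0 : 0 < r := by linarith
  refine ⟨(2 ^ (n + 2)) ^ (1 / r), rpow_ne_top_of_nonneg (by positivity) (by simp),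
    fun θ ε K hθ hε u hum hu hu0 => ?_⟩
  have hθm : Measurable fun x => θ (d x) := hθ.lipschitz.continuous.measurable.comp hdm
  have hWm := hθm.ennreal_ofReal
  have hεL : ε * L ≤ 1 / 2 := (mul_le_mul_of_nonneg_right hε h.nonneg).trans hρL
  have h1 := h.lintegral_rpow_le_of_eq_zero hr hεL hθ.pos hε hWm
    (hθ.weight_le_two_mul_inside h hε) hu hu0
  have h2 := h.neg.lintegral_rpow_le_of_eq_zero hr hεL hθ.pos hε hWm
    (hθ.weight_le_two_mul_outside h hε) (u := u)
      (fun x hx => hu x (by rwa [abs_neg] at hx)) (fun x hx => hu0 x (neg_eq_zero.1 hx))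
  rw [eLpNorm_wMeas hθm hum.enorm hp hpt, eLpNorm_wMeas hθm (measurable_fderiv ℝ u).enorm hp hpt,
    ← hr_def]
  set J := ∫⁻ x in {x | |d x| < ε}, ENNReal.ofReal (θ (d x)) * ‖fderiv ℝ u x‖ₑ ^ r
  have key : ∫⁻ x in {x | |d x| < ε}, ENNReal.ofReal (θ (d x)) * ‖u x‖ₑ ^ r ≤
      2 ^ (n + 2) * ENNReal.ofReal ε ^ r * J := by
    calc _ ≤ ∫⁻ x in {x | -ε < d x ∧ d x ≤ 0} ∪ {x | -ε < -d x ∧ -d x ≤ 0},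
          ENNReal.ofReal (θ (d x)) * ‖u x‖ₑ ^ r := lintegral_mono_set (tube_subset_union ε)
      _ ≤ _ := lintegral_union_le _ _ _
      _ ≤ 2 ^ (n + 1) * ENNReal.ofReal ε ^ r * J + 2 ^ (n + 1) * ENNReal.ofReal ε ^ r * J := by
          refine add_le_add (h1.trans ?_) (h2.trans ?_)
          · gcongr
            exact lintegral_mono_set (half_tube_subset hθ.pos)
          · gcongr
            exact lintegral_mono_set (half_tube_neg_subset hθ.pos)
      _ = _ := by rw [pow_succ _ (n + 1)]; ring
  have hir0 : 0 ≤ 1 / r := by positivity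
  refine (ENNReal.rpow_le_rpow key hir0).trans_eq ?_
  rw [ENNReal.mul_rpow_of_nonneg _ _ hir0, ENNReal.mul_rpow_of_nonneg _ _ hir0,
    ← ENNReal.rpow_mul, mul_one_div_cancel hr0.ne', ENNReal.rpow_one]

end IsNormalTube

theorem lintegral_enorm_mul_enorm_le {X E F : Type*} [MeasurableSpace X] {μ : Measure X}
    [NormedAddCommGroup E] [NormedAddCommGroup F] {p p' : ℝ≥0∞} (hp : 1 / p + 1 / p' = 1)
    {f : X → E} {g : X → F} (hf : AEStronglyMeasurable (fun x => ‖f x‖) μ)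
    (hg : AEStronglyMeasurable (fun x => ‖g x‖) μ) :
    ∫⁻ x, ‖f x‖ₑ * ‖g x‖ₑ ∂μ ≤ eLpNorm f p μ * eLpNorm g p' μ := by
  have : HolderTriple p p' 1 := ⟨by simpa using hp⟩
  have h := eLpNorm_le_eLpNorm_mul_eLpNorm'_of_norm (p := p) (q := p') (r := 1) hf hg
    (fun a b => a * b) 1 (Eventually.of_forall fun x => by simp)
  rw [ENNReal.coe_one, one_mul, eLpNorm_norm, eLpNorm_norm, eLpNorm_one_eq_lintegral_enorm] at h
  simpa only [enorm_mul, enorm_norm] using h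

theorem aemeasurable_enorm_mul_enorm {X E F : Type*} [MeasurableSpace X] {μ : Measure X}
    [NormedAddCommGroup E] [NormedAddCommGroup F] {f : X → E} {g : X → F}
    (hf : AEStronglyMeasurable (fun x => ‖f x‖) μ) (hg : AEStronglyMeasurable (fun x => ‖g x‖) μ) :
    AEMeasurable (fun x => ‖f x‖ₑ * ‖g x‖ₑ) μ := by
  have h : AEMeasurable (fun x => ‖‖f x‖‖ₑ * ‖‖g x‖‖ₑ) μ := hf.enorm.mul hg.enorm
  simpa only [enorm_norm] using h

/-- A Hölder dual exponent is antitone in the exponent. -/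
theorem dual_exponent_le {p q p' q' : ℝ≥0∞} (hpq : p ≤ q) (hp' : 1 / p + 1 / p' = 1)
    (hq' : 1 / q + 1 / q' = 1) : q' ≤ p' := by
  rw [← ENNReal.inv_le_inv]
  simp only [one_div] at hp' hq'
  have h1 : q⁻¹ ≤ p⁻¹ := ENNReal.inv_le_inv.2 hpq
  have hq1 : q⁻¹ ≤ 1 := hq' ▸ le_self_add
  have h2 : q⁻¹ + p'⁻¹ ≤ q⁻¹ + q'⁻¹ := by
    rw [hq', ← hp']
    gcongr
  exact (ENNReal.add_le_add_iff_left (hq1.trans_lt one_lt_top).ne).1 h2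

theorem lintegral_products_le {X E₀ E₁ E₂ F₀ F₁ : Type*} [MeasurableSpace X] {μ : Measure X}
    [NormedAddCommGroup E₀] [NormedAddCommGroup E₁] [NormedAddCommGroup E₂]
    [NormedAddCommGroup F₀] [NormedAddCommGroup F₁] {p q p' q' : ℝ≥0∞}
    (hp' : 1 / p + 1 / p' = 1) (hq' : 1 / q + 1 / q' = 1) {f₀ : X → E₀} {f₁ : X → E₁} {f₂ : X → E₂}
    {g₀ : X → F₀} {g₁ : X → F₁} (hf₀ : AEStronglyMeasurable (fun x => ‖f₀ x‖) μ)
    (hf₁ : AEStronglyMeasurable (fun x => ‖f₁ x‖) μ)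
    (hf₂ : AEStronglyMeasurable (fun x => ‖f₂ x‖) μ)
    (hg₀ : AEStronglyMeasurable (fun x => ‖g₀ x‖) μ)
    (hg₁ : AEStronglyMeasurable (fun x => ‖g₁ x‖) μ) {e c : ℝ≥0∞} (he : e ≠ ⊤) :
    (∫⁻ x, (‖f₀ x‖ₑ * ‖g₁ x‖ₑ + e * (‖f₁ x‖ₑ * ‖g₁ x‖ₑ + ‖f₂ x‖ₑ * ‖g₀ x‖ₑ)) ∂μ) +
      c * ∫⁻ x, (‖f₀ x‖ₑ * ‖g₀ x‖ₑ + e * (‖f₁ x‖ₑ * ‖g₀ x‖ₑ)) ∂μ ≤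
      (eLpNorm f₀ p μ + e * eLpNorm f₁ p μ) * (eLpNorm g₁ p' μ + c * eLpNorm g₀ p' μ) +
        e * (eLpNorm f₂ q μ * eLpNorm g₀ q' μ) := by
  have h₀₀ : AEMeasurable (fun x => ‖f₀ x‖ₑ * ‖g₀ x‖ₑ) μ :=
    aemeasurable_enorm_mul_enorm hf₀ hg₀
  have h₀₁ : AEMeasurable (fun x => ‖f₀ x‖ₑ * ‖g₁ x‖ₑ) μ :=
    aemeasurable_enorm_mul_enorm hf₀ hg₁
  have h₁₁ : AEMeasurable (fun x => ‖f₁ x‖ₑ * ‖g₁ x‖ₑ) μ :=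
    aemeasurable_enorm_mul_enorm hf₁ hg₁
  rw [lintegral_add_left' h₀₁, lintegral_const_mul' _ _ he, lintegral_add_left' h₁₁,
    lintegral_add_left' h₀₀, lintegral_const_mul' _ _ he]
  calc _ ≤ (eLpNorm f₀ p μ * eLpNorm g₁ p' μ + e * (eLpNorm f₁ p μ * eLpNorm g₁ p' μ +
        eLpNorm f₂ q μ * eLpNorm g₀ q' μ)) + c * (eLpNorm f₀ p μ * eLpNorm g₀ p' μ +
        e * (eLpNorm f₁ p μ * eLpNorm g₀ p' μ)) := by
        gcongr
        · exact lintegral_enorm_mul_enorm_le hp' hf₀ hg₁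
        · exact lintegral_enorm_mul_enorm_le hp' hf₁ hg₁
        · exact lintegral_enorm_mul_enorm_le hq' hf₂ hg₀
        · exact lintegral_enorm_mul_enorm_le hp' hf₀ hg₀
        · exact lintegral_enorm_mul_enorm_le hp' hf₁ hg₀
    _ = _ := by ring

theorem measurable_norm_fderiv {E F : Type*} [NormedAddCommGroup E] [NormedSpace ℝ E]
    [MeasurableSpace E] [OpensMeasurableSpace E] [NormedAddCommGroup F] [NormedSpace ℝ F]
    [CompleteSpace F] (f : E → F) : Measurable fun x => ‖fderiv ℝ f x‖ :=
  (measurable_fderiv ℝ f).norm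

theorem measurable_enorm_fderiv {E F : Type*} [NormedAddCommGroup E] [NormedSpace ℝ E]
    [MeasurableSpace E] [OpensMeasurableSpace E] [NormedAddCommGroup F] [NormedSpace ℝ F]
    [CompleteSpace F] (f : E → F) : Measurable fun x => ‖fderiv ℝ f x‖ₑ :=
  (measurable_fderiv ℝ f).enorm

namespace IsNormalTube

variable {n : ℕ} {d : EuclideanSpace ℝ (Fin n) → ℝ}
  {N : EuclideanSpace ℝ (Fin n) → EuclideanSpace ℝ (Fin n)} {ρ L : ℝ}

theorem exists_enorm_setIntegral_le (h : IsNormalTube d N ρ L) (hρ : 0 < ρ)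
    (hρL : ρ * L ≤ 1 / 2) (hvol : volume {x | d x < ρ} ≠ ⊤) {p q p' q' : ℝ≥0∞} (hp : 1 ≤ p)
    (hpq : p ≤ q) (hp' : 1 / p + 1 / p' = 1) (hq' : 1 / q + 1 / q' = 1) :
    ∃ C : ℝ≥0∞, C ≠ ⊤ ∧ ∀ (θ : ℝ → ℝ) (ε : ℝ) (K : NNReal), IsProfile θ ε K → ε ≤ ρ / 2 →
      ∀ u v : EuclideanSpace ℝ (Fin n) → ℝ, Measurable u → Measurable v →
      (∀ x, d x < ε → DifferentiableAt ℝ u x) →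
      (∀ x, d x < ε → DifferentiableAt ℝ (fun y => fderiv ℝ u y) x) →
      (∀ x, d x = 0 → u x = 0) → (∀ x, d x < ε → DifferentiableAt ℝ v x) →
      ‖∫ x in {x | |d x| < ε}, deriv θ (d x) * (u x * v x)‖ₑ ≤
        C * (ENNReal.ofReal ε ^ (1 + (1 / q').toReal) *
            (eLpNorm u q (wMeas {x | d x < ε} fun x => θ (d x)) +
              eLpNorm (fderiv ℝ u) q (wMeas {x | d x < ε} fun x => θ (d x)) +
              eLpNorm (fderiv ℝ fun y => fderiv ℝ u y) q
                (wMeas {x | d x < ε} fun x => θ (d x))) +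
          ENNReal.ofReal ε ^ (1 + (1 / p).toReal) *
            (eLpNorm u p (wMeas {x | d x < ε} fun x => θ (d x)) +
              eLpNorm (fderiv ℝ u) p (wMeas {x | d x < ε} fun x => θ (d x)) +
              eLpNorm (fderiv ℝ fun y => fderiv ℝ u y) p
                (wMeas {x | d x < ε} fun x => θ (d x)))) *
          (eLpNorm v p' (wMeas {x | d x < ε} fun x => θ (d x)) +
            eLpNorm (fderiv ℝ v) p' (wMeas {x | d x < ε} fun x => θ (d x))) := by
  have hq1 : 1 ≤ q' := by
    have : q'⁻¹ ≤ 1 := by rw [← hq', ← one_div]; exact le_add_self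
    simpa using this
  have hqp := dual_exponent_le hpq hp' hq'
  obtain ⟨C₁, hC₁, htr₁⟩ := h.exists_eLpNorm_trace_le hρ hρL (EuclideanSpace ℝ (Fin n) →L[ℝ] ℝ) hp
  obtain ⟨C₃, hC₃, htr₃⟩ := h.exists_eLpNorm_trace_le hρ hρL ℝ hq1
  obtain ⟨C₂, hC₂, hpoin⟩ := h.exists_eLpNorm_le_of_eq_zero hρL hp
  set e := 1 / q'.toReal - 1 / p'.toReal with he
  have he0 : 0 ≤ e := by
    rw [he, sub_nonneg]
    by_cases hpt : p' = ⊤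
    · simp [hpt]
    · exact one_div_le_one_div_of_le (ENNReal.toReal_pos (by positivity)
        (ne_top_of_le_ne_top hpt hqp)) (ENNReal.toReal_mono hpt hqp)
  set C₄ := volume {x | d x < ρ} ^ e with hC₄_def
  have hC₄ : C₄ ≠ ⊤ := rpow_ne_top_of_nonneg he0 hvol
  set c := ENNReal.ofReal (3 ^ n * (2 * L + 1)) with hc
  set C := (1 + c) * (C₂ * C₁ + C₁) + C₃ * C₄ with hC
  refine ⟨C, by finiteness, fun θ ε K hθ hε u v hum hvm hu hu' hu0 hv => ?_⟩
  have hdm : Measurable d := h.continuous.measurable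
  have hθm : Measurable fun x => θ (d x) := hθ.lipschitz.continuous.measurable.comp hdm
  have hερ : ε ≤ ρ := by linarith
  have hlt : ∀ x, |d x| < ε → d x < ε := fun x hx => (abs_lt.1 hx).2
  have hum' : Measurable (fderiv ℝ u) := measurable_fderiv ℝ u
  have hvm' : Measurable (fderiv ℝ v) := measurable_fderiv ℝ v
  have hun : Measurable fun x => ‖fderiv ℝ u x‖ₑ := hum'.enorm
  have hvn : Measurable fun x => ‖fderiv ℝ v x‖ₑ := hvm'.enorm
  have hun' : Measurable fun x => ‖fderiv ℝ (fun y => fderiv ℝ u y) x‖ₑ :=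
    measurable_enorm_fderiv _
  refine (h.enorm_setIntegral_deriv_profile_mul_le hθ hερ hum hvm (fun x hx => hu x (hlt x hx))
    (fun x hx => hu' x (hlt x hx)) hu0 fun x hx => hv x (hlt x hx)).trans ?_
  have hsub : {x | |d x| < ε} ⊆ {x | d x < ε} := hlt
  have hle : wMeas {x | |d x| < ε} (fun x => θ (d x)) ≤ wMeas {x | d x < ε} fun x => θ (d x) :=
    wMeas_mono hsub
  have hm₁ : Measurable fun x => ‖u x‖ₑ * ‖fderiv ℝ v x‖ₑ + ENNReal.ofReal ε *
      (‖fderiv ℝ u x‖ₑ * ‖fderiv ℝ v x‖ₑ + ‖fderiv ℝ (fun y => fderiv ℝ u y) x‖ₑ * ‖v x‖ₑ) :=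
    (hum.enorm.mul hvn).add (((hun.mul hvn).add (hun'.mul hvm.enorm)).const_mul _)
  have hm₀ : Measurable fun x => ‖u x‖ₑ * ‖v x‖ₑ +
      ENNReal.ofReal ε * (‖fderiv ℝ u x‖ₑ * ‖v x‖ₑ) :=
    (hum.enorm.mul hvm.enorm).add ((hun.mul hvm.enorm).const_mul _)
  rw [← lintegral_wMeas hθm hm₁, ← lintegral_wMeas hθm hm₀]
  set μT := wMeas {x | |d x| < ε} fun x => θ (d x)
  set μ := wMeas {x | d x < ε} fun x => θ (d x) with hμ
  have hμuniv : μ univ ≤ volume {x | d x < ρ} :=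
    (wMeas_univ_le hθm fun x => hθ.le_one _).trans
      (measure_mono fun x (hx : d x < ε) => hx.trans_le hερ)
  set Xq := eLpNorm u q μ + eLpNorm (fderiv ℝ u) q μ + eLpNorm (fderiv ℝ fun y => fderiv ℝ u y) q μ
  set Xp := eLpNorm u p μ + eLpNorm (fderiv ℝ u) p μ +
    eLpNorm (fderiv ℝ fun y => fderiv ℝ u y) p μ with hXp
  set V := eLpNorm v p' μ + eLpNorm (fderiv ℝ v) p' μ
  set P := ENNReal.ofReal ε ^ (1 / p).toReal
  set Q := ENNReal.ofReal ε ^ (1 / q').toReal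
  set E := ENNReal.ofReal ε
  have hPE : E ^ (1 + (1 / p).toReal) = E * P := by
    rw [ENNReal.rpow_add _ _ (by simpa [E] using hθ.pos) ofReal_ne_top, ENNReal.rpow_one]
  have hQE : E ^ (1 + (1 / q').toReal) = E * Q := by
    rw [ENNReal.rpow_add _ _ (by simpa [E] using hθ.pos) ofReal_ne_top, ENNReal.rpow_one]
  have hV0 : eLpNorm v p' μT ≤ V := (eLpNorm_mono_measure _ hle).trans le_self_add
  have hV1 : eLpNorm (fderiv ℝ v) p' μT ≤ V := (eLpNorm_mono_measure _ hle).trans le_add_self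
  have hU2 : eLpNorm (fderiv ℝ fun y => fderiv ℝ u y) q μT ≤ Xq :=
    (eLpNorm_mono_measure _ hle).trans le_add_self
  have hU1 : eLpNorm (fderiv ℝ u) p μT ≤ C₁ * P * Xp :=
    (htr₁ θ ε K hθ hε (fderiv ℝ u) hu' hun hun').trans (by
      gcongr
      rw [hXp, add_assoc]
      exact le_add_self)
  have hU0 : eLpNorm u p μT ≤ C₂ * E * (C₁ * P * Xp) :=
    (hpoin θ ε K hθ hερ u hum (fun x hx => hu x (hlt x hx)) hu0).trans (by gcongr)
  have hVq : eLpNorm v q' μT ≤ C₃ * Q * (V * C₄) := by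
    refine (htr₃ θ ε K hθ hε v hv hvm.enorm hvm'.enorm).trans ?_
    rw [add_mul]
    gcongr
    · refine (eLpNorm_le_eLpNorm_mul_rpow_measure_univ hqp hvm.aestronglyMeasurable).trans ?_
      exact mul_le_mul_right (ENNReal.rpow_le_rpow hμuniv he0) _
    · refine (eLpNorm_le_eLpNorm_mul_rpow_measure_univ hqp hvm'.aestronglyMeasurable).trans ?_
      exact mul_le_mul_right (ENNReal.rpow_le_rpow hμuniv he0) _
  rw [hPE, hQE, ← hc]
  refine (lintegral_products_le (e := E) (c := c) hp' hq' hum.norm.aestronglyMeasurable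
    (measurable_norm_fderiv u).aestronglyMeasurable
    (measurable_norm_fderiv fun y => fderiv ℝ u y).aestronglyMeasurable
    hvm.norm.aestronglyMeasurable (measurable_norm_fderiv v).aestronglyMeasurable
    ofReal_ne_top).trans ?_
  clear_value Xq Xp V P Q E c C₄
  calc _ ≤ (C₂ * E * (C₁ * P * Xp) + E * (C₁ * P * Xp)) * (V + c * V) +
        E * (Xq * (C₃ * Q * (V * C₄))) := by gcongr
    _ = C₃ * C₄ * (E * Q * Xq * V) + (1 + c) * (C₂ * C₁ + C₁) * (E * P * Xp * V) := by ring
    _ ≤ C * (E * Q * Xq * V) + C * (E * P * Xp * V) := by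
        gcongr
        · exact le_add_self
        · exact le_self_add
    _ = _ := by ring

end IsNormalTube

namespace IsProfile

variable {θ : ℝ → ℝ} {ε : ℝ} {K : NNReal}

theorem deriv_nonpos (h : IsProfile θ ε K) (t : ℝ) : deriv θ t ≤ 0 :=
  h.antitone.deriv_nonpos

theorem lintegral_neg_deriv_le (h : IsProfile θ ε K) (a : ℝ) {b : ℝ} (hb : 0 ≤ b) :
    ∫⁻ s in Ioc 0 b, ENNReal.ofReal (-deriv θ (a + s)) ≤ ENNReal.ofReal (θ a) := by
  set f : ℝ → ℝ := fun s => -θ (a + s) with hf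
  have hmono : Monotone f := fun s t hst => neg_le_neg (h.antitone (by gcongr))
  have hderiv : ∀ s, deriv f s = -deriv θ (a + s) := fun s => by
    rw [hf, deriv.fun_neg, deriv_comp_const_add]
  have hint : IntervalIntegrable (deriv f) volume 0 b :=
    (hmono.monotoneOn _).intervalIntegrable_deriv
  have hle := (hmono.monotoneOn (uIcc 0 b)).intervalIntegral_deriv_mem_uIcc
  rw [uIcc_of_le (sub_nonneg.2 (hmono hb))] at hle
  simp_rw [← hderiv]
  rw [← ofReal_integral_eq_lintegral_ofReal
    ((intervalIntegrable_iff_integrableOn_Ioc_of_le hb).1 hint)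
    (Eventually.of_forall fun s => by rw [hderiv]; exact neg_nonneg.2 (h.deriv_nonpos _)),
    ← intervalIntegral.integral_of_le hb]
  refine ENNReal.ofReal_le_ofReal (hle.2.trans ?_)
  simp only [hf, add_zero]
  linarith [h.nonneg (a + b)]

/-- The profile generated by a phase-field transition function. -/
theorem of_transition {S : ℝ → ℝ} {L : NNReal} (hS_lip : LipschitzWith L S)
    (hS_sign : ∀ t : ℝ, 1 ≤ |t| → S t = t / |t|) (hS_pos : ∀ t : ℝ, |t| < 1 → 0 < deriv S t)
    (hS_odd : ∀ t : ℝ, S (-t) = -S t) (hε : 0 < ε) :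
    IsProfile (fun t => (1 + S (-t / ε)) / 2) ε (L * Real.toNNReal (1 / (2 * ε))) where
  pos := hε
  lipschitz := LipschitzWith.of_dist_le_mul fun x y => by
    have h := hS_lip.dist_le_mul (-x / ε) (-y / ε)
    have h1 : dist (-x / ε) (-y / ε) = dist x y / ε := by
      rw [Real.dist_eq, Real.dist_eq, ← sub_div, abs_div, abs_of_pos hε, neg_sub_neg, abs_sub_comm]
    rw [h1] at h
    have h2 : dist ((1 + S (-x / ε)) / 2) ((1 + S (-y / ε)) / 2) =
        dist (S (-x / ε)) (S (-y / ε)) / 2 := by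
      rw [Real.dist_eq, Real.dist_eq, ← sub_div, abs_div, abs_of_pos (two_pos : (0 : ℝ) < 2),
        add_sub_add_left_eq_sub]
    rw [h2, NNReal.coe_mul, Real.coe_toNNReal _ (by positivity)]
    calc _ ≤ L * (dist x y / ε) / 2 := by gcongr
      _ = _ := by field_simp
  deriv_neg t ht := by
    have h1 : |-t / ε| < 1 := by
      rw [abs_div, abs_neg, abs_of_pos hε, div_lt_one hε]; exact ht
    have h2 := hS_pos _ h1
    have h3 : HasDerivAt S (deriv S (-t / ε)) (-t / ε) :=
      (differentiableAt_of_deriv_ne_zero h2.ne').hasDerivAt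
    have h4 := ((h3.comp t ((hasDerivAt_neg t).div_const ε)).const_add 1).div_const 2
    have h5 : deriv (fun t => (1 + S (-t / ε)) / 2) t = deriv S (-t / ε) * (-1 / ε) / 2 := h4.deriv
    have : 0 < deriv S (-t / ε) * (1 / ε) / 2 := by positivity
    calc _ = -(deriv S (-t / ε) * (1 / ε) / 2) := h5.trans (by ring)
      _ < 0 := neg_neg_of_pos this
  eq_one t ht := by
    have h1 : 1 ≤ -t / ε := by rw [le_div_iff₀ hε]; linarith
    have h0 : -t / ε ≠ 0 := by positivity
    show (1 + S (-t / ε)) / 2 = 1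
    rw [hS_sign _ (h1.trans (le_abs_self _)), abs_of_nonneg (by linarith), div_self h0]
    norm_num
  eq_zero t ht := by
    have h1 : 1 ≤ t / ε := by rw [le_div_iff₀ hε]; linarith
    have h0 : t / ε ≠ 0 := by positivity
    show (1 + S (-t / ε)) / 2 = 0
    rw [neg_div, hS_odd, hS_sign _ (h1.trans (le_abs_self _)), abs_of_nonneg (by linarith),
      div_self h0]
    norm_num
  symm t := by
    show (1 + S (- -t / ε)) / 2 = 1 - (1 + S (-t / ε)) / 2
    have := hS_odd (-t / ε)
    rw [← neg_div] at this
    rw [this]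
    ring

end IsProfile

namespace IsSignedDist

variable {n : ℕ} {D : Set (EuclideanSpace ℝ (Fin n))} {d : EuclideanSpace ℝ (Fin n) → ℝ}
  {θ : ℝ → ℝ} {ε : ℝ} {K : NNReal}

/-- The outer half of the layer is controlled by sliding inwards along the gradient of `d`. -/
theorem lintegral_outer_le (h : IsSignedDist D d) (hθ : IsProfile θ ε K)
    {w : EuclideanSpace ℝ (Fin n) → ℝ} (hw : ∀ x, d x < ε → DifferentiableAt ℝ w x)
    (hwm : Measurable w) :
    ENNReal.ofReal (ε / 4) * ∫⁻ x in {x | ε / 2 < d x ∧ d x < ε},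
        ENNReal.ofReal (-deriv θ (d x)) * ‖w x‖ₑ ≤
      (1 + ENNReal.ofReal (ε / 4)) * (2 ^ n * ∫⁻ x in {x | d x < ε},
        ENNReal.ofReal (θ (d x)) * (‖w x‖ₑ + ‖fderiv ℝ w x‖ₑ)) := by
  have hε := hθ.pos
  have hdc : Continuous d := h.lipschitz.continuous
  set A : Set (EuclideanSpace ℝ (Fin n)) := {x | ε / 2 < d x ∧ d x < ε} with hA_def
  set A' := A ∩ {x | DifferentiableAt ℝ d x} with hA'_def
  have hA : MeasurableSet A :=
    ((isOpen_lt continuous_const hdc).inter (isOpen_lt hdc continuous_const)).measurableSet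
  have hA' : MeasurableSet A' := hA.inter (measurableSet_of_differentiableAt ℝ d)
  have hAA' : (A : Set _) =ᵐ[volume] A' := by
    filter_upwards [h.lipschitz.ae_differentiableAt (μ := volume)] with x hx
    exact propext ⟨fun hxA => ⟨hxA, hx⟩, fun hxA => hxA.1⟩
  have hflow : ∀ x ∈ A', ∀ t ∈ Icc (0 : ℝ) (ε / 4), d (x + t • -gradient d x) = d x - t :=
    fun x hx t ht => by
      rw [smul_neg, ← sub_eq_add_neg]
      exact h.gradient_flow_neg (by linarith [hx.1.1]) hx.2 ⟨ht.1, by linarith [hx.1.1, ht.2]⟩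
  have hNm : Measurable fun x => -gradient d x :=
    (((InnerProductSpace.toDual ℝ (EuclideanSpace ℝ (Fin n))).symm.continuous.measurable).comp
      (measurable_fderiv ℝ d)).neg
  have hdm : Measurable d := hdc.measurable
  have hκ : Measurable fun x => ENNReal.ofReal (-deriv θ (d x)) :=
    ((measurable_deriv θ).comp hdm).neg.ennreal_ofReal
  have hH : Measurable fun y => ‖w y‖ₑ + ‖fderiv ℝ w y‖ₑ :=
    hwm.enorm.add (measurable_enorm_fderiv w)
  have h1 := mul_lintegral_rpow_le_along (w := w) (A := A') (N := fun x => -gradient d x)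
    (δ := ε / 4) le_rfl hA' hNm
    (fun x _ => by rw [norm_neg]; exact h.lipschitz.norm_gradient_le x)
    (fun x hx t ht => hw _ (by rw [hflow x hx t ht]; linarith [hx.1.2, ht.1]))
    hwm.enorm (measurable_enorm_fderiv w) hκ
  have h2 := lintegral_family_le_of_expanding_on (δ := ε / 4) (A := fun _ => A')
    (B := {x | d x < ε}) (Φ := fun s x => x + s • -gradient d x) (K := 2)
    (κ := fun x => ENNReal.ofReal (-deriv θ (d x)))
    (κ' := fun y s => ENNReal.ofReal (-deriv θ (d y + s)))
    (W := fun y => ENNReal.ofReal (θ (d y))) (H := fun y => ‖w y‖ₑ + ‖fderiv ℝ w y‖ₑ)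
    (fun s _ => hA') (isOpen_lt hdc continuous_const).measurableSet
    (fun s => measurable_id.add (hNm.const_smul s))
    (fun s hs x hx y hy => by
      simp only [smul_neg, ← sub_eq_add_neg]
      exact h.dist_le_two_mul_dist_sub_smul_gradient (c := ε / 2) (by linarith)
        ⟨hs.1.le, by linarith [hs.2]⟩ hx.1.1.le hy.1.1.le hx.2 hy.2)
    (fun s hs x hx => show d (x + s • -gradient d x) < ε by
      rw [hflow x hx s ⟨hs.1.le, hs.2⟩]; linarith [hx.1.2, hs.1])
    (((measurable_deriv θ).comp ((hdm.comp measurable_fst).add measurable_snd)).neg.ennreal_ofReal)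
    (fun s hs x hx => by
      show _ ≤ ENNReal.ofReal (-deriv θ (d (x + s • -gradient d x) + s))
      rw [hflow x hx s ⟨hs.1.le, hs.2⟩, sub_add_cancel])
    (fun y _ => hθ.lintegral_neg_deriv_le (d y) (by linarith)) hH
  rw [setLIntegral_congr hAA']
  simp only [ENNReal.rpow_one, sub_self, ENNReal.rpow_zero, one_mul] at h1
  exact h1.trans (mul_le_mul_right h2 _)

end IsSignedDist

theorem enorm_fderiv_mul_le {E : Type*} [NormedAddCommGroup E] [NormedSpace ℝ E] {u v : E → ℝ}
    {x : E} (hu : DifferentiableAt ℝ u x) (hv : DifferentiableAt ℝ v x) :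
    ‖fderiv ℝ (fun y => u y * v y) x‖ₑ ≤ ‖u x‖ₑ * ‖fderiv ℝ v x‖ₑ + ‖fderiv ℝ u x‖ₑ * ‖v x‖ₑ := by
  rw [fderiv_fun_mul hu hv]
  refine (enorm_add_le (u x • fderiv ℝ v x) (v x • fderiv ℝ u x)).trans (le_of_eq ?_)
  rw [enorm_smul, enorm_smul, mul_comm ‖v x‖ₑ]

namespace IsSignedDist

variable {n : ℕ} {D : Set (EuclideanSpace ℝ (Fin n))} {d : EuclideanSpace ℝ (Fin n) → ℝ}
  {θ : ℝ → ℝ} {ε : ℝ} {K : NNReal}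

theorem lintegral_layer_le (h : IsSignedDist D d) (hθ : IsProfile θ ε K) {m : ℝ} (hm : 0 < m)
    (hmθ : m ≤ θ (ε / 2)) {w : EuclideanSpace ℝ (Fin n) → ℝ}
    (hw : ∀ x, d x < ε → DifferentiableAt ℝ w x) (hwm : Measurable w) :
    ∫⁻ x in {x | |d x| < ε}, ENNReal.ofReal (-deriv θ (d x)) * ‖w x‖ₑ ≤
      (ENNReal.ofReal (K / m) + (1 + ENNReal.ofReal (ε / 4)) * 2 ^ n / ENNReal.ofReal (ε / 4)) *
        ∫⁻ x in {x | d x < ε}, ENNReal.ofReal (θ (d x)) * (‖w x‖ₑ + ‖fderiv ℝ w x‖ₑ) := by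
  have hε := hθ.pos
  have hdc : Continuous d := h.lipschitz.continuous
  set I := ∫⁻ x in {x | d x < ε}, ENNReal.ofReal (θ (d x)) * (‖w x‖ₑ + ‖fderiv ℝ w x‖ₑ)
  set A : Set (EuclideanSpace ℝ (Fin n)) := {x | ε / 2 < d x ∧ d x < ε}
  set B : Set (EuclideanSpace ℝ (Fin n)) := {x | d x ≤ ε / 2}
  have hB : MeasurableSet B := (isClosed_le hdc continuous_const).measurableSet
  have hsub : {x | |d x| < ε} ⊆ B ∪ A := fun x (hx : |d x| < ε) => by
    rcases le_or_gt (d x) (ε / 2) with hx' | hx'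
    · exact Or.inl hx'
    · exact Or.inr ⟨hx', (abs_lt.1 hx).2⟩
  have hinner : ∫⁻ x in B, ENNReal.ofReal (-deriv θ (d x)) * ‖w x‖ₑ ≤
      ENNReal.ofReal (K / m) * I := by
    calc _ ≤ ∫⁻ x in B, ENNReal.ofReal (K / m) *
          (ENNReal.ofReal (θ (d x)) * (‖w x‖ₑ + ‖fderiv ℝ w x‖ₑ)) := by
          refine setLIntegral_mono' hB fun x (hx : d x ≤ ε / 2) => ?_
          rw [← mul_assoc, ← ENNReal.ofReal_mul (by positivity)]
          gcongr
          · have h1 : -deriv θ (d x) ≤ K := (neg_le_abs _).trans (hθ.abs_deriv_le _)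
            have h2 : m ≤ θ (d x) := hmθ.trans (hθ.antitone hx)
            calc _ ≤ (K : ℝ) := h1
              _ = K / m * m := (div_mul_cancel₀ _ hm.ne').symm
              _ ≤ _ := by gcongr
          · exact le_self_add
      _ = ENNReal.ofReal (K / m) *
          ∫⁻ x in B, ENNReal.ofReal (θ (d x)) * (‖w x‖ₑ + ‖fderiv ℝ w x‖ₑ) :=
          lintegral_const_mul' _ _ ofReal_ne_top
      _ ≤ _ := by
          gcongr
          exact lintegral_mono_set fun x (hx : d x ≤ ε / 2) => show d x < ε by linarith
  have houter : ∫⁻ x in A, ENNReal.ofReal (-deriv θ (d x)) * ‖w x‖ₑ ≤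
      (1 + ENNReal.ofReal (ε / 4)) * 2 ^ n / ENNReal.ofReal (ε / 4) * I := by
    have h1 := h.lintegral_outer_le hθ hw hwm
    rw [mul_comm, ← ENNReal.le_div_iff_mul_le (Or.inl (by simpa using hε))
      (Or.inl ofReal_ne_top)] at h1
    refine h1.trans (le_of_eq ?_)
    rw [← mul_assoc, ENNReal.mul_div_right_comm]
  calc _ ≤ ∫⁻ x in B ∪ A, ENNReal.ofReal (-deriv θ (d x)) * ‖w x‖ₑ := lintegral_mono_set hsub
    _ ≤ _ := lintegral_union_le _ _ _
    _ ≤ _ := by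
        rw [add_mul]
        exact add_le_add hinner houter

/-- For layers of width bounded below, the boundary term is controlled by the bulk norms. -/
theorem exists_lintegral_layer_mul_le (h : IsSignedDist D d) {p p' : ℝ≥0∞}
    (hp' : 1 / p + 1 / p' = 1) {r ε₀ m : ℝ} (hr : 0 < r) (hm : 0 < m) (K₀ : NNReal) :
    ∃ C : ℝ≥0∞, C ≠ ⊤ ∧ ∀ (θ : ℝ → ℝ) (ε : ℝ) (K : NNReal), IsProfile θ ε K → r ≤ ε → ε ≤ ε₀ →
      K ≤ K₀ → m ≤ θ (ε / 2) → ∀ u v : EuclideanSpace ℝ (Fin n) → ℝ, Measurable u → Measurable v →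
      (∀ x, d x < ε → DifferentiableAt ℝ u x) → (∀ x, d x < ε → DifferentiableAt ℝ v x) →
      ∫⁻ x in {x | |d x| < ε}, ENNReal.ofReal (-deriv θ (d x)) * ‖u x * v x‖ₑ ≤
        C * (ENNReal.ofReal ε ^ (1 + (1 / p).toReal) *
          (eLpNorm u p (wMeas {x | d x < ε} fun x => θ (d x)) +
            eLpNorm (fderiv ℝ u) p (wMeas {x | d x < ε} fun x => θ (d x)))) *
          (eLpNorm v p' (wMeas {x | d x < ε} fun x => θ (d x)) +
            eLpNorm (fderiv ℝ v) p' (wMeas {x | d x < ε} fun x => θ (d x))) := by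
  set C₁ := ENNReal.ofReal (K₀ / m) + (1 + ENNReal.ofReal (ε₀ / 4)) * 2 ^ n / ENNReal.ofReal (r / 4)
    with hC₁
  set b := 1 + (1 / p).toReal with hb
  have hb0 : 0 ≤ b := by positivity
  have hrb : ENNReal.ofReal r ^ b ≠ 0 := (ENNReal.rpow_pos (by simpa using hr) ofReal_ne_top).ne'
  have hrb' : ENNReal.ofReal r ^ b ≠ ⊤ := rpow_ne_top_of_nonneg hb0 ofReal_ne_top
  have hC₁t : C₁ ≠ ⊤ := by
    refine add_ne_top.2 ⟨ofReal_ne_top, ENNReal.div_ne_top (by finiteness) ?_⟩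
    simpa using hr
  refine ⟨C₁ * (ENNReal.ofReal r ^ b)⁻¹, mul_ne_top hC₁t (inv_ne_top.2 hrb),
    fun θ ε K hθ hrε hε₀ hK hmθ u v hum hvm hu hv => ?_⟩
  have hdm : Measurable d := h.lipschitz.continuous.measurable
  have hθm : Measurable fun x => θ (d x) := hθ.lipschitz.continuous.measurable.comp hdm
  set μ := wMeas {x | d x < ε} fun x => θ (d x) with hμ
  have hun := measurable_enorm_fderiv u
  have hvn := measurable_enorm_fderiv v
  have huv : Measurable fun x => ‖u x‖ₑ * ‖v x‖ₑ := hum.enorm.mul hvm.enorm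
  have huv' : Measurable fun x => ‖u x‖ₑ * ‖fderiv ℝ v x‖ₑ := hum.enorm.mul hvn
  have huv'' : Measurable fun x => ‖fderiv ℝ u x‖ₑ * ‖v x‖ₑ := hun.mul hvm.enorm
  have hbulk : ∫⁻ x in {x | d x < ε}, ENNReal.ofReal (θ (d x)) *
      (‖u x * v x‖ₑ + ‖fderiv ℝ (fun y => u y * v y) x‖ₑ) ≤
      (eLpNorm u p μ + eLpNorm (fderiv ℝ u) p μ) *
        (eLpNorm v p' μ + eLpNorm (fderiv ℝ v) p' μ) := by
    calc _ ≤ ∫⁻ x in {x | d x < ε}, ENNReal.ofReal (θ (d x)) *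
          (‖u x‖ₑ * ‖v x‖ₑ + (‖u x‖ₑ * ‖fderiv ℝ v x‖ₑ + ‖fderiv ℝ u x‖ₑ * ‖v x‖ₑ)) := by
          refine setLIntegral_mono' (isOpen_lt h.lipschitz.continuous
            continuous_const).measurableSet fun x (hx : d x < ε) => ?_
          rw [enorm_mul]
          gcongr
          exact enorm_fderiv_mul_le (hu x hx) (hv x hx)
      _ = ∫⁻ x, (‖u x‖ₑ * ‖v x‖ₑ + (‖u x‖ₑ * ‖fderiv ℝ v x‖ₑ + ‖fderiv ℝ u x‖ₑ * ‖v x‖ₑ)) ∂μ :=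
          (lintegral_wMeas hθm (huv.add (huv'.add huv''))).symm
      _ = ∫⁻ x, ‖u x‖ₑ * ‖v x‖ₑ ∂μ + (∫⁻ x, ‖u x‖ₑ * ‖fderiv ℝ v x‖ₑ ∂μ +
            ∫⁻ x, ‖fderiv ℝ u x‖ₑ * ‖v x‖ₑ ∂μ) := by
          rw [lintegral_add_left huv, lintegral_add_left huv']
      _ ≤ eLpNorm u p μ * eLpNorm v p' μ + (eLpNorm u p μ * eLpNorm (fderiv ℝ v) p' μ +
            eLpNorm (fderiv ℝ u) p μ * eLpNorm v p' μ) := by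
          have hu₀ := hum.norm.aestronglyMeasurable (μ := μ)
          have hu₁ := (measurable_norm_fderiv u).aestronglyMeasurable (μ := μ)
          have hv₀ := hvm.norm.aestronglyMeasurable (μ := μ)
          have hv₁ := (measurable_norm_fderiv v).aestronglyMeasurable (μ := μ)
          gcongr
          · exact lintegral_enorm_mul_enorm_le hp' hu₀ hv₀
          · exact lintegral_enorm_mul_enorm_le hp' hu₀ hv₁
          · exact lintegral_enorm_mul_enorm_le hp' hu₁ hv₀
      _ ≤ _ := by
          rw [add_mul, mul_add, add_assoc]
          gcongr
          exact le_self_add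
  have hC : ENNReal.ofReal (K / m) +
      (1 + ENNReal.ofReal (ε / 4)) * 2 ^ n / ENNReal.ofReal (ε / 4) ≤ C₁ := by
    rw [hC₁]
    gcongr
  refine (h.lintegral_layer_le hθ hm hmθ (fun x hx => (hu x hx).mul (hv x hx))
    (hum.mul hvm)).trans ?_
  set Xp := eLpNorm u p μ + eLpNorm (fderiv ℝ u) p μ
  set V := eLpNorm v p' μ + eLpNorm (fderiv ℝ v) p' μ
  calc _ ≤ C₁ * (Xp * V) := mul_le_mul' hC hbulk
    _ = C₁ * (ENNReal.ofReal r ^ b)⁻¹ * (ENNReal.ofReal r ^ b * Xp) * V := by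
        have := ENNReal.inv_mul_cancel hrb hrb'
        calc C₁ * (Xp * V) = C₁ * ((ENNReal.ofReal r ^ b)⁻¹ * ENNReal.ofReal r ^ b) * Xp * V := by
              rw [this]; ring
          _ = _ := by ring
    _ ≤ _ := by gcongr

end IsSignedDist

namespace IsProfile

variable {θ : ℝ → ℝ} {ε : ℝ} {K : NNReal}

theorem fderiv_comp_eq_zero {E : Type*} [NormedAddCommGroup E] [NormedSpace ℝ E]
    (hθ : IsProfile θ ε K) {d : E → ℝ} {x : E} (hx : d x = -ε) :
    fderiv ℝ (fun y => θ (d y)) x = 0 :=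
  IsLocalMax.fderiv_eq_zero (Eventually.of_forall fun y => by
    show θ (d y) ≤ θ (d x)
    rw [hx, hθ.eq_one _ le_rfl]
    exact hθ.le_one _)

theorem norm_fderiv_comp {E : Type*} [NormedAddCommGroup E] [NormedSpace ℝ E]
    (hθ : IsProfile θ ε K) {d : E → ℝ} {x : E} (hx : |d x| < ε) (hd : DifferentiableAt ℝ d x) :
    ‖fderiv ℝ (fun y => θ (d y)) x‖ = -deriv θ (d x) * ‖fderiv ℝ d x‖ := by
  have h := ((hθ.differentiableAt hx).hasDerivAt.comp_hasFDerivAt x hd.hasFDerivAt).fderiv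
  rw [show (fun y => θ (d y)) = θ ∘ d from rfl, h, norm_smul, Real.norm_eq_abs,
    abs_of_nonpos (hθ.deriv_nonpos _)]

theorem setIntegral_layer_eq {n : ℕ} (hθ : IsProfile θ ε K) {d : EuclideanSpace ℝ (Fin n) → ℝ}
    (hd : Continuous d) (f : EuclideanSpace ℝ (Fin n) → ℝ) :
    ∫ x in {x | d x < ε} \ closure {x | d x < -ε}, f x * ‖fderiv ℝ (fun y => θ (d y)) x‖ =
      ∫ x in {x | |d x| < ε}, f x * ‖fderiv ℝ (fun y => θ (d y)) x‖ := by
  refine setIntegral_eq_of_subset_of_forall_sdiff_eq_zero (s := {x | |d x| < ε})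
    (t := {x | d x < ε} \ closure {x | d x < -ε})
    (f := fun x => f x * ‖fderiv ℝ (fun y => θ (d y)) x‖)
    ((isOpen_lt hd continuous_const).measurableSet.diff isClosed_closure.measurableSet)
    (fun x (hx : |d x| < ε) => ⟨(abs_lt.1 hx).2, fun hc => ?_⟩) fun x hx => ?_
  · have h1 : d x ≤ -ε := closure_minimal (fun y (hy : d y < -ε) => hy.le)
      (isClosed_le hd continuous_const) hc
    linarith [(abs_lt.1 hx).1]
  · obtain ⟨⟨h1, h2⟩, h3⟩ := hx
    have h1 : d x < ε := h1
    have h2 : -ε ≤ d x := not_lt.1 fun hlt => h2 (subset_closure hlt)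
    have h3 : ¬ |d x| < ε := h3
    have h4 : d x = -ε := by
      refine le_antisymm (not_lt.1 fun hlt => h3 (abs_lt.2 ⟨hlt, h1⟩)) h2
    show f x * ‖fderiv ℝ (fun y => θ (d y)) x‖ = 0
    rw [hθ.fderiv_comp_eq_zero h4, norm_zero, mul_zero]

end IsProfile

namespace IsSignedDist

variable {n : ℕ} {D : Set (EuclideanSpace ℝ (Fin n))} {d : EuclideanSpace ℝ (Fin n) → ℝ}
  {θ : ℝ → ℝ} {ε : ℝ} {K : NNReal}

theorem enorm_setIntegral_layer_le (h : IsSignedDist D d) (hθ : IsProfile θ ε K)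
    (f : EuclideanSpace ℝ (Fin n) → ℝ) :
    ‖∫ x in {x | |d x| < ε}, f x * ‖fderiv ℝ (fun y => θ (d y)) x‖‖ₑ ≤
      ∫⁻ x in {x | |d x| < ε}, ENNReal.ofReal (-deriv θ (d x)) * ‖f x‖ₑ := by
  refine (enorm_integral_le_lintegral_enorm _).trans (lintegral_mono_ae ?_)
  rw [ae_restrict_iff' (isOpen_lt h.lipschitz.continuous.abs continuous_const).measurableSet]
  filter_upwards [h.lipschitz.ae_differentiableAt (μ := volume)] with x hx (hxε : |d x| < ε)
  rw [enorm_mul, mul_comm]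
  gcongr
  rw [hθ.norm_fderiv_comp hxε hx, Real.enorm_eq_ofReal
    (mul_nonneg (neg_nonneg.2 (hθ.deriv_nonpos _)) (norm_nonneg _))]
  refine ENNReal.ofReal_le_ofReal (mul_le_of_le_one_right (neg_nonneg.2 (hθ.deriv_nonpos _)) ?_)
  simpa using norm_fderiv_le_of_lipschitz ℝ h.lipschitz (x₀ := x)

end IsSignedDist

theorem IsNormalTube.setIntegral_layer_eq {n : ℕ} {d : EuclideanSpace ℝ (Fin n) → ℝ} {ρ L : ℝ}
    (h : IsNormalTube d (gradient d) ρ L) (hd : ∀ x, |d x| < ρ → DifferentiableAt ℝ d x)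
    {θ : ℝ → ℝ} {ε : ℝ} {K : NNReal} (hθ : IsProfile θ ε K) (hερ : ε ≤ ρ)
    (f : EuclideanSpace ℝ (Fin n) → ℝ) :
    ∫ x in {x | |d x| < ε}, f x * ‖fderiv ℝ (fun y => θ (d y)) x‖ =
      -∫ x in {x | |d x| < ε}, deriv θ (d x) * f x := by
  rw [← integral_neg]
  refine setIntegral_congr_fun (isOpen_lt h.continuous.abs continuous_const).measurableSet
    fun x (hx : |d x| < ε) => ?_
  show f x * _ = -(deriv θ (d x) * f x)
  rw [hθ.norm_fderiv_comp hx (hd x (hx.trans_le hερ)), ← norm_gradient,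
    h.norm_eq x (hx.trans_le hερ)]
  ring

/-- Passage from an extended nonnegative estimate to a real one. -/
theorem le_of_enorm_le_mul_add_mul {I ε a b : ℝ} {C X Y V : ℝ≥0∞} (hε : 0 < ε) (hC : C ≠ ⊤)
    (hX : X ≠ ⊤) (hY : Y ≠ ⊤) (hV : V ≠ ⊤)
    (h : ‖I‖ₑ ≤ C * (ENNReal.ofReal ε ^ a * X + ENNReal.ofReal ε ^ b * Y) * V) :
    I ≤ C.toReal * (ε ^ a * X.toReal + ε ^ b * Y.toReal) * V.toReal := by
  rw [ENNReal.ofReal_rpow_of_pos hε, ENNReal.ofReal_rpow_of_pos hε] at h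
  have h1 := ENNReal.toReal_mono (by finiteness) h
  rw [toReal_mul, toReal_mul, toReal_add (by finiteness) (by finiteness), toReal_mul, toReal_mul,
    toReal_ofReal (by positivity), toReal_ofReal (by positivity), toReal_enorm] at h1
  exact (le_abs_self I).trans h1

theorem eLpNorm_norm_fderiv {E F : Type*} [NormedAddCommGroup E] [NormedSpace ℝ E]
    [MeasurableSpace E] [NormedAddCommGroup F] [NormedSpace ℝ F] (f : E → F) (p : ℝ≥0∞)
    (μ : Measure E) : eLpNorm (fun x => ‖fderiv ℝ f x‖) p μ = eLpNorm (fderiv ℝ f) p μ :=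
  eLpNorm_norm _

/-- Refined estimate for the diffuse boundary integral of a product `u v` where `u`
vanishes on `∂D`: Theorem 4.8 of the paper. -/
theorem diffuse_boundary_product_estimate
    (n : ℕ) (hn : 2 ≤ n)
    (D : Set (EuclideanSpace ℝ (Fin n)))
    (hD_open : IsOpen D) (hD_bdd : Bornology.IsBounded D) (hD_ne : D.Nonempty)
    (dD : EuclideanSpace ℝ (Fin n) → ℝ)
    (hdD : ∀ x, dD x = Metric.infDist x D - Metric.infDist x Dᶜ)
    (Dt : ℝ → Set (EuclideanSpace ℝ (Fin n)))
    (hDt : ∀ t, Dt t = {x | dD x < t})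
    (Γ : ℝ → Set (EuclideanSpace ℝ (Fin n)))
    (hΓ : ∀ ε : ℝ, Γ ε = Dt ε \ closure (Dt (-ε)))
    (ε₀ : ℝ) (hε₀ : 0 < ε₀)
    (hproj : ∀ z ∈ Γ (2 * ε₀), ∃! y, y ∈ frontier D ∧ dist z y = Metric.infDist z (frontier D))
    (hC11 : ∃ U : Set (EuclideanSpace ℝ (Fin n)), IsOpen U ∧ frontier D ⊆ U ∧
      ContDiffOn ℝ 1 dD U ∧ ∃ L : NNReal, LipschitzOnWith L (fun x => fderiv ℝ dD x) U)
    (S : ℝ → ℝ) (ζ₁ ζ₂ α : ℝ) (hζ₁ : 0 < ζ₁) (hζ₂ : 0 < ζ₂) (hα : 0 < α)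
    (hS_lip : ∃ L : NNReal, LipschitzWith L S)
    (hS_sign : ∀ t : ℝ, 1 ≤ |t| → S t = t / |t|)
    (hS_pos : ∀ t : ℝ, |t| < 1 → 0 < deriv S t)
    (hS_odd : ∀ t : ℝ, S (-t) = -S t)
    (hS2 : ∀ t ∈ Set.Ioo (0:ℝ) 2,
      ζ₁ * t ^ α ≤ (1 + S (t - 1)) / 2 ∧ (1 + S (t - 1)) / 2 ≤ ζ₂ * t ^ α)
    (hS3 : ∀ s t : ℝ, 0 ≤ s → s ≤ t → t < 1 → deriv S t ≤ deriv S s)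
    (ω : ℝ → EuclideanSpace ℝ (Fin n) → ℝ)
    (hω : ∀ ε : ℝ, 0 < ε → ∀ x, ω ε x = (1 + S (-(dD x) / ε)) / 2)
    (p q p' q' : ℝ≥0∞) (hp : 1 ≤ p) (hpq : p ≤ q)
    (hp' : 1 / p + 1 / p' = 1) (hq' : 1 / q + 1 / q' = 1) :
    ∃ C : ℝ, 0 < C ∧ ∀ ε ∈ Set.Ioc (0:ℝ) ε₀,
      ∀ u v : EuclideanSpace ℝ (Fin n) → ℝ, Measurable u → Measurable v →
        (∀ x ∈ Dt ε, DifferentiableAt ℝ u x) →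
        (∀ x ∈ Dt ε, DifferentiableAt ℝ (fun y => fderiv ℝ u y) x) →
        (∀ x ∈ frontier D, u x = 0) →
        (∀ x ∈ Dt ε, DifferentiableAt ℝ v x) →
        eLpNorm u q (wMeas (Dt ε) (ω ε)) +
          eLpNorm (fun x => ‖fderiv ℝ u x‖) q (wMeas (Dt ε) (ω ε)) +
          eLpNorm (fun x => ‖fderiv ℝ (fun y => fderiv ℝ u y) x‖) q
            (wMeas (Dt ε) (ω ε)) < ⊤ →
        eLpNorm u p (wMeas (Dt ε) (ω ε)) +
          eLpNorm (fun x => ‖fderiv ℝ u x‖) p (wMeas (Dt ε) (ω ε)) +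
          eLpNorm (fun x => ‖fderiv ℝ (fun y => fderiv ℝ u y) x‖) p
            (wMeas (Dt ε) (ω ε)) < ⊤ →
        eLpNorm v p' (wMeas (Dt ε) (ω ε)) +
          eLpNorm (fun x => ‖fderiv ℝ v x‖) p' (wMeas (Dt ε) (ω ε)) < ⊤ →
        (∫ x in Γ ε, u x * v x * ‖fderiv ℝ (ω ε) x‖) ≤
          C * (ε ^ (1 + (1 / q').toReal) *
                 (eLpNorm u q (wMeas (Dt ε) (ω ε)) +
                   eLpNorm (fun x => ‖fderiv ℝ u x‖) q (wMeas (Dt ε) (ω ε)) +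
                   eLpNorm (fun x => ‖fderiv ℝ (fun y => fderiv ℝ u y) x‖) q
                     (wMeas (Dt ε) (ω ε))).toReal +
               ε ^ (1 + (1 / p).toReal) *
                 (eLpNorm u p (wMeas (Dt ε) (ω ε)) +
                   eLpNorm (fun x => ‖fderiv ℝ u x‖) p (wMeas (Dt ε) (ω ε)) +
                   eLpNorm (fun x => ‖fderiv ℝ (fun y => fderiv ℝ u y) x‖) p
                     (wMeas (Dt ε) (ω ε))).toReal) *
            (eLpNorm v p' (wMeas (Dt ε) (ω ε)) +
              eLpNorm (fun x => ‖fderiv ℝ v x‖) p' (wMeas (Dt ε) (ω ε))).toReal := by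
  obtain ⟨LS, hLS⟩ := hS_lip
  obtain ⟨U, hU, hFU, hUd, LU, hLU⟩ := hC11
  have : Nontrivial (EuclideanSpace ℝ (Fin n)) := by
    have : NeZero n := ⟨by omega⟩
    infer_instance
  have hD_compl : Dᶜ.Nonempty := nonempty_compl.2 fun hD =>
    NormedSpace.unbounded_univ ℝ (EuclideanSpace ℝ (Fin n)) (hD ▸ hD_bdd)
  have hd : IsSignedDist D dD := isSignedDist_of_eq hD_open hD_ne hD_compl hdD
  obtain ⟨ρ, L, hρ, hρL, htube, htube_diff⟩ :=
    hd.exists_isNormalTube hD_bdd hU hFU (hUd.differentiableOn one_ne_zero) hLU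
  have hvol : volume {x | dD x < ρ} ≠ ⊤ := by
    refine ((hD_bdd.cthickening (δ := ρ)).subset fun x (hx : dD x < ρ) => ?_).measure_lt_top.ne
    by_cases hxD : x ∈ D
    · exact Metric.self_subset_cthickening D hxD
    · rw [hdD, Metric.infDist_zero_of_mem (s := Dᶜ) hxD, sub_zero] at hx
      obtain ⟨y, hy, hxy⟩ := (Metric.infDist_lt_iff hD_ne).1 hx
      exact Metric.mem_cthickening_of_dist_le x y ρ D hy hxy.le
  set m := (1 + S (-1 / 2)) / 2 with hm_def
  have hm : 0 < m := by
    have := (hS2 (1 / 2) ⟨by norm_num, by norm_num⟩).1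
    rw [show (1 / 2 - 1 : ℝ) = -1 / 2 by norm_num] at this
    exact lt_of_lt_of_le (by positivity) this
  have hθ : ∀ ε : ℝ, 0 < ε → IsProfile (fun t => (1 + S (-t / ε)) / 2) ε
      (LS * Real.toNNReal (1 / (2 * ε))) :=
    fun ε hε => IsProfile.of_transition hLS hS_sign hS_pos hS_odd hε
  obtain ⟨C₁, hC₁, hthin⟩ := htube.exists_enorm_setIntegral_le hρ hρL hvol hp hpq hp' hq'
  obtain ⟨C₂, hC₂, hthick⟩ := hd.exists_lintegral_layer_mul_le (ε₀ := ε₀) hp' (half_pos hρ) hm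
    (LS * Real.toNNReal (1 / (2 * (ρ / 2))))
  refine ⟨(C₁ + C₂ + 1).toReal, toReal_pos (by simp) (by finiteness), fun ε hε u v hum hvm hu hu'
    hu0 hv hXq hXp hV => le_of_enorm_le_mul_add_mul hε.1 (by finiteness) hXq.ne hXp.ne hV.ne ?_⟩
  have hωε : ω ε = fun x => (fun t => (1 + S (-t / ε)) / 2) (dD x) := funext (hω ε hε.1)
  have hθε := hθ ε hε.1
  set θ := fun t => (1 + S (-t / ε)) / 2 with hθ_def
  rw [hΓ, hDt, hDt, hωε, hθε.setIntegral_layer_eq hd.lipschitz.continuous]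
  simp only [hDt] at hu hu' hv
  simp only [eLpNorm_norm_fderiv]
  rcases le_or_gt ε (ρ / 2) with hερ | hερ
  · rw [htube.setIntegral_layer_eq htube_diff hθε (by linarith), enorm_neg]
    refine (hthin θ ε _ hθε hερ u v hum hvm hu hu' (fun x hx => hu0 x ((hd.zero_iff x).1 hx))
      hv).trans ?_
    gcongr
    rw [add_assoc]
    exact le_self_add
  · refine (hd.enorm_setIntegral_layer_le hθε _).trans ?_
    have hθm : m ≤ θ (ε / 2) := by
      have hε0 : ε ≠ 0 := hε.1.ne'
      have : -(ε / 2) / ε = -1 / 2 := by field_simp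
      show m ≤ (1 + S (-(ε / 2) / ε)) / 2
      rw [this]
    refine (hthick θ ε _ hθε hερ.le hε.2 (by gcongr) hθm u v hum hvm hu hv).trans ?_
    gcongr
    · exact (le_add_self).trans le_self_add
    · exact le_trans (mul_le_mul_right le_self_add _) le_add_self
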